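/- arXiv:2506.04955 — 2 statements merged into one kernel-verified Lean document; each statement's English description precedes it below -/
import Mathlib

section
/- Let Γ be the Cayley graph of a group G with respect to a finite generating set S, let δ_G be the critical exponent of the action of G on Γ, and fix 0 < λ < 1. If the Floyd boundary ∂_λΓ is non-trivial (|∂_λΓ| > 3), then the Hausdorff dimension of the Myrberg limit set of G, with respect to the Floyd metric on ∂_λΓ, equals δ_G/(−log λ) (which is the full Hausdorff dimension of ∂_λΓ). -/
/-!
STATEMENT 9. Let `Γ` be the Cayley graph of a group `G` with respect to a finite generating
set `S`, let `δ_G` be the critical exponent of the action of `G` on `Γ`, and fix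
`0 < λ < 1`.  If the Floyd boundary `∂_λΓ` is non-trivial (`|∂_λΓ| > 3`), then the Hausdorff
dimension of the Myrberg limit set of `G`, with respect to the Floyd metric on `∂_λΓ`,
equals `δ_G/(−log λ)` (the full Hausdorff dimension of `∂_λΓ`).

The Floyd compactification is encoded as a complete metric space `B` together with a map
`ι : G → B` with dense range realizing the Floyd metric on the vertices; the Floyd boundary
is the complement of the image, and the (uniformly continuous, hence continuously extended)
left translation action on the compactification is given as data.
-/

open Filter Set

noncomputable section

namespace Floyd

variable {G : Type*} [Group G] [DecidableEq G]

/-- The word length of `g` with respect to the generating set `S`. -/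
def wlen (S : Finset G) (g : G) : ℕ :=
  sInf {n : ℕ | ∃ l : List G, (∀ x ∈ l, x ∈ S) ∧ l.length = n ∧ l.prod = g}

/-- The word metric on the Cayley graph of `(G, S)`. -/
def wd (S : Finset G) (x y : G) : ℕ := wlen S (x⁻¹ * y)

/-- The Floyd length of a vertex path `l` in the Cayley graph, with rescaling parameter
`lam`: each edge `{u,v}` has length `lam^{d(1,{u,v})}`. -/
def floydLen (S : Finset G) (lam : ℝ) (l : List G) : ℝ :=
  ((l.zip l.tail).map (fun p => lam ^ (min (wlen S p.1) (wlen S p.2)))).sum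

/-- `l` is an edge path in the Cayley graph from `x` to `y`. -/
def IsPath (S : Finset G) (x y : G) (l : List G) : Prop :=
  l.Chain' (fun u v => wd S u v = 1) ∧ l.head? = some x ∧ l.getLast? = some y

/-- The Floyd metric on the vertex set of the Cayley graph: infimal Floyd length of edge
paths. -/
def floydDist (S : Finset G) (lam : ℝ) (x y : G) : ℝ :=
  sInf {c : ℝ | ∃ l : List G, IsPath S x y l ∧ c = floydLen S lam l}

/-- `(B, ι)` is the Floyd compactification of `(G, S)` with parameter `lam`: a complete
metric space realizing the Floyd metric on the (dense) image of the vertex set. -/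
def IsFloydCompactification (S : Finset G) (lam : ℝ) (B : Type*) [MetricSpace B]
    (ι : G → B) : Prop :=
  CompleteSpace B ∧ DenseRange ι ∧
    ∀ x y : G, dist (ι x) (ι y) = floydDist S lam x y

/-- The Floyd boundary `∂_λ Γ ⊆ B`. -/
def floydBoundary {B : Type*} [MetricSpace B] (ι : G → B) : Set B :=
  (Set.range ι)ᶜ

/-- The limit set of `G` in its Floyd boundary. -/
def limitSet {B : Type*} [MetricSpace B] (ι : G → B) : Set B :=
  {b | b ∈ floydBoundary ι ∧ ∃ g : ℕ → G, Function.Injective g ∧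
    Tendsto (fun n => ι (g n)) atTop (nhds b)}

/-- `act` is the extension to the Floyd compactification of the left translation action of
`G` on itself. -/
def IsBoundaryAction {B : Type*} [MetricSpace B] (ι : G → B) (act : G → B → B) : Prop :=
  (∀ g : G, Continuous (act g)) ∧ ∀ g x : G, act g (ι x) = ι (g * x)

/-- The Myrberg limit set of `G` in its Floyd boundary: points `ξ` such that the `G`-orbit
of `(1, ξ)` accumulates on every pair of distinct limit points. -/
def myrbergSet {B : Type*} [MetricSpace B] (ι : G → B) (act : G → B → B) : Set B :=
  {ξ | ξ ∈ floydBoundary ι ∧ ∀ a ∈ limitSet ι, ∀ b ∈ limitSet ι, a ≠ b →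
    ∃ g : ℕ → G, Tendsto (fun n => ι (g n)) atTop (nhds a) ∧
      Tendsto (fun n => act (g n) ξ) atTop (nhds b)}

/-- The critical exponent `δ_G` of `G` acting on its Cayley graph. -/
def critExp (S : Finset G) : ℝ :=
  limsup (fun n : ℕ => Real.log (Set.ncard {g : G | wlen S g ≤ n}) / n) atTop

end Floyd

open Floyd MeasureTheory

namespace Floyd

section WordLength

variable {G : Type*} [Group G] {S : Finset G}

lemma wlen_prod_le {l : List G} (hl : ∀ x ∈ l, x ∈ S) : wlen S l.prod ≤ l.length :=
  Nat.sInf_le ⟨l, hl, rfl, rfl⟩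

lemma exists_word (hgen : Subgroup.closure (S : Set G) = ⊤) (hsymm : ∀ s ∈ S, s⁻¹ ∈ S) (g : G) :
    ∃ l : List G, (∀ x ∈ l, x ∈ S) ∧ l.length = wlen S g ∧ l.prod = g := by
  have hne : {n : ℕ | ∃ l : List G, (∀ x ∈ l, x ∈ S) ∧ l.length = n ∧ l.prod = g}.Nonempty := by
    have hg : g ∈ Subgroup.closure (S : Set G) := by rw [hgen]; trivial
    induction hg using Subgroup.closure_induction with
    | mem x hx => exact ⟨1, [x], by simpa using hx, rfl, by simp⟩
    | one => exact ⟨0, [], by simp, rfl, rfl⟩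
    | mul x y _ _ hx hy =>
      obtain ⟨_, l, hl, -, rfl⟩ := hx
      obtain ⟨_, l', hl', -, rfl⟩ := hy
      refine ⟨_, l ++ l', fun z hz => ?_, rfl, by simp⟩
      rcases List.mem_append.1 hz with h | h
      exacts [hl z h, hl' z h]
    | inv x _ hx =>
      obtain ⟨_, l, hl, -, rfl⟩ := hx
      refine ⟨_, (l.map (·⁻¹)).reverse, fun z hz => ?_, rfl, (List.prod_inv_reverse l).symm⟩
      simp only [List.mem_reverse, List.mem_map] at hz
      obtain ⟨y, hy, rfl⟩ := hz
      exact hsymm y (hl y hy)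
  exact Nat.sInf_mem hne

@[simp] lemma wlen_one : wlen S (1 : G) = 0 := by
  have := wlen_prod_le (S := S) (l := []) (by simp)
  simpa using this

lemma wlen_le_one {s : G} (hs : s ∈ S) : wlen S s ≤ 1 := by
  have := wlen_prod_le (S := S) (l := [s]) (by simpa using hs)
  simpa using this

variable (hgen : Subgroup.closure (S : Set G) = ⊤) (hsymm : ∀ s ∈ S, s⁻¹ ∈ S)
include hgen hsymm

lemma wlen_mul_le (g h : G) : wlen S (g * h) ≤ wlen S g + wlen S h := by
  obtain ⟨l, hl, hn, rfl⟩ := exists_word hgen hsymm g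
  obtain ⟨l', hl', hn', rfl⟩ := exists_word hgen hsymm h
  rw [← hn, ← hn', ← List.prod_append, ← List.length_append]
  apply wlen_prod_le
  intro x hx
  rcases List.mem_append.1 hx with h | h
  exacts [hl x h, hl' x h]

lemma wlen_inv_le (g : G) : wlen S g⁻¹ ≤ wlen S g := by
  obtain ⟨l, hl, hn, rfl⟩ := exists_word hgen hsymm g
  rw [← hn, List.prod_inv_reverse]
  refine (wlen_prod_le ?_).trans (by simp)
  intro x hx
  simp only [List.mem_reverse, List.mem_map] at hx
  obtain ⟨y, hy, rfl⟩ := hx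
  exact hsymm y (hl y hy)

lemma wlen_inv (g : G) : wlen S g⁻¹ = wlen S g :=
  le_antisymm (wlen_inv_le hgen hsymm g) (by simpa using wlen_inv_le hgen hsymm g⁻¹)

lemma wlen_le_mul_add (g h : G) : wlen S g ≤ wlen S (g * h) + wlen S h := by
  have := wlen_mul_le hgen hsymm (g * h) h⁻¹
  rwa [wlen_inv hgen hsymm, mul_inv_cancel_right] at this

lemma wlen_le_mul_add' (g h : G) : wlen S h ≤ wlen S (g * h) + wlen S g := by
  have := wlen_mul_le hgen hsymm g⁻¹ (g * h)
  rw [wlen_inv hgen hsymm, inv_mul_cancel_left] at this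
  omega

lemma wlen_inv_mul_comm (g h : G) : wlen S (g⁻¹ * h) = wlen S (h⁻¹ * g) := by
  rw [← wlen_inv hgen hsymm]; simp

/-- `γ` restricted to `[0, |g|]` is a geodesic from `1` to `g`. -/
lemma exists_geodesic (g : G) : ∃ γ : ℕ → G, γ 0 = 1 ∧ γ (wlen S g) = g ∧
    ∀ i j, i ≤ j → j ≤ wlen S g → wlen S ((γ i)⁻¹ * γ j) = j - i := by
  obtain ⟨l, hl, hn, hp⟩ := exists_word hgen hsymm g
  have key : ∀ i j, i ≤ j → j ≤ wlen S g →
      wlen S ((l.take i).prod⁻¹ * (l.take j).prod) ≤ j - i := by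
    intro i j hij hj
    have h1 : (l.take j).prod = (l.take i).prod * ((l.take j).drop i).prod := by
      rw [← List.prod_append]
      congr 1
      conv_lhs => rw [← List.take_append_drop i (l.take j)]
      rw [List.take_take, min_eq_left hij]
    rw [h1, inv_mul_cancel_left]
    refine (wlen_prod_le ?_).trans ?_
    · intro x hx
      exact hl x (List.mem_of_mem_take (List.mem_of_mem_drop hx))
    · simp; omega
  refine ⟨fun i => (l.take i).prod, by simp, by rw [← hn]; simpa using hp, ?_⟩
  intro i j hij hj
  refine le_antisymm (key i j hij hj) ?_
  have h1 := key 0 i (Nat.zero_le _) (hij.trans hj)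
  have h2 := key j _ hj le_rfl
  have h3 : (l.take (wlen S g)).prod = g := by rw [← hn]; simpa using hp
  have e : g = ((l.take 0).prod⁻¹ * (l.take i).prod) *
      (((l.take i).prod⁻¹ * (l.take j).prod) * ((l.take j).prod⁻¹ * g)) := by simp
  rw [h3] at h2
  have h4 := wlen_mul_le hgen hsymm ((l.take 0).prod⁻¹ * (l.take i).prod)
    (((l.take i).prod⁻¹ * (l.take j).prod) * ((l.take j).prod⁻¹ * g))
  have h5 := wlen_mul_le hgen hsymm ((l.take i).prod⁻¹ * (l.take j).prod) ((l.take j).prod⁻¹ * g)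
  rw [← e] at h4
  change _ ≤ wlen S ((l.take i).prod⁻¹ * (l.take j).prod)
  omega

lemma mem_of_wlen_eq_one {g : G} (h : wlen S g = 1) : g ∈ S := by
  obtain ⟨l, hl, hn, rfl⟩ := exists_word hgen hsymm g
  rw [h, List.length_eq_one_iff] at hn
  obtain ⟨a, rfl⟩ := hn
  simpa using hl a (by simp)

lemma ball_succ_subset (n : ℕ) :
    {g : G | wlen S g ≤ n + 1} ⊆
      Set.image2 (· * ·) {g : G | wlen S g ≤ n} (insert 1 (S : Set G)) := by
  intro g hg
  rcases Nat.lt_or_ge (wlen S g) (n + 1) with h | h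
  · exact ⟨g, Nat.lt_succ_iff.1 h, 1, by simp, by simp⟩
  · have hgn : wlen S g = n + 1 := le_antisymm hg h
    obtain ⟨γ, h0, h1, h2⟩ := exists_geodesic hgen hsymm g
    rw [hgn] at h1 h2
    refine ⟨γ n, ?_, (γ n)⁻¹ * g, Or.inr ?_, by simp⟩
    · have := h2 0 n (Nat.zero_le _) (Nat.le_succ _)
      simp [h0] at this
      exact this.le
    · apply mem_of_wlen_eq_one hgen hsymm
      have := h2 n (n + 1) (Nat.le_succ _) le_rfl
      rwa [h1, Nat.add_sub_cancel_left] at this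

lemma finite_ball (n : ℕ) : {g : G | wlen S g ≤ n}.Finite := by
  induction n with
  | zero =>
    refine (Set.finite_singleton (1 : G)).subset fun g hg => ?_
    obtain ⟨l, hl, hn, rfl⟩ := exists_word hgen hsymm g
    have : l.length = 0 := by rw [hn]; exact Nat.le_zero.1 hg
    rw [List.length_eq_zero_iff] at this
    simp [this]
  | succ n ih =>
    exact (ih.image2 _ (S.finite_toSet.insert 1)).subset (ball_succ_subset hgen hsymm n)

lemma ncard_ball_le (n : ℕ) : {g : G | wlen S g ≤ n}.ncard ≤ (S.card + 1) ^ n := by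
  induction n with
  | zero =>
    have : {g : G | wlen S g ≤ 0} ⊆ {1} := by
      intro g hg
      obtain ⟨l, hl, hn, rfl⟩ := exists_word hgen hsymm g
      have : l.length = 0 := by rw [hn]; exact Nat.le_zero.1 hg
      rw [List.length_eq_zero_iff] at this
      simp [this]
    simpa using Set.ncard_le_ncard this
  | succ n ih =>
    have hf := (finite_ball hgen hsymm n).prod (S.finite_toSet.insert 1)
    have h1 := Set.ncard_le_ncard (ball_succ_subset hgen hsymm n)
      ((finite_ball hgen hsymm n).image2 _ (S.finite_toSet.insert 1))
    rw [← Set.image_prod] at h1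
    have h2 := Set.ncard_image_le (f := fun x : G × G => x.1 * x.2) hf
    rw [Set.ncard_prod] at h2
    have h3 : (insert 1 (S : Set G)).ncard ≤ S.card + 1 := by
      simpa using Set.ncard_insert_le (1 : G) (S : Set G)
    calc _ ≤ _ := h1.trans h2
      _ ≤ (S.card + 1) ^ n * (S.card + 1) := Nat.mul_le_mul ih h3
      _ = _ := (pow_succ _ _).symm

lemma one_le_ncard_ball (n : ℕ) : 1 ≤ {g : G | wlen S g ≤ n}.ncard :=
  (Set.ncard_pos (finite_ball hgen hsymm n)).2 ⟨1, by simp⟩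

end WordLength

end Floyd

namespace Floyd

section FloydMetric

variable {G : Type*} [Group G] {S : Finset G} {lam : ℝ}

lemma floydLen_cons_cons (a b : G) (t : List G) :
    floydLen S lam (a :: b :: t) =
      lam ^ (min (wlen S a) (wlen S b)) + floydLen S lam (b :: t) := by
  simp [floydLen]

lemma floydLen_nonneg (h0 : 0 < lam) (l : List G) : 0 ≤ floydLen S lam l := by
  refine List.sum_nonneg fun x hx => ?_
  obtain ⟨p, -, rfl⟩ := List.mem_map.1 hx
  positivity

lemma floydDist_le (h0 : 0 < lam) {x y : G} {l : List G} (hl : IsPath S x y l) :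
    floydDist S lam x y ≤ floydLen S lam l :=
  csInf_le ⟨0, by rintro _ ⟨l, -, rfl⟩; exact floydLen_nonneg h0 l⟩ ⟨l, hl, rfl⟩

lemma floydLen_map_mul_le (hgen : Subgroup.closure (S : Set G) = ⊤)
    (hsymm : ∀ s ∈ S, s⁻¹ ∈ S) (h0 : 0 < lam) (h1 : lam < 1) (g : G) (l : List G) :
    lam ^ wlen S g * floydLen S lam (l.map (g * ·)) ≤ floydLen S lam l := by
  induction l with
  | nil => simp [floydLen]
  | cons a t ih =>
    cases t with
    | nil => simp [floydLen]
    | cons b t =>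
      simp only [List.map_cons] at ih ⊢
      rw [floydLen_cons_cons, floydLen_cons_cons, mul_add]
      refine add_le_add ?_ ih
      rw [← pow_add]
      apply pow_le_pow_of_le_one h0.le h1.le
      have h2 := wlen_le_mul_add' hgen hsymm g a
      have h3 := wlen_le_mul_add' hgen hsymm g b
      omega

lemma IsPath.map_mul {x y : G} {l : List G} (hl : IsPath S x y l) (g : G) :
    IsPath S (g * x) (g * y) (l.map (g * ·)) := by
  obtain ⟨h1, h2, h3⟩ := hl
  refine ⟨?_, by simp [h2], by simp [h3]⟩
  show List.IsChain _ _
  rw [List.isChain_map]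
  refine List.IsChain.imp (fun a b hab => ?_) h1
  simpa [wd, mul_assoc] using hab

variable (hgen : Subgroup.closure (S : Set G) = ⊤) (hsymm : ∀ s ∈ S, s⁻¹ ∈ S)
include hgen hsymm

lemma wlen_eq_one_of_mem (hS1 : (1 : G) ∉ S) {s : G} (hs : s ∈ S) : wlen S s = 1 := by
  refine le_antisymm (wlen_le_one hs) (Nat.one_le_iff_ne_zero.2 fun h => ?_)
  obtain ⟨l, -, hn, rfl⟩ := exists_word hgen hsymm s
  rw [h, List.length_eq_zero_iff] at hn
  subst hn
  exact hS1 (by simpa using hs)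

lemma exists_isPath (hS1 : (1 : G) ∉ S) (x y : G) : ∃ l, IsPath S x y l := by
  obtain ⟨l, hl, -, hp⟩ := exists_word hgen hsymm (x⁻¹ * y)
  obtain rfl : y = x * l.prod := by rw [hp]; simp
  clear hp
  induction l generalizing x with
  | nil => exact ⟨[x], List.isChain_singleton _, by simp, by simp⟩
  | cons s l ih =>
    obtain ⟨p, h1, h2, h3⟩ := ih (x * s) fun z hz => hl z (List.mem_cons_of_mem _ hz)
    cases p with
    | nil => simp at h2
    | cons a p =>
      obtain rfl : a = x * s := by simpa using h2
      refine ⟨x :: (x * s) :: p, ?_, by simp, ?_⟩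
      · show List.IsChain _ _
        refine List.IsChain.cons_cons ?_ h1
        simpa [wd] using wlen_eq_one_of_mem hgen hsymm hS1 (hl s (by simp))
      · rw [List.getLast?_cons_cons, h3]; simp [mul_assoc]

lemma le_floydDist (hS1 : (1 : G) ∉ S) {x y : G} {c : ℝ}
    (h : ∀ l, IsPath S x y l → c ≤ floydLen S lam l) : c ≤ floydDist S lam x y := by
  obtain ⟨l, hl⟩ := exists_isPath hgen hsymm hS1 x y
  refine le_csInf ⟨_, l, hl, rfl⟩ ?_
  rintro _ ⟨l, hl, rfl⟩
  exact h l hl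

end FloydMetric

/-- The properties of the Floyd compactification of a Cayley graph used below. -/
structure FloydSpace {G : Type*} [Group G] (S : Finset G) (lam : ℝ) {B : Type*} [MetricSpace B]
    (ι : G → B) : Prop where
  gen : Subgroup.closure (S : Set G) = ⊤
  symm : ∀ s ∈ S, s⁻¹ ∈ S
  pos : 0 < lam
  lt_one : lam < 1
  complete : CompleteSpace B
  dense : DenseRange ι
  edge : ∀ x, ∀ s ∈ S, dist (ι x) (ι (x * s)) ≤ lam ^ min (wlen S x) (wlen S (x * s))
  smul : ∀ g x y, lam ^ wlen S g * dist (ι (g * x)) (ι (g * y)) ≤ dist (ι x) (ι y)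
  isolated : ∀ x y, x ≠ y → lam ^ wlen S x ≤ dist (ι x) (ι y)

lemma IsFloydCompactification.floydSpace {G : Type*} [Group G] {S : Finset G}
    (hgen : Subgroup.closure (S : Set G) = ⊤) (hsymm : ∀ s ∈ S, s⁻¹ ∈ S) (hS1 : (1 : G) ∉ S)
    {lam : ℝ} (h0 : 0 < lam) (h1 : lam < 1) {B : Type*} [MetricSpace B] {ι : G → B}
    (hcomp : IsFloydCompactification S lam B ι) : FloydSpace S lam ι where
  gen := hgen
  symm := hsymm
  pos := h0
  lt_one := h1
  complete := hcomp.1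
  dense := hcomp.2.1
  edge x s hs := by
    rw [hcomp.2.2]
    have hp : IsPath S x (x * s) [x, x * s] := by
      refine ⟨?_, by simp, by simp⟩
      show List.IsChain _ _
      simpa [wd] using wlen_eq_one_of_mem hgen hsymm hS1 hs
    refine (floydDist_le h0 hp).trans ?_
    simp [floydLen]
  smul g x y := by
    rw [hcomp.2.2, hcomp.2.2]
    refine le_floydDist hgen hsymm hS1 fun l hl => ?_
    refine le_trans ?_ (floydLen_map_mul_le hgen hsymm h0 h1 g l)
    gcongr
    exact floydDist_le h0 (hl.map_mul g)
  isolated x y hxy := by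
    rw [hcomp.2.2]
    refine le_floydDist hgen hsymm hS1 fun l hl => ?_
    obtain ⟨-, h2, h3⟩ := hl
    match l, h2, h3 with
    | [a], h2, h3 =>
      simp at h2 h3
      exact absurd (h2.symm.trans h3) hxy
    | a :: b :: t, h2, h3 =>
      obtain rfl : a = x := by simpa using h2
      rw [floydLen_cons_cons]
      have := floydLen_nonneg (S := S) h0 (b :: t)
      have h4 : lam ^ wlen S a ≤ lam ^ min (wlen S a) (wlen S b) :=
        pow_le_pow_of_le_one h0.le h1.le (min_le_left _ _)
      linarith

end Floyd

namespace Floyd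

/-- `γ` restricted to `[0, |g|]` is a geodesic from `1` to `g`. -/
def IsGeodesicTo {G : Type*} [Group G] (S : Finset G) (γ : ℕ → G) (g : G) : Prop :=
  γ 0 = 1 ∧ γ (wlen S g) = g ∧
    ∀ i j, i ≤ j → j ≤ wlen S g → wlen S ((γ i)⁻¹ * γ j) = j - i

lemma IsGeodesicTo.wlen_eq {G : Type*} [Group G] {S : Finset G} {γ : ℕ → G} {g : G}
    (hγ : IsGeodesicTo S γ g) {k : ℕ} (hk : k ≤ wlen S g) : wlen S (γ k) = k := by
  have := hγ.2.2 0 k (Nat.zero_le _) hk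
  simpa [hγ.1] using this

lemma dist_le_of_geometric {X : Type*} [PseudoMetricSpace X] (p : ℕ → X) (n : ℕ) {C μ : ℝ}
    (hC : 0 ≤ C) (h0 : 0 ≤ μ) (h1 : μ < 1) (h : ∀ i < n, dist (p i) (p (i + 1)) ≤ C * μ ^ i) :
    dist (p 0) (p n) ≤ C / (1 - μ) := by
  refine (dist_le_range_sum_of_dist_le n (d := fun i => C * μ ^ i) fun {k} hk => h k hk).trans ?_
  rw [← Finset.mul_sum, div_eq_mul_inv]
  gcongr
  rw [← tsum_geometric_of_lt_one h0 h1]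
  exact (summable_geometric_of_lt_one h0 h1).sum_le_tsum _ fun i _ => pow_nonneg h0 i

namespace FloydSpace

variable {G : Type*} [Group G] {S : Finset G} {lam : ℝ} {B : Type*} [MetricSpace B]
  {ι : G → B} (H : FloydSpace S lam ι)
include H

lemma exists_geodesicTo (g : G) : ∃ γ, IsGeodesicTo S γ g := exists_geodesic H.gen H.symm g

lemma mul_le (g h : G) : wlen S (g * h) ≤ wlen S g + wlen S h := wlen_mul_le H.gen H.symm g h

lemma inv_eq (g : G) : wlen S g⁻¹ = wlen S g := wlen_inv H.gen H.symm g

lemma pow_anti {m n : ℕ} (h : m ≤ n) : lam ^ n ≤ lam ^ m :=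
  pow_le_pow_of_le_one H.pos.le H.lt_one.le h

lemma dist_step {γ : ℕ → G} {g : G} (hγ : IsGeodesicTo S γ g) (x : G) {i m : ℕ}
    (hi : i < wlen S g) (h1 : m ≤ wlen S (x * γ i)) (h2 : m ≤ wlen S (x * γ (i + 1))) :
    dist (ι (x * γ i)) (ι (x * γ (i + 1))) ≤ lam ^ m := by
  have h3 := hγ.2.2 i (i + 1) (Nat.le_succ _) hi
  rw [Nat.add_sub_cancel_left] at h3
  have h4 := H.edge (x * γ i) _ (mem_of_wlen_eq_one H.gen H.symm h3)
  have h5 : x * γ i * ((γ i)⁻¹ * γ (i + 1)) = x * γ (i + 1) := by group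
  rw [h5] at h4
  exact h4.trans (H.pow_anti (le_min h1 h2))

/-- Karlsson's lemma: geodesics that are far from the identity are short in the Floyd metric. -/
lemma exists_geodesic_near {ε : ℝ} (hε : 0 < ε) : ∃ R : ℕ, ∀ x z : G, ∀ γ, IsGeodesicTo S γ z →
    ε ≤ dist (ι x) (ι (x * z)) → ∃ k ≤ wlen S z, wlen S (x * γ k) ≤ R := by
  obtain ⟨μ, hμ0, hμ1, hμ⟩ : ∃ μ : ℝ, 0 < μ ∧ μ < 1 ∧ μ ^ 4 = lam := by
    refine ⟨√√lam, by have := H.pos; positivity, ?_, ?_⟩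
    · rw [Real.sqrt_lt' one_pos, Real.sqrt_lt' (by norm_num)]
      simpa using H.lt_one
    · have : (√√lam) ^ 4 = ((√√lam) ^ 2) ^ 2 := by ring
      rw [this, Real.sq_sqrt (Real.sqrt_nonneg _), Real.sq_sqrt H.pos.le]
  have hμ' : 0 < 1 - μ := by linarith
  obtain ⟨R, hR⟩ := exists_pow_lt_of_lt_one (show 0 < ε * (1 - μ) / 2 by positivity) hμ1
  refine ⟨R, fun x z γ hγ hd => ?_⟩
  by_contra! hcon
  obtain ⟨k, hk, hmin⟩ := Finset.exists_min_image (Finset.range (wlen S z + 1))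
    (fun i => wlen S (x * γ i)) ⟨0, by simp⟩
  set r := wlen S (x * γ k) with hr
  have hkn : k ≤ wlen S z := by simpa [Nat.lt_succ_iff] using hk
  have hRr : R < r := hcon k hkn
  have key : ∀ i ≤ wlen S z, 2 * r + (i - k) ≤ 4 * wlen S (x * γ i) ∧
      2 * r + (k - i) ≤ 4 * wlen S (x * γ i) := by
    intro i hi
    have h1 : r ≤ wlen S (x * γ i) := hmin i (by simpa [Nat.lt_succ_iff] using hi)
    have h2 : wlen S ((γ i)⁻¹ * γ k) ≤ wlen S (x * γ i) + r := by
      have h := H.mul_le (x * γ i)⁻¹ (x * γ k)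
      rw [H.inv_eq] at h
      have e : (x * γ i)⁻¹ * (x * γ k) = (γ i)⁻¹ * γ k := by group
      rwa [e] at h
    rcases le_total i k with hik | hik
    · rw [hγ.2.2 i k hik hkn] at h2
      omega
    · rw [wlen_inv_mul_comm H.gen H.symm, hγ.2.2 k i hik hi] at h2
      omega
  have hpow : ∀ m a : ℕ, m ≤ 4 * a → lam ^ a ≤ μ ^ m := by
    intro m a h
    rw [← hμ, ← pow_mul]
    exact pow_le_pow_of_le_one hμ0.le hμ1.le h
  have hstep : ∀ i < wlen S z, ∀ m, m ≤ 4 * wlen S (x * γ i) → m ≤ 4 * wlen S (x * γ (i + 1)) →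
      dist (ι (x * γ i)) (ι (x * γ (i + 1))) ≤ μ ^ m := by
    intro i hi m h1 h2
    refine (H.dist_step hγ x hi (min_le_left _ (wlen S (x * γ (i + 1)))) (min_le_right _ _)).trans
      (hpow _ _ ?_)
    rcases min_choice (wlen S (x * γ i)) (wlen S (x * γ (i + 1))) with h | h <;> rw [h] <;>
      assumption
  have hright : dist (ι (x * γ k)) (ι (x * γ (wlen S z))) ≤ μ ^ (2 * r) / (1 - μ) := by
    have := dist_le_of_geometric (fun i => ι (x * γ (k + i))) (wlen S z - k)
      (C := μ ^ (2 * r)) (by positivity) hμ0.le hμ1 (fun i hi => by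
        rw [← pow_add]
        refine hstep (k + i) (by omega) _ ?_ ?_
        · have := (key (k + i) (by omega)).1; omega
        · have := (key (k + i + 1) (by omega)).1; omega)
    simpa [Nat.add_sub_cancel' hkn] using this
  have hleft : dist (ι (x * γ k)) (ι (x * γ 0)) ≤ μ ^ (2 * r) / (1 - μ) := by
    have := dist_le_of_geometric (fun i => ι (x * γ (k - i))) k
      (C := μ ^ (2 * r)) (by positivity) hμ0.le hμ1 (fun i hi => by
        rw [← pow_add, dist_comm]
        have e : k - i = k - (i + 1) + 1 := by omega
        simp only [e]
        refine hstep (k - (i + 1)) (by omega) _ ?_ ?_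
        · have := (key (k - (i + 1)) (by omega)).2; omega
        · have := (key (k - (i + 1) + 1) (by omega)).2; omega)
    simpa using this
  rw [hγ.1, mul_one] at hleft
  rw [hγ.2.1] at hright
  have h1 : ε ≤ 2 * (μ ^ (2 * r) / (1 - μ)) := by
    have := dist_triangle_left (ι x) (ι (x * z)) (ι (x * γ k))
    linarith
  have h2 : μ ^ (2 * r) ≤ μ ^ R := pow_le_pow_of_le_one hμ0.le hμ1.le (by omega)
  rw [← mul_div_assoc, le_div_iff₀ hμ'] at h1
  linarith

/-- Concatenations that do not backtrack in the Floyd metric are quasi-geodesic. -/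
lemma exists_geodesic_near_left {ε : ℝ} (hε : 0 < ε) : ∃ R : ℕ, ∀ x z : G,
    ε ≤ dist (ι x⁻¹) (ι z) → ∀ γ, IsGeodesicTo S γ (x * z) →
      ∃ k ≤ wlen S (x * z), wlen S (x⁻¹ * γ k) ≤ R := by
  obtain ⟨R, hR⟩ := H.exists_geodesic_near hε
  exact ⟨R, fun x z h γ hγ => hR x⁻¹ (x * z) γ hγ (by simpa using h)⟩

lemma exists_wlen_mul_ge {ε : ℝ} (hε : 0 < ε) : ∃ R : ℕ, ∀ x z : G,
    ε ≤ dist (ι x⁻¹) (ι z) → wlen S x + wlen S z ≤ wlen S (x * z) + R := by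
  obtain ⟨R, hR⟩ := H.exists_geodesic_near_left hε
  refine ⟨2 * R, fun x z h => ?_⟩
  obtain ⟨γ, hγ⟩ := H.exists_geodesicTo (x * z)
  obtain ⟨k, hk, hkR⟩ := hR x z h γ hγ
  have h1 := hγ.wlen_eq hk
  have h2 := hγ.2.2 k _ hk le_rfl
  rw [hγ.2.1] at h2
  have h3 := H.mul_le (x⁻¹ * γ k) ((γ k)⁻¹ * (x * z))
  have e3 : (x⁻¹ * γ k) * ((γ k)⁻¹ * (x * z)) = z := by group
  rw [e3] at h3
  have h4 := H.mul_le (γ k) (x⁻¹ * γ k)⁻¹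
  have e4 : γ k * (x⁻¹ * γ k)⁻¹ = x := by group
  rw [e4, H.inv_eq] at h4
  omega

lemma dist_mul_right_le (u w : G) :
    dist (ι u) (ι (u * w)) ≤ wlen S w * (lam ^ wlen S w)⁻¹ * lam ^ wlen S u := by
  obtain ⟨γ, hγ⟩ := H.exists_geodesicTo w
  have hpos := H.pos
  have h := dist_le_range_sum_of_dist_le (f := fun i => ι (u * γ i)) (wlen S w)
    (d := fun _ => (lam ^ wlen S w)⁻¹ * lam ^ wlen S u) (fun {i} hi => by
      have hle : ∀ j ≤ wlen S w, wlen S u - wlen S w ≤ wlen S (u * γ j) := by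
        intro j hj
        have := wlen_le_mul_add H.gen H.symm u (γ j)
        rw [hγ.wlen_eq hj] at this
        omega
      refine (H.dist_step hγ u hi (hle i hi.le) (hle (i + 1) hi)).trans ?_
      rw [inv_mul_eq_div, le_div_iff₀ (by positivity), ← pow_add]
      exact H.pow_anti (by omega))
  simp only [hγ.1, hγ.2.1, mul_one, Finset.sum_const, Finset.card_range, nsmul_eq_mul] at h
  rwa [mul_assoc]

lemma dist_geodesic_tail {γ : ℕ → G} {g : G} (hγ : IsGeodesicTo S γ g) {k : ℕ}
    (hk : k ≤ wlen S g) : dist (ι (γ k)) (ι g) ≤ lam ^ k / (1 - lam) := by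
  have := dist_le_of_geometric (fun i => ι (γ (k + i))) (wlen S g - k)
      (C := lam ^ k) (pow_nonneg H.pos.le _) H.pos.le H.lt_one (fun i hi => by
        rw [← pow_add]
        have := H.dist_step hγ 1 (i := k + i) (m := k + i) (by omega)
          (by rw [one_mul, hγ.wlen_eq (by omega)])
          (by rw [one_mul, hγ.wlen_eq (by omega)]; omega)
        simpa [add_assoc] using this)
  simpa [Nat.add_sub_cancel' hk, hγ.2.1] using this

lemma exists_dist_mul_le {ε : ℝ} (hε : 0 < ε) : ∃ C : ℝ, 0 < C ∧ ∀ x z : G,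
    ε ≤ dist (ι x⁻¹) (ι z) → dist (ι x) (ι (x * z)) ≤ C * lam ^ wlen S x := by
  obtain ⟨R, hR⟩ := H.exists_geodesic_near_left hε
  have hpos := H.pos
  have hlt : 0 < 1 - lam := by linarith [H.lt_one]
  refine ⟨R * (lam ^ R)⁻¹ + (lam ^ R)⁻¹ / (1 - lam), by positivity, fun x z h => ?_⟩
  obtain ⟨γ, hγ⟩ := H.exists_geodesicTo (x * z)
  obtain ⟨k, hk, hkR⟩ := hR x z h γ hγ
  have h1 := H.dist_mul_right_le x (x⁻¹ * γ k)
  rw [mul_inv_cancel_left] at h1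
  have h2 := H.dist_geodesic_tail hγ hk
  have h3 : (wlen S (x⁻¹ * γ k) : ℝ) * (lam ^ wlen S (x⁻¹ * γ k))⁻¹ ≤ R * (lam ^ R)⁻¹ := by
    exact mul_le_mul (by exact_mod_cast hkR) (inv_anti₀ (by positivity) (H.pow_anti hkR))
      (by positivity) (by positivity)
  have h4 : lam ^ k ≤ (lam ^ R)⁻¹ * lam ^ wlen S x := by
    have h := H.mul_le (γ k) (x⁻¹ * γ k)⁻¹
    have e : γ k * (x⁻¹ * γ k)⁻¹ = x := by group
    rw [e, H.inv_eq, hγ.wlen_eq hk] at h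
    rw [inv_mul_eq_div, le_div_iff₀ (by positivity), ← pow_add]
    exact H.pow_anti (by omega)
  calc dist (ι x) (ι (x * z)) ≤ dist (ι x) (ι (γ k)) + dist (ι (γ k)) (ι (x * z)) :=
        dist_triangle _ _ _
    _ ≤ R * (lam ^ R)⁻¹ * lam ^ wlen S x + (lam ^ R)⁻¹ * lam ^ wlen S x / (1 - lam) := by
        gcongr
        · exact h1.trans (by gcongr)
        · exact h2.trans (by gcongr)
    _ = _ := by ring

end FloydSpace

end Floyd

namespace Floyd

open scoped Topology

lemma exists_forall_eq_of_finite {α β : Type*} (U : Ultrafilter α) {f : α → β} {s : Set β}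
    (hs : s.Finite) (h : ∀ᶠ a in (U : Filter α), f a ∈ s) : ∃ c, ∀ᶠ a in (U : Filter α), f a = c := by
  have h1 : s ∈ U.map f := h
  rw [← Set.biUnion_of_singleton s, Ultrafilter.finite_biUnion_mem_iff hs] at h1
  obtain ⟨c, -, hc⟩ := h1
  exact ⟨c, hc⟩

namespace FloydSpace

variable {G : Type*} [Group G] {S : Finset G} {lam : ℝ} {B : Type*} [MetricSpace B]
  {ι : G → B} (H : FloydSpace S lam ι)
include H

lemma exists_ball_near (n : ℕ) (b : B) :
    ∃ h, wlen S h ≤ n ∧ dist b (ι h) ≤ lam ^ n / (1 - lam) := by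
  have hcl : IsClosed (⋃ h ∈ {g : G | wlen S g ≤ n},
      Metric.closedBall (ι h) (lam ^ n / (1 - lam))) :=
    (finite_ball H.gen H.symm n).isClosed_biUnion fun _ _ => Metric.isClosed_closedBall
  have hpos := H.pos
  have hlt : 0 < 1 - lam := by linarith [H.lt_one]
  have hsub : Set.range ι ⊆ ⋃ h ∈ {g : G | wlen S g ≤ n},
      Metric.closedBall (ι h) (lam ^ n / (1 - lam)) := by
    rintro _ ⟨g, rfl⟩
    simp only [Set.mem_iUnion, Metric.mem_closedBall]
    rcases le_total (wlen S g) n with h | h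
    · exact ⟨g, h, by rw [dist_self]; positivity⟩
    · obtain ⟨γ, hγ⟩ := H.exists_geodesicTo g
      exact ⟨γ n, (hγ.wlen_eq h).le, by rw [dist_comm]; exact H.dist_geodesic_tail hγ h⟩
  have := hcl.closure_subset_iff.2 hsub (H.dense b)
  simpa only [Set.mem_iUnion, Metric.mem_closedBall, exists_prop, Set.mem_ofPred_eq] using this

lemma compactSpace : CompactSpace B := by
  have := H.complete
  refine ⟨TotallyBounded.isCompact_of_isClosed (Metric.totallyBounded_iff.2 fun ε hε => ?_)
    isClosed_univ⟩
  have hlt : 0 < 1 - lam := by linarith [H.lt_one]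
  obtain ⟨n, hn⟩ := exists_pow_lt_of_lt_one (show 0 < ε * (1 - lam) by positivity) H.lt_one
  refine ⟨ι '' {g | wlen S g ≤ n}, (finite_ball H.gen H.symm n).image ι, fun b _ => ?_⟩
  obtain ⟨h, hh, hd⟩ := H.exists_ball_near n b
  refine Set.mem_biUnion (Set.mem_image_of_mem ι hh) (Metric.mem_ball.2 (hd.trans_lt ?_))
  rwa [div_lt_iff₀ hlt]

lemma neBot_comap (b : B) : (comap ι (𝓝 b)).NeBot := by
  rw [comap_neBot_iff]
  intro s hs
  obtain ⟨_, hbs, g, rfl⟩ := mem_closure_iff_nhds.1 (H.dense b) s hs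
  exact ⟨g, hbs⟩

lemma tendsto_wlen {α : Type*} {F : Filter α} {u : α → G} {ζ : B}
    (h : Tendsto (fun a => ι (u a)) F (𝓝 ζ)) (hζ : ζ ∈ floydBoundary ι) :
    Tendsto (fun a => wlen S (u a)) F atTop := by
  refine tendsto_atTop.2 fun N => ?_
  have hcl : IsClosed (ι '' {g | wlen S g ≤ N}) :=
    ((finite_ball H.gen H.symm N).image ι).isClosed
  have hmem : ζ ∈ (ι '' {g | wlen S g ≤ N})ᶜ := fun ⟨g, _, hg⟩ => hζ ⟨g, hg⟩
  filter_upwards [h (hcl.isOpen_compl.mem_nhds hmem)] with a ha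
  by_contra! hlt
  exact ha ⟨u a, hlt.le, rfl⟩

lemma tendsto_pow_wlen {α : Type*} {F : Filter α} {u : α → G}
    (hw : Tendsto (fun a => wlen S (u a)) F atTop) (C : ℝ) :
    Tendsto (fun a => C * lam ^ wlen S (u a)) F (𝓝 0) := by
  simpa using ((tendsto_pow_atTop_nhds_zero_of_lt_one H.pos.le H.lt_one).comp hw).const_mul C

lemma tendsto_of_dist_le {α : Type*} {F : Filter α} {u : α → G} {v : α → B} {ζ : B}
    (h : Tendsto (fun a => ι (u a)) F (𝓝 ζ)) (hw : Tendsto (fun a => wlen S (u a)) F atTop)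
    (C : ℝ) (hv : ∀ᶠ a in F, dist (ι (u a)) (v a) ≤ C * lam ^ wlen S (u a)) :
    Tendsto v F (𝓝 ζ) :=
  h.congr_dist (squeeze_zero' (Eventually.of_forall fun _ => dist_nonneg) hv
    (H.tendsto_pow_wlen hw C))

lemma tendsto_mul_right {α : Type*} {F : Filter α} {u : α → G} {ζ : B}
    (h : Tendsto (fun a => ι (u a)) F (𝓝 ζ)) (hw : Tendsto (fun a => wlen S (u a)) F atTop)
    (w : G) : Tendsto (fun a => ι (u a * w)) F (𝓝 ζ) :=
  H.tendsto_of_dist_le h hw _ (Eventually.of_forall fun a => H.dist_mul_right_le (u a) w)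

lemma exists_ultrafilter {ξ : B} (hξ : ξ ∈ floydBoundary ι) :
    ∃ (U : Ultrafilter G) (η : B), Tendsto ι U (𝓝 ξ) ∧ Tendsto (fun x => ι x⁻¹) U (𝓝 η) ∧
      Tendsto (wlen S) U atTop := by
  have := H.neBot_comap ξ
  have := H.compactSpace
  set U := Ultrafilter.of (comap ι (𝓝 ξ))
  have hU : Tendsto ι U (𝓝 ξ) := tendsto_comap.mono_left (Ultrafilter.of_le _)
  obtain ⟨η, -, hη⟩ := isCompact_univ.ultrafilter_le_nhds (U.map fun x => ι x⁻¹) (by simp)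
  exact ⟨U, η, hU, hη, H.tendsto_wlen (u := fun x => x) hU hξ⟩

variable {act : G → B → B} (hact : IsBoundaryAction ι act)
include hact

lemma act_mul (g h : G) (b : B) : act g (act h b) = act (g * h) b := by
  have := H.dense.equalizer ((hact.1 g).comp (hact.1 h)) (hact.1 (g * h)) (by
    funext x
    simp [hact.2, mul_assoc])
  exact congrFun this b

lemma act_one (b : B) : act 1 b = b := by
  have := H.dense.equalizer (hact.1 1) continuous_id (by funext x; simp [hact.2])
  exact congrFun this b

lemma dist_act_le {x : G} {a y : B} {c δ : ℝ} (hδ : 0 < δ)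
    (h : ∀ z, dist (ι z) y < δ → dist a (ι (x * z)) ≤ c) : dist a (act x y) ≤ c := by
  have := H.neBot_comap y
  have h1 : Tendsto (fun z => dist a (ι (x * z))) (comap ι (𝓝 y)) (𝓝 (dist a (act x y))) := by
    simp only [← hact.2]
    exact tendsto_const_nhds.dist (((hact.1 x).tendsto y).comp tendsto_comap)
  refine le_of_tendsto h1 ?_
  filter_upwards [tendsto_comap (Metric.ball_mem_nhds y hδ)] with z hz using h z hz

/-- The convergence property of the action on the Floyd compactification. -/
lemma tendsto_act {α : Type*} {F : Filter α} {u : α → G} {ξ η y : B}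
    (h : Tendsto (fun a => ι (u a)) F (𝓝 ξ)) (hξ : ξ ∈ floydBoundary ι)
    (h' : Tendsto (fun a => ι (u a)⁻¹) F (𝓝 η)) (hy : y ≠ η) :
    Tendsto (fun a => act (u a) y) F (𝓝 ξ) := by
  have hd : 0 < dist y η := dist_pos.2 hy
  obtain ⟨C, hC, hC'⟩ := H.exists_dist_mul_le (show 0 < dist y η / 3 by positivity)
  refine H.tendsto_of_dist_le h (H.tendsto_wlen h hξ) C ?_
  filter_upwards [h' (Metric.ball_mem_nhds η (show 0 < dist y η / 3 by positivity))] with a ha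
  refine H.dist_act_le hact (show 0 < dist y η / 3 by positivity) fun z hz => hC' _ _ ?_
  have h1 : dist (ι (u a)⁻¹) η < dist y η / 3 := ha
  have h2 := dist_triangle4 y (ι z) (ι (u a)⁻¹) η
  rw [dist_comm y (ι z), dist_comm (ι z) (ι (u a)⁻¹)] at h2
  linarith

/-- If `G` fixes a point, then it fixes every other boundary point. -/
lemma act_eq_of_fixed {ξ ζ : B} (hfix : ∀ g, act g ξ = ξ) (hζ : ζ ∈ floydBoundary ι)
    (hne : ζ ≠ ξ) (g : G) : act g ζ = ζ := by
  obtain ⟨U, -, hU, -, hw⟩ := H.exists_ultrafilter hζ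
  have hd : 0 < dist ζ ξ := dist_pos.2 hne
  obtain ⟨R, hR⟩ := H.exists_geodesic_near (show 0 < dist ζ ξ / 3 by positivity)
  have hbdd : ∀ s ∈ S, ∃ c, ∀ᶠ x in (U : Filter G), x * s * x⁻¹ = c := by
    intro s hs
    refine exists_forall_eq_of_finite U (finite_ball H.gen H.symm (4 * R + 1)) ?_
    filter_upwards [hU (Metric.ball_mem_nhds ζ (show 0 < dist ζ ξ / 3 by positivity)),
      H.tendsto_mul_right hU hw s (Metric.ball_mem_nhds ζ (show 0 < dist ζ ξ / 3 by positivity))]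
      with x hx hxs
    have hx' : dist (ι x) ζ < dist ζ ξ / 3 := hx
    have hxs' : dist (ι (x * s)) ζ < dist ζ ξ / 3 := hxs
    have hz : ∀ y, ∀ᶠ z in comap ι (𝓝 ξ), dist (ι (y * z)) ξ < dist ζ ξ / 3 := by
      intro y
      have : Tendsto (fun z => ι (y * z)) (comap ι (𝓝 ξ)) (𝓝 ξ) := by
        simp only [← hact.2]
        have := ((hact.1 y).tendsto ξ).comp (tendsto_comap (f := ι))
        rwa [hfix] at this
      exact this (Metric.ball_mem_nhds ξ (show 0 < dist ζ ξ / 3 by positivity))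
    have := H.neBot_comap ξ
    obtain ⟨z, hz1, hz2⟩ := ((hz x).and (hz (x * s))).exists
    obtain ⟨γ, hγ⟩ := H.exists_geodesicTo z
    obtain ⟨k, hk, hkR⟩ := hR x z γ hγ (by
      have h2 := dist_triangle4 ζ (ι x) (ι (x * z)) ξ
      rw [dist_comm ζ (ι x)] at h2
      linarith)
    obtain ⟨m, hm, hmR⟩ := hR (x * s) z γ hγ (by
      have h2 := dist_triangle4 ζ (ι (x * s)) (ι (x * s * z)) ξ
      rw [dist_comm ζ (ι (x * s))] at h2
      linarith)
    have hs1 := wlen_le_one hs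
    have h1 : wlen S ((γ m)⁻¹ * γ k) ≤ 2 * R + 1 := by
      have a1 := H.mul_le (x * γ k) (γ k)⁻¹
      rw [mul_inv_cancel_right, H.inv_eq, hγ.wlen_eq hk] at a1
      have a2 := wlen_le_mul_add' H.gen H.symm x (γ k)
      rw [hγ.wlen_eq hk] at a2
      have a3 := H.mul_le (x * s * γ m) (γ m)⁻¹
      rw [mul_inv_cancel_right, H.inv_eq, hγ.wlen_eq hm] at a3
      have a4 := wlen_le_mul_add' H.gen H.symm (x * s) (γ m)
      rw [hγ.wlen_eq hm] at a4
      have a5 := H.mul_le x s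
      have a6 := wlen_le_mul_add H.gen H.symm x s
      rcases le_total m k with hmk | hmk
      · rw [hγ.2.2 m k hmk hk]; omega
      · rw [wlen_inv_mul_comm H.gen H.symm, hγ.2.2 k m hmk hm]; omega
    have e : x * s * x⁻¹ = (x * s * γ m) * (((γ m)⁻¹ * γ k) * (x * γ k)⁻¹) := by group
    have h2 := H.mul_le (x * s * γ m) (((γ m)⁻¹ * γ k) * (x * γ k)⁻¹)
    have h3 := H.mul_le ((γ m)⁻¹ * γ k) (x * γ k)⁻¹
    rw [H.inv_eq] at h3
    rw [← e] at h2
    show wlen S (x * s * x⁻¹) ≤ _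
    omega
  choose! c hc using hbdd
  have hall : ∀ᶠ x in (U : Filter G), ∀ s ∈ S, x * s * x⁻¹ = c s :=
    (Filter.eventually_all_finset S).2 hc
  obtain ⟨y, hy⟩ := hall.exists
  have hlim : ∀ h : G, Tendsto (fun x => ι (h * x)) U (𝓝 (act h ζ)) := fun h => by
    simp only [← hact.2]
    exact ((hact.1 h).tendsto ζ).comp hU
  have hfixS : ∀ s ∈ S, act s (act y⁻¹ ζ) = act y⁻¹ ζ := by
    intro s hs
    rw [H.act_mul hact]
    have h1 : Tendsto (fun x => ι (y⁻¹ * x * s)) U (𝓝 (act y⁻¹ ζ)) := by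
      have h2 := ((hact.1 y⁻¹).tendsto ζ).comp (H.tendsto_mul_right hU hw s)
      simpa [Function.comp_def, hact.2, mul_assoc] using h2
    refine tendsto_nhds_unique ((hlim (s * y⁻¹)).congr' ?_) h1
    filter_upwards [hall] with x hx
    have h3 : x * s * x⁻¹ = y * s * y⁻¹ := (hx s hs).trans (hy s hs).symm
    congr 1
    calc s * y⁻¹ * x = y⁻¹ * (y * s * y⁻¹) * x := by group
      _ = y⁻¹ * (x * s * x⁻¹) * x := by rw [h3]
      _ = _ := by group
  have hfixG : ∀ g, act g (act y⁻¹ ζ) = act y⁻¹ ζ := by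
    intro g
    obtain ⟨l, hl, -, rfl⟩ := exists_word H.gen H.symm g
    clear hall hlim
    induction l with
    | nil => simpa using H.act_one hact _
    | cons s l ih =>
      rw [List.prod_cons, ← H.act_mul hact, ih fun x hx => hl x (List.mem_cons_of_mem _ hx),
        hfixS s (hl s (by simp))]
  have h1 := hfixG y
  rw [H.act_mul hact, mul_inv_cancel, H.act_one hact] at h1
  have h2 := hfixG g
  rwa [← h1] at h2

lemma exists_act_ne {a b c : B} (ha : a ∈ floydBoundary ι) (hb : b ∈ floydBoundary ι)
    (hc : c ∈ floydBoundary ι) (hab : a ≠ b) (hac : a ≠ c) (hbc : b ≠ c) (ξ : B) :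
    ∃ g, act g ξ ≠ ξ := by
  by_contra! hfix
  obtain ⟨ζ₁, ζ₂, h1, h2, h12, h1ξ, h2ξ⟩ : ∃ ζ₁ ζ₂, ζ₁ ∈ floydBoundary ι ∧ ζ₂ ∈ floydBoundary ι ∧
      ζ₁ ≠ ζ₂ ∧ ζ₁ ≠ ξ ∧ ζ₂ ≠ ξ := by
    by_cases h : a = ξ
    · exact ⟨b, c, hb, hc, hbc, h ▸ hab.symm, h ▸ hac.symm⟩
    · by_cases h' : b = ξ
      · exact ⟨a, c, ha, hc, hac, h, h' ▸ hbc.symm⟩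
      · exact ⟨a, b, ha, hb, hab, h, h'⟩
  obtain ⟨U, η, hU, hη, -⟩ := H.exists_ultrafilter h1
  obtain ⟨y, hyη, hyfix, hy1⟩ : ∃ y, y ≠ η ∧ (∀ g, act g y = y) ∧ y ≠ ζ₁ := by
    by_cases h : ξ = η
    · exact ⟨ζ₂, h ▸ h2ξ, H.act_eq_of_fixed hact hfix h2 h2ξ, h12.symm⟩
    · exact ⟨ξ, h, hfix, h1ξ.symm⟩
  have := H.tendsto_act hact (u := fun x => x) hU h1 hη hyη
  simp only [hyfix] at this
  exact hy1 (tendsto_nhds_unique tendsto_const_nhds this)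

lemma exists_act_ne_ne {a b c : B} (ha : a ∈ floydBoundary ι) (hb : b ∈ floydBoundary ι)
    (hc : c ∈ floydBoundary ι) (hab : a ≠ b) (hac : a ≠ c) (hbc : b ≠ c) (ξ p q : B) :
    ∃ g, act g ξ ≠ p ∧ act g ξ ≠ q := by
  by_contra! hcon
  obtain ⟨ζ, hζ, hζp, hζq⟩ : ∃ ζ, ζ ∈ floydBoundary ι ∧ ζ ≠ p ∧ ζ ≠ q := by
    by_contra! hex
    have h1 := hex a ha
    have h2 := hex b hb
    have h3 := hex c hc
    by_cases hap : a = p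
    · exact hbc ((h2 (hap ▸ hab.symm)).trans (h3 (hap ▸ hac.symm)).symm)
    · by_cases hbp : b = p
      · exact hac ((h1 hap).trans (h3 (hbp ▸ hbc.symm)).symm)
      · exact hab ((h1 hap).trans (h2 hbp).symm)
  obtain ⟨U, η, hU, hη, -⟩ := H.exists_ultrafilter hζ
  obtain ⟨h, hh⟩ : ∃ h, act h ξ ≠ η := by
    by_contra! hall
    obtain ⟨g, hg⟩ := H.exists_act_ne hact ha hb hc hab hac hbc ξ
    exact hg ((hall g).trans ((H.act_one hact ξ).symm.trans (hall 1)).symm)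
  have hlim := H.tendsto_act hact (u := fun x => x) hU hζ hη hh
  simp only [H.act_mul hact] at hlim
  have hmem : ζ ∈ ({p, q} : Set B) := by
    refine (Set.toFinite ({p, q} : Set B)).isClosed.mem_of_tendsto hlim
      (Eventually.of_forall fun x => ?_)
    by_cases hx : act (x * h) ξ = p
    · exact Or.inl hx
    · exact Or.inr (hcon _ hx)
  rcases hmem with h | h
  exacts [hζp h, hζq h]

lemma exists_ultrafilter_act {ξ : B} (hξ : ξ ∈ floydBoundary ι) : ∃ η, ∀ g : G,
    ∃ U : Ultrafilter G, Tendsto ι U (𝓝 ξ) ∧ Tendsto (fun x => ι x⁻¹) U (𝓝 (act g η)) := by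
  obtain ⟨U, η, hU, hη, hw⟩ := H.exists_ultrafilter hξ
  refine ⟨η, fun g => ⟨U.map (· * g⁻¹), ?_, ?_⟩⟩
  · exact H.tendsto_mul_right hU hw g⁻¹
  · have : Tendsto (fun x => ι (g * x⁻¹)) U (𝓝 (act g η)) := by
      simp only [← hact.2]
      exact ((hact.1 g).tendsto η).comp hη
    have h2 : Tendsto (fun x => ι (x * g⁻¹)⁻¹) U (𝓝 (act g η)) := by simpa using this
    exact tendsto_map'_iff.2 h2

/-- Any two elements can be connected by one of three long elements without backtracking. -/
lemma exists_connectors {a b c : B} (ha : a ∈ floydBoundary ι) (hb : b ∈ floydBoundary ι)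
    (hc : c ∈ floydBoundary ι) (hab : a ≠ b) (hac : a ≠ c) (hbc : b ≠ c) :
    ∃ ε > 0, ∀ L : ℕ, ∃ f : Fin 3 → G, (∀ i, L ≤ wlen S (f i)) ∧
      ∀ u v, ∃ i, ε ≤ dist (ι u) (ι (f i)) ∧ ε ≤ dist (ι (f i)⁻¹) (ι v) := by
  obtain ⟨ξ, η, hξ, hξi, hηi, hU⟩ : ∃ ξ η : Fin 3 → B, (∀ i, ξ i ∈ floydBoundary ι) ∧
      Function.Injective ξ ∧ Function.Injective η ∧ ∀ i, ∃ U : Ultrafilter G,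
        Tendsto ι U (𝓝 (ξ i)) ∧ Tendsto (fun x => ι x⁻¹) U (𝓝 (η i)) := by
    obtain ⟨η₁, h1⟩ := H.exists_ultrafilter_act hact ha
    obtain ⟨η₂, h2⟩ := H.exists_ultrafilter_act hact hb
    obtain ⟨η₃, h3⟩ := H.exists_ultrafilter_act hact hc
    obtain ⟨g₂, hg₂, -⟩ := H.exists_act_ne_ne hact ha hb hc hab hac hbc η₂ (act 1 η₁) (act 1 η₁)
    obtain ⟨g₃, hg₃, hg₃'⟩ :=
      H.exists_act_ne_ne hact ha hb hc hab hac hbc η₃ (act 1 η₁) (act g₂ η₂)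
    refine ⟨![a, b, c], ![act 1 η₁, act g₂ η₂, act g₃ η₃], ?_, ?_, ?_, ?_⟩
    · intro i; fin_cases i <;> assumption
    · intro i j; fin_cases i <;> fin_cases j <;> simp [hab, hac, hbc, hab.symm, hac.symm, hbc.symm]
    · intro i j
      fin_cases i <;> fin_cases j <;>
        simp [hg₂, hg₃, hg₃', hg₂.symm, hg₃.symm, hg₃'.symm]
    · intro i
      fin_cases i
      exacts [h1 1, h2 g₂, h3 g₃]
  obtain ⟨ε, hε, hsep⟩ : ∃ ε > 0, ∀ i j, i ≠ j →
      4 * ε < dist (ξ i) (ξ j) ∧ 4 * ε < dist (η i) (η j) := by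
    have hev : ∀ᶠ ε : ℝ in 𝓝[>] 0, ∀ i j, i ≠ j →
        4 * ε < dist (ξ i) (ξ j) ∧ 4 * ε < dist (η i) (η j) := by
      rw [eventually_all]; intro i
      rw [eventually_all]; intro j
      by_cases hij : i = j
      · simp [hij]
      have hlim : Tendsto (fun ε : ℝ => 4 * ε) (𝓝[>] 0) (𝓝 0) := by
        have : Tendsto (fun ε : ℝ => 4 * ε) (𝓝 0) (𝓝 (4 * 0)) := tendsto_id.const_mul 4
        rw [mul_zero] at this
        exact this.mono_left nhdsWithin_le_nhds
      filter_upwards [hlim.eventually_lt_const (dist_pos.2 (hξi.ne hij)),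
        hlim.eventually_lt_const (dist_pos.2 (hηi.ne hij))] with ε h1 h2 _ using ⟨h1, h2⟩
    obtain ⟨ε, h, hpos⟩ := (hev.and self_mem_nhdsWithin).exists
    exact ⟨ε, hpos, h⟩
  refine ⟨ε, hε, fun L => ?_⟩
  have hex : ∀ i, ∃ g : G, L ≤ wlen S g ∧ dist (ι g) (ξ i) < ε ∧ dist (ι g⁻¹) (η i) < ε := by
    intro i
    obtain ⟨U, h1, h2⟩ := hU i
    have e1 : ∀ᶠ g in (U : Filter G), dist (ι g) (ξ i) < ε := h1 (Metric.ball_mem_nhds _ hε)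
    have e2 : ∀ᶠ g in (U : Filter G), dist (ι g⁻¹) (η i) < ε := h2 (Metric.ball_mem_nhds _ hε)
    exact (((H.tendsto_wlen (u := fun x => x) h1 (hξ i)).eventually_ge_atTop L).and
      (e1.and e2)).exists
  choose f hf1 hf2 hf3 using hex
  refine ⟨f, hf1, fun u v => ?_⟩
  have hu : ∀ i j, i ≠ j → dist (ι u) (ι (f i)) < ε → dist (ι u) (ι (f j)) < ε → False := by
    intro i j hij h1 h2
    have h3 := dist_triangle4 (ξ i) (ι (f i)) (ι (f j)) (ξ j)
    have h4 := dist_triangle_left (ι (f i)) (ι (f j)) (ι u)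
    have h5 := hf2 i
    rw [dist_comm] at h5
    linarith [hf2 j, (hsep i j hij).1]
  have hv : ∀ i j, i ≠ j → dist (ι (f i)⁻¹) (ι v) < ε → dist (ι (f j)⁻¹) (ι v) < ε → False := by
    intro i j hij h1 h2
    have h3 := dist_triangle4 (η i) (ι (f i)⁻¹) (ι (f j)⁻¹) (η j)
    have h4 := dist_triangle_right (ι (f i)⁻¹) (ι (f j)⁻¹) (ι v)
    have h5 := hf3 i
    rw [dist_comm] at h5
    linarith [hf3 j, (hsep i j hij).2]
  by_contra! hcon
  have hor : ∀ i, dist (ι u) (ι (f i)) < ε ∨ dist (ι (f i)⁻¹) (ι v) < ε := fun i => by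
    by_cases h : dist (ι u) (ι (f i)) < ε
    · exact Or.inl h
    · exact Or.inr (hcon i (not_lt.1 h))
  rcases hor 0 with h0 | h0 <;> rcases hor 1 with h1 | h1 <;> rcases hor 2 with h2 | h2 <;>
    first
    | exact hu 0 1 (by decide) h0 h1
    | exact hu 0 2 (by decide) h0 h2
    | exact hu 1 2 (by decide) h1 h2
    | exact hv 0 1 (by decide) h0 h1
    | exact hv 0 2 (by decide) h0 h2
    | exact hv 1 2 (by decide) h1 h2

end FloydSpace

end Floyd

namespace Floyd

open scoped Topology

/-- `IsGoodWord S ι ε L g x y`: the element `g` is a product of letters of length at least `L`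
starting with `x` and ending with `y`, without backtracking at scale `ε` between consecutive
letters. -/
inductive IsGoodWord {G : Type*} [Group G] (S : Finset G) {B : Type*} [MetricSpace B]
    (ι : G → B) (ε : ℝ) (L : ℕ) : G → G → G → Prop
  | single (x : G) : L ≤ wlen S x → IsGoodWord S ι ε L x x x
  | cons (x y z u : G) : L ≤ wlen S x → ε ≤ dist (ι x⁻¹) (ι y) →
      IsGoodWord S ι ε L u y z → IsGoodWord S ι ε L (x * u) x z

/-- Constants for which good words behave like quasi-geodesics. -/
structure GoodConstants {G : Type*} [Group G] (S : Finset G) (lam : ℝ) {B : Type*}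
    [MetricSpace B] (ι : G → B) (ε : ℝ) (R L : ℕ) (C : ℝ) : Prop where
  space : FloydSpace S lam ι
  eps_pos : 0 < ε
  near : ∀ x z : G, ε / 2 ≤ dist (ι x⁻¹) (ι z) → ∀ γ, IsGeodesicTo S γ (x * z) →
    ∃ k ≤ wlen S (x * z), wlen S (x⁻¹ * γ k) ≤ R
  le_mul : ∀ x z : G, ε / 2 ≤ dist (ι x⁻¹) (ι z) → wlen S x + wlen S z ≤ wlen S (x * z) + R
  shadow : ∀ x z : G, ε / 2 ≤ dist (ι x⁻¹) (ι z) →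
    dist (ι x) (ι (x * z)) ≤ C * lam ^ wlen S x
  C_pos : 0 < C
  lt_L : R < L
  small : C * lam ^ L ≤ ε / 4

lemma FloydSpace.exists_goodConstants {G : Type*} [Group G] {S : Finset G} {lam : ℝ} {B : Type*}
    [MetricSpace B] {ι : G → B} (H : FloydSpace S lam ι) {ε : ℝ} (hε : 0 < ε) :
    ∃ R L C, GoodConstants S lam ι ε R L C := by
  obtain ⟨R₁, h1⟩ := H.exists_geodesic_near_left (half_pos hε)
  obtain ⟨R₂, h2⟩ := H.exists_wlen_mul_ge (half_pos hε)
  obtain ⟨C, hC, h3⟩ := H.exists_dist_mul_le (half_pos hε)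
  obtain ⟨n, hn⟩ := exists_pow_lt_of_lt_one (show 0 < ε / 4 / C by positivity) H.lt_one
  refine ⟨max R₁ R₂, max R₁ R₂ + 1 + n, C, H, hε, fun x z h γ hγ => ?_, fun x z h => ?_, h3, hC,
    by omega, ?_⟩
  · obtain ⟨k, hk, hkR⟩ := h1 x z h γ hγ
    exact ⟨k, hk, hkR.trans (le_max_left _ _)⟩
  · exact (h2 x z h).trans (Nat.add_le_add_left (le_max_right _ _) _)
  · rw [← le_div_iff₀' hC]
    exact (H.pow_anti (by omega)).trans hn.le

variable {G : Type*} [Group G] {S : Finset G} {lam : ℝ} {B : Type*} [MetricSpace B]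
  {ι : G → B} {ε : ℝ} {R L : ℕ} {C : ℝ}

namespace IsGoodWord

lemma concat {u x y v x' z : G} (hu : IsGoodWord S ι ε L u x y)
    (hyx : ε ≤ dist (ι y⁻¹) (ι x')) (hv : IsGoodWord S ι ε L v x' z) :
    IsGoodWord S ι ε L (u * v) x z := by
  induction hu with
  | single x hx => exact .cons x _ z v hx hyx hv
  | cons x y' z' u hx hxy _ ih => exact mul_assoc x u v ▸ .cons x y' z _ hx hxy (ih hyx)

lemma inv (H : FloydSpace S lam ι) {u x y : G} (hu : IsGoodWord S ι ε L u x y) :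
    IsGoodWord S ι ε L u⁻¹ y⁻¹ x⁻¹ := by
  induction hu with
  | single x hx => exact .single _ (by rwa [H.inv_eq])
  | cons x y z u hx hxy _ ih =>
    rw [mul_inv_rev]
    refine ih.concat ?_ (.single _ (by rwa [H.inv_eq]))
    rwa [inv_inv, dist_comm]

lemma near_first (K : GoodConstants S lam ι ε R L C) {u x y : G}
    (hu : IsGoodWord S ι ε L u x y) : L ≤ wlen S u ∧ dist (ι x) (ι u) ≤ ε / 4 := by
  have hε := K.eps_pos
  induction hu with
  | single x hx => exact ⟨hx, by rw [dist_self]; positivity⟩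
  | cons x y z u hx hxy _ ih =>
    have h1 : ε / 2 ≤ dist (ι x⁻¹) (ι u) := by
      have := dist_triangle_right (ι x⁻¹) (ι y) (ι u)
      linarith [ih.2]
    have h2 := K.le_mul x u h1
    have h3 := K.lt_L
    refine ⟨by omega, (K.shadow x u h1).trans (le_trans ?_ K.small)⟩
    exact mul_le_mul_of_nonneg_left (K.space.pow_anti hx) K.C_pos.le

lemma near_last (K : GoodConstants S lam ι ε R L C) {u x y : G}
    (hu : IsGoodWord S ι ε L u x y) : dist (ι y⁻¹) (ι u⁻¹) ≤ ε / 4 :=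
  ((hu.inv K.space).near_first K).2

lemma dist_inv_ge (K : GoodConstants S lam ι ε R L C) {u x y e : G}
    (hu : IsGoodWord S ι ε L u x y) (h : ε ≤ dist (ι y⁻¹) (ι e)) :
    ε / 2 ≤ dist (ι u⁻¹) (ι e) := by
  have := dist_triangle (ι y⁻¹) (ι u⁻¹) (ι e)
  linarith [hu.near_last K, K.eps_pos]

lemma dist_ge (K : GoodConstants S lam ι ε R L C) {u x y e : G}
    (hu : IsGoodWord S ι ε L u x y) (h : ε ≤ dist (ι e⁻¹) (ι x)) :
    3 * ε / 4 ≤ dist (ι e⁻¹) (ι u) := by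
  have := dist_triangle_right (ι e⁻¹) (ι x) (ι u)
  linarith [hu.near_first K, K.eps_pos]

lemma dist_inv_ge_of_concat (K : GoodConstants S lam ι ε R L C) {u x y v x' z : G}
    (hu : IsGoodWord S ι ε L u x y) (hyx : ε ≤ dist (ι y⁻¹) (ι x'))
    (hv : IsGoodWord S ι ε L v x' z) : ε / 2 ≤ dist (ι u⁻¹) (ι v) := by
  have h1 := dist_triangle4 (ι y⁻¹) (ι u⁻¹) (ι v) (ι x')
  have h2 := (hv.near_first K).2
  rw [dist_comm] at h2
  linarith [hu.near_last K]

end IsGoodWord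

/-- Elements with the same length that lie in separated positions have separated shadows. -/
lemma GoodConstants.le_dist_of_separated (K : GoodConstants S lam ι ε R L C) {x x' t t' : G}
    {m : ℕ} (hx : wlen S x = m) (hx' : wlen S x' = m) (hsep : 4 * R < wlen S (x⁻¹ * x'))
    (ht : 3 * ε / 4 ≤ dist (ι x⁻¹) (ι t)) (ht' : 3 * ε / 4 ≤ dist (ι x'⁻¹) (ι t')) :
    lam ^ m * (ε / 4) ≤ dist (ι (x * t)) (ι (x' * t')) := by
  have H := K.space
  have hε := K.eps_pos
  by_contra! hlt
  have h1 := H.smul x⁻¹ (x * t) (x' * t')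
  rw [H.inv_eq, hx, inv_mul_cancel_left] at h1
  have h2 : dist (ι t) (ι (x⁻¹ * (x' * t'))) < ε / 4 :=
    lt_of_mul_lt_mul_left (h1.trans_lt hlt) (pow_nonneg H.pos.le m)
  have h3 : ε / 2 ≤ dist (ι x⁻¹) (ι (x⁻¹ * (x' * t'))) := by
    have := dist_triangle_right (ι x⁻¹) (ι t) (ι (x⁻¹ * (x' * t')))
    linarith
  obtain ⟨γ, hγ⟩ := H.exists_geodesicTo (x' * t')
  obtain ⟨k, hk, hkR⟩ := K.near _ _ h3 γ (by rwa [mul_inv_cancel_left])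
  obtain ⟨k', hk', hkR'⟩ := K.near x' t' (by linarith) γ hγ
  rw [mul_inv_cancel_left] at hk
  have a1 := hγ.wlen_eq hk
  have a2 := hγ.wlen_eq hk'
  have b1 := H.mul_le x (x⁻¹ * γ k)
  have b2 := H.mul_le x' (x'⁻¹ * γ k')
  have b3 := wlen_le_mul_add H.gen H.symm x (x⁻¹ * γ k)
  have b4 := wlen_le_mul_add H.gen H.symm x' (x'⁻¹ * γ k')
  rw [mul_inv_cancel_left] at b1 b2 b3 b4
  have h5 : wlen S ((γ k)⁻¹ * γ k') ≤ 2 * R := by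
    rcases le_total k k' with h | h
    · rw [hγ.2.2 k k' h hk']; omega
    · rw [wlen_inv_mul_comm H.gen H.symm, hγ.2.2 k' k h hk]; omega
  have e : x⁻¹ * x' = (x⁻¹ * γ k) * (((γ k)⁻¹ * γ k') * (x'⁻¹ * γ k')⁻¹) := by group
  have c1 := H.mul_le (x⁻¹ * γ k) (((γ k)⁻¹ * γ k') * (x'⁻¹ * γ k')⁻¹)
  have c2 := H.mul_le ((γ k)⁻¹ * γ k') (x'⁻¹ * γ k')⁻¹
  rw [H.inv_eq] at c2
  rw [← e] at c1
  omega

/-- A criterion for being a Myrberg limit point. -/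
lemma FloydSpace.mem_myrbergSet (H : FloydSpace S lam ι) {act : G → B → B}
    (hact : IsBoundaryAction ι act) (hε : 0 < ε) {ξ : B} (hξ : ξ ∈ floydBoundary ι)
    (h : ∀ e, L ≤ wlen S e → ∃ (P : G) (w : ℕ → G), ε ≤ dist (ι P⁻¹) (ι e) ∧
      (∀ j, ε ≤ dist (ι e⁻¹) (ι (w j))) ∧ Tendsto (fun j => ι (P * e * w j)) atTop (𝓝 ξ)) :
    ξ ∈ myrbergSet ι act := by
  refine ⟨hξ, ?_⟩
  rintro a ⟨ha, x, -, hx⟩ b ⟨hb, y, -, hy⟩ hab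
  have hwx := H.tendsto_wlen hx ha
  have hwy := H.tendsto_wlen hy hb
  have hd : 0 < dist a b / 2 := half_pos (dist_pos.2 hab)
  obtain ⟨R, hR⟩ := H.exists_wlen_mul_ge hd
  obtain ⟨C, hC, hCd⟩ := H.exists_dist_mul_le hd
  obtain ⟨C', hC', hCd'⟩ := H.exists_dist_mul_le (half_pos hε)
  have hxy : ∀ᶠ n in atTop, dist a b / 2 < dist (ι (x n)) (ι (y n)) :=
    (hx.dist hy).eventually_const_lt (by linarith)
  have hlen : ∀ᶠ n in atTop, L ≤ wlen S ((x n)⁻¹ * y n) := by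
    filter_upwards [hxy, hwx.eventually_ge_atTop (L + R)] with n h1 h2
    have := hR (x n)⁻¹ (y n) (by rw [inv_inv]; exact h1.le)
    rw [H.inv_eq] at this
    omega
  have hP : ∀ n, ∃ (P : G) (w : ℕ → G), L ≤ wlen S ((x n)⁻¹ * y n) →
      ε ≤ dist (ι P⁻¹) (ι ((x n)⁻¹ * y n)) ∧ (∀ j, ε ≤ dist (ι ((x n)⁻¹ * y n)⁻¹) (ι (w j))) ∧
      Tendsto (fun j => ι (P * ((x n)⁻¹ * y n) * w j)) atTop (𝓝 ξ) := by
    intro n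
    by_cases hn : L ≤ wlen S ((x n)⁻¹ * y n)
    · obtain ⟨P, w, hPw⟩ := h _ hn
      exact ⟨P, w, fun _ => hPw⟩
    · exact ⟨1, fun _ => 1, fun h => absurd h hn⟩
  choose P w hPw using hP
  refine ⟨fun n => x n * (P n)⁻¹, H.tendsto_of_dist_le hx hwx C' ?_,
    H.tendsto_of_dist_le hy hwy C' ?_⟩
  · filter_upwards [hxy, hlen, (H.tendsto_pow_wlen hwx C).eventually_lt_const (half_pos hε)]
      with n h1 h2 h3
    refine hCd' _ _ ?_
    have h4 := hCd (x n)⁻¹ (y n) (by rw [inv_inv]; exact h1.le)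
    rw [H.inv_eq] at h4
    have h5 := dist_triangle_left (ι (P n)⁻¹) (ι ((x n)⁻¹ * y n)) (ι (x n)⁻¹)
    linarith [(hPw n h2).1]
  · filter_upwards [hxy, hlen, (H.tendsto_pow_wlen hwy C).eventually_lt_const (half_pos hε)]
      with n h1 h2 h3
    have h4 := hCd (y n)⁻¹ (x n) (by rw [inv_inv, dist_comm (ι (y n))]; exact h1.le)
    rw [H.inv_eq] at h4
    have h5 : Tendsto (fun j => ι (y n * w n j)) atTop (𝓝 (act (x n * (P n)⁻¹) ξ)) := by
      have := ((hact.1 (x n * (P n)⁻¹)).tendsto ξ).comp (hPw n h2).2.2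
      simpa [Function.comp_def, hact.2, mul_assoc] using this
    refine le_of_tendsto (tendsto_const_nhds.dist h5) (Eventually.of_forall fun j => hCd' _ _ ?_)
    have h6 := (hPw n h2).2.1 j
    rw [mul_inv_rev, inv_inv] at h6
    have h7 := dist_triangle_left (ι ((y n)⁻¹ * x n)) (ι (w n j)) (ι (y n)⁻¹)
    linarith

end Floyd

namespace Floyd

open scoped Topology

/-- Any sequence of patterns can be scattered along a stream so sparsely that the partial sums
of the sizes grow at most linearly. -/
lemma exists_sparse {α : Type*} (p : ℕ → α) (o : α) (ℓ : α → ℕ) (ho : ℓ o = 0) :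
    ∃ V : ℕ → α, (∀ k, V k = o ∨ ∃ j, V k = p j) ∧ (∀ j, ∃ k, V k = p j) ∧
      ∀ k, ∑ i ∈ Finset.range k, ℓ (V i) ≤ k := by
  classical
  set N : ℕ → ℕ := fun j => ∑ i ∈ Finset.range (j + 1), (ℓ (p i) + 1) with hN
  have hNm : StrictMono N := strictMono_nat_of_lt_succ fun j => by
    simp only [hN, Finset.sum_range_succ _ (j + 1)]
    omega
  have hNs : ∀ j, ∑ i ∈ Finset.range (j + 1), ℓ (p i) ≤ N j := fun j =>
    Finset.sum_le_sum fun i _ => Nat.le_succ _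
  let V : ℕ → α := fun k => if h : ∃ j, N j = k then p h.choose else o
  have hV : ∀ j, V (N j) = p j := fun j => by
    have h : ∃ i, N i = N j := ⟨j, rfl⟩
    simp only [V, dif_pos h]
    rw [hNm.injective h.choose_spec]
  have hV' : ∀ k, (¬ ∃ j, N j = k) → V k = o := fun k hk => dif_neg hk
  have key : ∀ k j, k ≤ N j → ∑ i ∈ Finset.range k, ℓ (V i) ≤ ∑ i ∈ Finset.range j, ℓ (p i) := by
    intro k
    induction k with
    | zero => simp
    | succ k ih =>
      intro j hj
      rw [Finset.sum_range_succ]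
      by_cases h : ∃ j, N j = k
      · obtain ⟨i, rfl⟩ := h
        have hij : i < j := hNm.lt_iff_lt.1 hj
        rw [hV]
        calc _ ≤ ∑ i ∈ Finset.range i, ℓ (p i) + ℓ (p i) := by have := ih i le_rfl; omega
          _ = ∑ i ∈ Finset.range (i + 1), ℓ (p i) := (Finset.sum_range_succ _ _).symm
          _ ≤ _ := Finset.sum_le_sum_of_subset (Finset.range_mono hij)
      · rw [hV' k h, ho, add_zero]
        exact ih j (by omega)
  refine ⟨V, fun k => ?_, fun j => ⟨N j, hV j⟩, fun k => ?_⟩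
  · by_cases h : ∃ j, N j = k
    · obtain ⟨j, rfl⟩ := h
      exact Or.inr ⟨j, hV j⟩
    · exact Or.inl (hV' k h)
  · have hex : ∃ j, k ≤ N j := ⟨k, hNm.id_le k⟩
    have h1 := key k _ (Nat.find_spec hex)
    rcases hj : Nat.find hex with _ | j
    · rw [hj] at h1
      simp only [Finset.range_zero, Finset.sum_empty] at h1
      omega
    · have h2 := Nat.find_min hex (m := j) (by omega)
      rw [hj] at h1
      exact h1.trans ((hNs j).trans (not_le.1 h2).le)

variable {G : Type*} [Group G]

/-- The partial products of the stream with digits `d`, connector `f` and inserted patterns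
`V`. -/
def stream (f : G) (V d : ℕ → G) : ℕ → G
  | 0 => 1
  | k + 1 => stream f V d k * (d k * (f * V k))

/-- The factor of the stream between positions `k` and `k + n`. -/
def streamFactor (f : G) (V d : ℕ → G) (k n : ℕ) : G :=
  (stream f V d k)⁻¹ * stream f V d (k + n)

lemma streamFactor_zero (f : G) (V d : ℕ → G) (k : ℕ) : streamFactor f V d k 0 = 1 := by
  simp [streamFactor]

lemma streamFactor_succ (f : G) (V d : ℕ → G) (k n : ℕ) :
    streamFactor f V d k (n + 1) = d k * (f * V k * streamFactor f V d (k + 1) n) := by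
  have h : k + 1 + n = k + (n + 1) := by ring
  rw [streamFactor, streamFactor, h, stream]
  group

lemma stream_add (f : G) (V d : ℕ → G) (k n : ℕ) :
    stream f V d (k + n) = stream f V d k * streamFactor f V d k n := by
  rw [streamFactor, mul_inv_cancel_left]

lemma streamFactor_zero_left (f : G) (V d : ℕ → G) (n : ℕ) :
    streamFactor f V d 0 n = stream f V d n := by
  simp [streamFactor, stream]

lemma stream_congr (f : G) (V : ℕ → G) {d d' : ℕ → G} {k : ℕ} (h : ∀ i < k, d i = d' i) :
    stream f V d k = stream f V d' k := by
  induction k with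
  | zero => rfl
  | succ k ih => rw [stream, stream, ih fun i hi => h i (by omega), h k (by omega)]

variable {S : Finset G} {lam : ℝ} {B : Type*} [MetricSpace B]
  {ι : G → B} {ε : ℝ} {R L : ℕ} {C : ℝ}

/-- The data from which streams are built: the allowed digits `A`, all of length `m`, a connector
`f` and a sequence `V` of inserted patterns. -/
structure StreamData (S : Finset G) (ι : G → B) (ε : ℝ) (R L : ℕ) (m : ℕ) (A : Set G) (f : G)
    (V : ℕ → G) : Prop where
  digit_le : L ≤ m
  digit_wlen : ∀ a ∈ A, wlen S a = m
  digit_left : ∀ a ∈ A, ε ≤ dist (ι f⁻¹) (ι a)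
  digit_right : ∀ a ∈ A, ε ≤ dist (ι a⁻¹) (ι f)
  digit_sep : ∀ a ∈ A, ∀ b ∈ A, a ≠ b → 4 * R < wlen S (a⁻¹ * b)
  pattern_good : ∀ k, IsGoodWord S ι ε L (f * V k) f f
  pattern_sum : ∀ k, ∑ i ∈ Finset.range k, wlen S (V i) ≤ k
  pattern_all : ∀ e, L ≤ wlen S e → ∃ (k : ℕ) (u v x y : G), V k = u * e * v ∧
    IsGoodWord S ι ε L (f * u) f y ∧ ε ≤ dist (ι y⁻¹) (ι e) ∧
    IsGoodWord S ι ε L v x f ∧ ε ≤ dist (ι e⁻¹) (ι x)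

namespace StreamData

variable {m : ℕ} {A : Set G} {f : G} {V : ℕ → G} (D : StreamData S ι ε R L m A f V)
  {d d' : ℕ → G} (hd : ∀ k, d k ∈ A)
include D hd

lemma isGoodWord_tail (k n : ℕ) :
    IsGoodWord S ι ε L (f * V k * streamFactor f V d (k + 1) n) f f := by
  have hL : ∀ k, L ≤ wlen S (d k) := fun k => (D.digit_wlen _ (hd k)).symm ▸ D.digit_le
  induction n generalizing k with
  | zero =>
    rw [streamFactor_zero, mul_one]
    exact D.pattern_good k
  | succ n ih =>
    rw [streamFactor_succ]
    exact (D.pattern_good k).concat (D.digit_left _ (hd _))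
      (.cons _ f _ _ (hL _) (D.digit_right _ (hd _)) (ih _))

lemma isGoodWord_streamFactor (k n : ℕ) :
    IsGoodWord S ι ε L (streamFactor f V d k (n + 1)) (d k) f := by
  rw [streamFactor_succ]
  exact .cons _ f _ _ ((D.digit_wlen _ (hd k)).symm ▸ D.digit_le) (D.digit_right _ (hd _))
    (D.isGoodWord_tail hd k n)

lemma isGoodWord_stream (n : ℕ) : IsGoodWord S ι ε L (stream f V d (n + 1)) (d 0) f := by
  rw [← streamFactor_zero_left]
  exact D.isGoodWord_streamFactor hd 0 n

variable (K : GoodConstants S lam ι ε R L C)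
include K

lemma dist_stream_ge (k n : ℕ) :
    ε / 2 ≤ dist (ι (stream f V d (k + 1))⁻¹) (ι (streamFactor f V d (k + 1) (n + 1))) :=
  (D.isGoodWord_stream hd k).dist_inv_ge_of_concat K (D.digit_left _ (hd _))
    (D.isGoodWord_streamFactor hd (k + 1) n)

lemma le_wlen_stream (k : ℕ) : k ≤ wlen S (stream f V d k) := by
  have hRL := K.lt_L
  induction k with
  | zero => exact Nat.zero_le _
  | succ k ih =>
    rcases k with _ | k
    · have := ((D.isGoodWord_stream hd 0).near_first K).1
      omega
    · have h1 := K.le_mul _ _ (D.dist_stream_ge hd K k 0)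
      rw [← stream_add, zero_add] at h1
      have h2 := ((D.isGoodWord_streamFactor hd (k + 1) 0).near_first K).1
      rw [zero_add] at h2
      omega

lemma wlen_stream_le (k : ℕ) : wlen S (stream f V d k) ≤ k * (m + wlen S f + 1) := by
  have H := K.space
  have h : wlen S (stream f V d k) ≤
      k * (m + wlen S f) + ∑ i ∈ Finset.range k, wlen S (V i) := by
    induction k with
    | zero => simp [stream]
    | succ k ih =>
      rw [stream, Finset.sum_range_succ]
      have h1 := H.mul_le (stream f V d k) (d k * (f * V k))
      have h2 := H.mul_le (d k) (f * V k)
      have h3 := H.mul_le f (V k)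
      have h4 := D.digit_wlen _ (hd k)
      have h5 : (k + 1) * (m + wlen S f) = k * (m + wlen S f) + (m + wlen S f) := by ring
      omega
  have := D.pattern_sum k
  have h5 : k * (m + wlen S f + 1) = k * (m + wlen S f) + k := by ring
  omega

lemma exists_tendsto_stream : ∃ ξ ∈ floydBoundary ι,
    Tendsto (fun n => ι (stream f V d n)) atTop (𝓝 ξ) := by
  have H := K.space
  have := H.complete
  have hbound : ∀ n k, dist (ι (stream f V d (n + 1))) (ι (stream f V d (n + 1 + k))) ≤
      C * lam ^ (n + 1) := by
    intro n k
    rcases k with _ | k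
    · rw [add_zero, dist_self]
      have := H.pos
      have := K.C_pos
      positivity
    · rw [stream_add _ _ _ (n + 1)]
      exact (K.shadow _ _ (D.dist_stream_ge hd K n k)).trans
        (mul_le_mul_of_nonneg_left (H.pow_anti (D.le_wlen_stream hd K _)) K.C_pos.le)
  have hcauchy : CauchySeq fun n => ι (stream f V d (n + 1)) := by
    refine cauchySeq_of_le_tendsto_0' (fun n => C * lam ^ (n + 1)) (fun n k hnk => ?_) ?_
    · obtain ⟨j, rfl⟩ := Nat.exists_eq_add_of_le hnk
      have h := hbound n j
      rwa [show n + 1 + j = n + j + 1 by ring] at h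
    · simpa using ((tendsto_pow_atTop_nhds_zero_of_lt_one H.pos.le H.lt_one).comp
        (tendsto_add_atTop_nat 1)).const_mul C
  obtain ⟨ξ, hξ⟩ := cauchySeq_tendsto_of_complete hcauchy
  have hξ' := (tendsto_add_atTop_iff_nat (f := fun n => ι (stream f V d n)) 1).1 hξ
  refine ⟨ξ, ?_, hξ'⟩
  rintro ⟨g, rfl⟩
  have hlim := (tendsto_const_nhds (x := ι g)).dist hξ'
  rw [dist_self] at hlim
  obtain ⟨n, h1, h2⟩ := ((hlim.eventually_lt_const (pow_pos H.pos (wlen S g))).and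
    (eventually_gt_atTop (wlen S g))).exists
  refine h1.not_ge (H.isolated _ _ fun h => ?_)
  have := D.le_wlen_stream hd K n
  rw [← h] at this
  omega

lemma mem_myrbergSet {act : G → B → B} (hact : IsBoundaryAction ι act) {ξ : B}
    (hξ : ξ ∈ floydBoundary ι) (hlim : Tendsto (fun n => ι (stream f V d n)) atTop (𝓝 ξ)) :
    ξ ∈ myrbergSet ι act := by
  refine K.space.mem_myrbergSet hact (half_pos K.eps_pos) (L := L) hξ fun e he => ?_
  obtain ⟨k, u, v, x, y, hVk, hu, huy, hv, hvx⟩ := D.pattern_all e he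
  refine ⟨stream f V d k * (d k * (f * u)), fun j => v * streamFactor f V d (k + 1) j, ?_,
    fun j => ?_, ?_⟩
  · have h1 : IsGoodWord S ι ε L (d k * (f * u)) (d k) y :=
      .cons _ f _ _ ((D.digit_wlen _ (hd k)).symm ▸ D.digit_le) (D.digit_right _ (hd _)) hu
    rcases k with _ | k
    · rw [stream, one_mul]
      exact h1.dist_inv_ge K huy
    · exact ((D.isGoodWord_stream hd k).concat (D.digit_left _ (hd _)) h1).dist_inv_ge K huy
  · have h1 : IsGoodWord S ι ε L (v * streamFactor f V d (k + 1) j) x f := by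
      rcases j with _ | j
      · rwa [streamFactor_zero, mul_one]
      · exact hv.concat (D.digit_left _ (hd _)) (D.isGoodWord_streamFactor hd (k + 1) j)
    have := h1.dist_ge K hvx
    linarith [K.eps_pos]
  · refine ((tendsto_add_atTop_iff_nat (k + 1)).2 hlim).congr fun j => ?_
    rw [add_comm j, stream_add, stream, hVk]
    congr 1
    group

lemma le_dist_limit (hd' : ∀ k, d' k ∈ A) {k : ℕ} (hlt : ∀ i < k, d i = d' i) (hk : d k ≠ d' k)
    {ξ ξ' : B} (hξ : Tendsto (fun n => ι (stream f V d n)) atTop (𝓝 ξ))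
    (hξ' : Tendsto (fun n => ι (stream f V d' n)) atTop (𝓝 ξ')) :
    lam ^ m * (ε / 4) * (lam ^ (m + wlen S f + 1)) ^ k ≤ dist ξ ξ' := by
  have H := K.space
  refine ge_of_tendsto (hξ.dist hξ') ?_
  filter_upwards [eventually_gt_atTop k] with n hn
  obtain ⟨j, rfl⟩ := Nat.exists_eq_add_of_lt hn
  rw [add_assoc k, stream_add f V d, stream_add f V d', ← stream_congr f V hlt]
  have hf : ∀ {d₁ : ℕ → G}, (∀ k, d₁ k ∈ A) → 3 * ε / 4 ≤
      dist (ι (d₁ k)⁻¹) (ι (f * V k * streamFactor f V d₁ (k + 1) j)) := fun h =>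
    (D.isGoodWord_tail h k j).dist_ge K (D.digit_right _ (h k))
  have h1 := K.le_dist_of_separated (D.digit_wlen _ (hd k)) (D.digit_wlen _ (hd' k))
    (D.digit_sep _ (hd k) _ (hd' k) hk) (hf hd) (hf hd')
  rw [← streamFactor_succ, ← streamFactor_succ] at h1
  have h2 := H.smul (stream f V d k)⁻¹ (stream f V d k * streamFactor f V d k (j + 1))
    (stream f V d k * streamFactor f V d' k (j + 1))
  rw [H.inv_eq, inv_mul_cancel_left, inv_mul_cancel_left] at h2
  refine le_trans ?_ h2
  rw [mul_comm, ← pow_mul, mul_comm (m + wlen S f + 1)]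
  exact mul_le_mul (H.pow_anti (D.wlen_stream_le hd K k)) h1
    (mul_nonneg (pow_nonneg H.pos.le _) (by linarith [K.eps_pos])) (pow_nonneg H.pos.le _)

end StreamData

/-- Streams exist as soon as any two elements can be connected. -/
lemma exists_streamData (K : GoodConstants S lam ι ε R L C) {F : Fin 3 → G}
    (hF : ∀ i, L ≤ wlen S (F i))
    (hconn : ∀ u v, ∃ i, ε ≤ dist (ι u) (ι (F i)) ∧ ε ≤ dist (ι (F i)⁻¹) (ι v))
    {m : ℕ} {A : Set G} (hA : A.Nonempty) (i : Fin 3) (hm : L ≤ m) (hAm : ∀ a ∈ A, wlen S a = m)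
    (hAl : ∀ a ∈ A, ε ≤ dist (ι (F i)⁻¹) (ι a)) (hAr : ∀ a ∈ A, ε ≤ dist (ι a⁻¹) (ι (F i)))
    (hAs : ∀ a ∈ A, ∀ b ∈ A, a ≠ b → 4 * R < wlen S (a⁻¹ * b)) :
    ∃ V, StreamData S ι ε R L m A (F i) V := by
  have H := K.space
  obtain ⟨a, ha⟩ := hA
  have haL : L ≤ wlen S a := (hAm a ha).symm ▸ hm
  have hpat : ∀ e : G, ∃ V : G, IsGoodWord S ι ε L (F i * V) (F i) (F i) ∧ (L ≤ wlen S e →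
      ∃ u v x y : G, V = u * e * v ∧ IsGoodWord S ι ε L (F i * u) (F i) y ∧
        ε ≤ dist (ι y⁻¹) (ι e) ∧ IsGoodWord S ι ε L v x (F i) ∧ ε ≤ dist (ι e⁻¹) (ι x)) := by
    intro e
    by_cases he : L ≤ wlen S e
    · obtain ⟨i₁, h1, h1'⟩ := hconn a⁻¹ e
      obtain ⟨i₂, h2, h2'⟩ := hconn e⁻¹ a
      have hu : IsGoodWord S ι ε L (F i * (a * F i₁)) (F i) (F i₁) :=
        .cons _ a _ _ (hF i) (hAl a ha) (.cons _ _ _ _ haL h1 (.single _ (hF i₁)))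
      have hv : IsGoodWord S ι ε L (F i₂ * (a * F i)) (F i₂) (F i) :=
        .cons _ a _ _ (hF i₂) h2' (.cons _ _ _ _ haL (hAr a ha) (.single _ (hF i)))
      refine ⟨a * F i₁ * e * (F i₂ * (a * F i)), ?_, fun _ =>
        ⟨_, _, _, _, rfl, hu, h1', hv, h2⟩⟩
      have := hu.concat h1' (.cons e _ _ _ he h2 hv)
      simpa only [mul_assoc] using this
    · exact ⟨1, by rw [mul_one]; exact .single _ (hF i), fun h => absurd h he⟩
  choose p hp1 hp2 using hpat
  have hcount : Countable G := by
    have : (⋃ n, {g : G | wlen S g ≤ n}) = Set.univ :=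
      Set.eq_univ_of_forall fun g => Set.mem_iUnion.2 ⟨wlen S g, le_refl (wlen S g)⟩
    exact Set.countable_univ_iff.1 (this ▸ Set.countable_iUnion fun n =>
      (finite_ball H.gen H.symm n).countable)
  obtain ⟨enum, henum⟩ := exists_surjective_nat G
  obtain ⟨V, hV1, hV2, hV3⟩ := exists_sparse (p ∘ enum) 1 (wlen S) wlen_one
  refine ⟨V, hm, hAm, hAl, hAr, hAs, fun k => ?_, hV3, fun e he => ?_⟩
  · rcases hV1 k with h | ⟨j, h⟩
    · rw [h, mul_one]
      exact .single _ (hF i)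
    · rw [h]
      exact hp1 _
  · obtain ⟨j, rfl⟩ := henum e
    obtain ⟨k, hk⟩ := hV2 j
    obtain ⟨u, v, x, y, h⟩ := hp2 _ he
    exact ⟨k, u, v, x, y, by rw [hk]; exact h.1, h.2⟩

end Floyd

namespace Floyd

open scoped Topology ENNReal NNReal

/-- A Cantor set coded by `N` digits with gaps at least `c * θ ^ k` at level `k` has dimension at
least `log N / (-log θ)`. -/
lemma le_dimH_range_of_separated {X : Type*} [MetricSpace X] {N : ℕ} (hN : 1 < N)
    (Φ : (ℕ → Fin N) → X) {c θ : ℝ} (hc : 0 < c) (hθ0 : 0 < θ) (hθ1 : θ < 1)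
    (h : ∀ (d d' : ℕ → Fin N) (k : ℕ), (∀ i < k, d i = d' i) → d k ≠ d' k →
      c * θ ^ k ≤ dist (Φ d) (Φ d')) :
    ENNReal.ofReal (Real.log N / (-Real.log θ)) ≤ dimH (Set.range Φ) := by
  have hN' : (1 : ℝ) < N := by exact_mod_cast hN
  have hlogN : 0 < Real.log N := Real.log_pos hN'
  have hlogθ : 0 < -Real.log θ := neg_pos.2 (Real.log_neg hθ0 hθ1)
  set r : ℝ≥0 := ⟨Real.log N / (-Real.log θ), (div_pos hlogN hlogθ).le⟩ with hr
  have hr' : (r : ℝ) = Real.log N / (-Real.log θ) := rfl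
  have hr0 : 0 < r := by
    rw [← NNReal.coe_pos, hr']
    exact div_pos hlogN hlogθ
  have hθr : θ ^ (r : ℝ) = (N : ℝ)⁻¹ := by
    rw [hr', Real.rpow_def_of_pos hθ0, ← Real.exp_log (show (0 : ℝ) < (N : ℝ)⁻¹ by positivity),
      Real.log_inv]
    congr 1
    have hne : Real.log θ ≠ 0 := (neg_pos.1 hlogθ).ne
    field_simp
  have hsep : ∀ d d' : ℕ → Fin N, d ≠ d' → 0 < dist (Φ d) (Φ d') ∧
      |Real.ofDigits d - Real.ofDigits d'| ≤ (c ^ (r : ℝ))⁻¹ * dist (Φ d) (Φ d') ^ (r : ℝ) := by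
    intro d d' hne
    have hex : ∃ k, d k ≠ d' k := Function.ne_iff.1 hne
    classical
    have hk := h d d' (Nat.find hex) (fun i hi => not_not.1 (Nat.find_min hex hi))
      (Nat.find_spec hex)
    refine ⟨lt_of_lt_of_le (by positivity) hk,
      (Real.abs_ofDigits_sub_ofDigits_le fun i hi => not_not.1 (Nat.find_min hex hi)).trans ?_⟩
    rw [← inv_pow, ← hθr, ← Real.rpow_natCast, ← Real.rpow_mul hθ0.le, mul_comm (r : ℝ),
      Real.rpow_mul hθ0.le, Real.rpow_natCast, ← div_eq_inv_mul,
      ← Real.div_rpow dist_nonneg hc.le]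
    refine Real.rpow_le_rpow (by positivity) ?_ r.coe_nonneg
    rwa [le_div_iff₀' hc]
  have hinj : Function.Injective Φ := fun d d' hdd => by
    by_contra hne
    exact (hsep d d' hne).1.ne' (by rw [hdd, dist_self])
  have : Nonempty (ℕ → Fin N) := ⟨fun _ => ⟨0, by omega⟩⟩
  have hholder : HolderOnWith (Real.toNNReal (c ^ (r : ℝ))⁻¹) r
      (fun x => Real.ofDigits (Function.invFun Φ x)) (Set.range Φ) := by
    rintro _ ⟨d, rfl⟩ _ ⟨d', rfl⟩
    simp only [Function.leftInverse_invFun hinj _]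
    rcases eq_or_ne d d' with rfl | hne
    · simp
    rw [edist_dist, edist_dist, Real.dist_eq, ENNReal.ofReal_rpow_of_nonneg dist_nonneg r.coe_nonneg,
      ← ENNReal.ofReal, ← ENNReal.ofReal_mul (by positivity)]
    exact ENNReal.ofReal_le_ofReal (hsep d d' hne).2
  have h1 := hholder.dimH_image_le hr0
  have h2 : Set.Icc (0 : ℝ) 1 ⊆
      (fun x => Real.ofDigits (Function.invFun Φ x)) '' Set.range Φ := by
    intro y hy
    obtain ⟨d, -, rfl⟩ := Real.ofDigits_SurjOn hN hy
    exact ⟨Φ d, ⟨d, rfl⟩, by simp only [Function.leftInverse_invFun hinj d]⟩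
  have h3 : (1 : ℝ≥0∞) ≤ dimH (Set.Icc (0 : ℝ) 1) := by
    rw [Real.dimH_of_nonempty_interior (by rw [interior_Icc]; exact ⟨1 / 2, by norm_num⟩)]
    simp
  have h4 := (h3.trans (dimH_mono h2)).trans h1
  rw [ENNReal.le_div_iff_mul_le (Or.inl (by exact_mod_cast hr0.ne')) (Or.inl ENNReal.coe_ne_top),
    one_mul] at h4
  rwa [ENNReal.ofReal, ← hr', Real.toNNReal_coe]

end Floyd

namespace Floyd

open scoped Topology ENNReal NNReal

variable {G : Type*} [Group G] {S : Finset G}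

section Growth

variable (hgen : Subgroup.closure (S : Set G) = ⊤) (hsymm : ∀ s ∈ S, s⁻¹ ∈ S)
include hgen hsymm

lemma log_ncard_div_le (n : ℕ) :
    Real.log (Set.ncard {g : G | wlen S g ≤ n}) / n ≤ Real.log (S.card + 1) := by
  rcases Nat.eq_zero_or_pos n with rfl | hn
  · simpa using Real.log_nonneg (by linarith [(Nat.cast_nonneg S.card : (0 : ℝ) ≤ S.card)])
  rw [div_le_iff₀ (by exact_mod_cast hn), mul_comm, ← Real.log_pow]
  refine Real.log_le_log (by exact_mod_cast one_le_ncard_ball hgen hsymm n) ?_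
  exact_mod_cast ncard_ball_le hgen hsymm n

lemma eventually_log_ncard_div_lt {t : ℝ} (ht : critExp S < t) :
    ∀ᶠ n : ℕ in atTop, Real.log (Set.ncard {g : G | wlen S g ≤ n}) / n < t :=
  eventually_lt_of_limsup_lt ht
    (isBoundedUnder_of ⟨_, log_ncard_div_le hgen hsymm⟩)

omit hgen hsymm in
lemma frequently_lt_log_ncard_div {t : ℝ} (ht : t < critExp S) :
    ∃ᶠ n : ℕ in atTop, t < Real.log (Set.ncard {g : G | wlen S g ≤ n}) / n := by
  refine frequently_lt_of_lt_limsup (IsBoundedUnder.isCoboundedUnder_le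
    (isBoundedUnder_of ⟨0, fun n => ?_⟩)) ht
  exact div_nonneg (Real.log_natCast_nonneg _) (Nat.cast_nonneg n)

lemma exists_exp_le_ncard_sphere {t : ℝ} (ht0 : 0 < t) (ht : t < critExp S) (M : ℕ) :
    ∃ m ≥ M, Real.exp (t * m) ≤ Set.ncard {g : G | wlen S g = m} := by
  obtain ⟨t', htt', ht'⟩ := exists_between ht
  have h1 : ∀ᶠ n : ℕ in atTop, ((n : ℝ) + 1) ≤ Real.exp ((t' - t) * n) := by
    have h := ((Real.tendsto_exp_div_pow_atTop 1).comp
      (tendsto_natCast_atTop_atTop.const_mul_atTop (sub_pos.2 htt'))).eventually_ge_atTop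
        (2 / (t' - t))
    filter_upwards [h, eventually_ge_atTop 1] with n hn hn1
    have hn1' : (1 : ℝ) ≤ n := by exact_mod_cast hn1
    have hpos : 0 < (t' - t) * n := mul_pos (sub_pos.2 htt') (by linarith)
    simp only [Function.comp, pow_one] at hn
    rw [le_div_iff₀ hpos, div_mul_eq_mul_div, ← mul_assoc, mul_div_right_comm,
      mul_div_cancel_right₀ _ (sub_pos.2 htt').ne'] at hn
    linarith
  have h2 : ∀ᶠ n : ℕ in atTop, ((S.card + 1 : ℕ) ^ M : ℝ) < Real.exp (t * n) :=
    ((Real.tendsto_exp_atTop).comp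
      (tendsto_natCast_atTop_atTop.const_mul_atTop ht0)).eventually_gt_atTop _
  obtain ⟨n, hn, hn1, hn2, hn0⟩ := ((frequently_lt_log_ncard_div ht').and_eventually
    (h1.and (h2.and (eventually_gt_atTop 0)))).exists
  have hn0' : (0 : ℝ) < n := by exact_mod_cast hn0
  have hball : Real.exp (t' * n) ≤ Set.ncard {g : G | wlen S g ≤ n} := by
    rw [lt_div_iff₀ hn0'] at hn
    exact ((Real.lt_log_iff_exp_lt (by exact_mod_cast one_le_ncard_ball hgen hsymm n)).1 hn).le
  have hex : ∃ m ≤ n, Real.exp (t * n) ≤ Set.ncard {g : G | wlen S g = m} := by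
    by_contra! hcon
    have hsub : {g : G | wlen S g ≤ n} = ⋃ m ∈ Finset.range (n + 1), {g : G | wlen S g = m} := by
      ext g
      simp
    have h3 : (Set.ncard {g : G | wlen S g ≤ n} : ℝ) ≤
        ∑ m ∈ Finset.range (n + 1), (Set.ncard {g : G | wlen S g = m} : ℝ) := by
      rw [hsub]
      exact_mod_cast Finset.set_ncard_biUnion_le _ _
    have h4 : ∑ m ∈ Finset.range (n + 1), (Set.ncard {g : G | wlen S g = m} : ℝ) <
        ∑ m ∈ Finset.range (n + 1), Real.exp (t * n) :=
      Finset.sum_lt_sum_of_nonempty ⟨0, by simp⟩ fun m hm =>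
        hcon m (Nat.lt_succ_iff.1 (Finset.mem_range.1 hm))
    rw [Finset.sum_const, Finset.card_range, nsmul_eq_mul] at h4
    push_cast at h4
    have h5 := mul_le_mul_of_nonneg_right hn1 (Real.exp_pos (t * n)).le
    rw [← Real.exp_add, ← add_mul, sub_add_cancel] at h5
    linarith
  obtain ⟨m, hmn, hm⟩ := hex
  refine ⟨m, ?_, le_trans (Real.exp_le_exp.2 ?_) hm⟩
  · by_contra! hmM
    have h3 : Set.ncard {g : G | wlen S g = m} ≤ (S.card + 1) ^ M :=
      (Set.ncard_le_ncard (fun g (hg : wlen S g = m) => show wlen S g ≤ M by omega)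
        (finite_ball hgen hsymm M)).trans (ncard_ball_le hgen hsymm M)
    have h4 : (Set.ncard {g : G | wlen S g = m} : ℝ) ≤ ((S.card + 1 : ℕ) ^ M : ℝ) := by
      exact_mod_cast h3
    linarith
  · exact mul_le_mul_of_nonneg_left (by exact_mod_cast hmn) ht0.le

/-- A finite set contains a separated subset of proportional size. -/
lemma exists_separated_subset (D : ℕ) (X : Finset G) : ∃ A ⊆ X,
    (∀ a ∈ A, ∀ b ∈ A, a ≠ b → D < wlen S (a⁻¹ * b)) ∧
      X.card ≤ A.card * Set.ncard {g : G | wlen S g ≤ D} := by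
  classical
  obtain ⟨A, hAX, hsep, hcov⟩ : ∃ A ⊆ X, (∀ a ∈ A, ∀ b ∈ A, a ≠ b → D < wlen S (a⁻¹ * b)) ∧
      ∀ x ∈ X, ∃ a ∈ A, wlen S (a⁻¹ * x) ≤ D := by
    induction X using Finset.induction_on with
    | empty => exact ⟨∅, by simp⟩
    | insert x X _ ih =>
      obtain ⟨A, hAX, hsep, hcov⟩ := ih
      by_cases hx : ∃ a ∈ A, wlen S (a⁻¹ * x) ≤ D
      · refine ⟨A, hAX.trans (Finset.subset_insert _ _), hsep, fun y hy => ?_⟩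
        rcases Finset.mem_insert.1 hy with rfl | hy
        exacts [hx, hcov y hy]
      · push Not at hx
        refine ⟨insert x A, Finset.insert_subset_insert _ hAX, fun a ha b hb hab => ?_,
          fun y hy => ?_⟩
        · rcases Finset.mem_insert.1 ha with rfl | ha' <;>
            rcases Finset.mem_insert.1 hb with rfl | hb'
          · exact absurd rfl hab
          · rw [wlen_inv_mul_comm hgen hsymm]
            exact hx b hb'
          · exact hx a ha'
          · exact hsep a ha' b hb' hab
        · rcases Finset.mem_insert.1 hy with rfl | hy
          · exact ⟨y, Finset.mem_insert_self _ _, by simp⟩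
          · obtain ⟨a, ha, h⟩ := hcov y hy
            exact ⟨a, Finset.mem_insert_of_mem ha, h⟩
  refine ⟨A, hAX, hsep, ?_⟩
  have hfin := finite_ball hgen hsymm D
  have hsub : X ⊆ A.biUnion fun a => hfin.toFinset.image (a * ·) := by
    intro x hx
    obtain ⟨a, ha, h⟩ := hcov x hx
    simp only [Finset.mem_biUnion, Finset.mem_image, Set.Finite.mem_toFinset]
    exact ⟨a, ha, a⁻¹ * x, h, by simp⟩
  rw [Set.ncard_eq_toFinset_card _ hfin]
  exact (Finset.card_le_card hsub).trans
    (Finset.card_biUnion_le_card_mul _ _ _ fun a _ => Finset.card_image_le)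

end Growth

variable {lam : ℝ} {B : Type*} [MetricSpace B] {ι : G → B}

lemma FloydSpace.dimH_le (H : FloydSpace S lam ι) (s : Set B) :
    dimH s ≤ ENNReal.ofReal (critExp S / (-Real.log lam)) := by
  have hpos := H.pos
  have hlog : 0 < -Real.log lam := neg_pos.2 (Real.log_neg H.pos H.lt_one)
  have hlt : 0 < 1 - lam := by linarith [H.lt_one]
  refine le_of_forall_gt_imp_ge_of_dense fun d hd => ?_
  rcases eq_or_ne d ⊤ with rfl | hd'
  · exact le_top
  lift d to ℝ≥0 using hd'
  have hd1 : critExp S < d * (-Real.log lam) := by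
    rw [← div_lt_iff₀ hlog]
    rw [ENNReal.ofReal, ENNReal.coe_lt_coe] at hd
    exact (Real.le_coe_toNNReal _).trans_lt (by exact_mod_cast hd)
  borelize B
  refine dimH_le_of_hausdorffMeasure_ne_top (ne_top_of_le_ne_top
    (ENNReal.ofReal_ne_top (r := (2 / (1 - lam)) ^ (d : ℝ))) ?_)
  have hfin := fun n => finite_ball H.gen H.symm n
  let T : ℕ → Type _ := fun n => (hfin n).toFinset
  have hdiam : ∀ (n : ℕ) (h : G), Metric.ediam (Metric.closedBall (ι h) (lam ^ n / (1 - lam))) ≤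
      ENNReal.ofReal (2 / (1 - lam) * lam ^ n) := by
    intro n h
    rw [← Metric.closedEBall_ofReal (by positivity)]
    refine Metric.ediam_closedEBall_le.trans_eq ?_
    rw [show 2 / (1 - lam) * lam ^ n = 2 * (lam ^ n / (1 - lam)) by ring,
      ENNReal.ofReal_mul (by norm_num), ENNReal.ofReal_ofNat]
  refine (Measure.hausdorffMeasure_le_liminf_sum (ι := T) (d : ℝ) s (l := atTop)
    (fun n : ℕ => ENNReal.ofReal (2 / (1 - lam) * lam ^ n)) ?_
    (fun n h => Metric.closedBall (ι h) (lam ^ n / (1 - lam)))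
    (Eventually.of_forall fun n h => hdiam n h) (Eventually.of_forall fun n b _ => ?_)).trans ?_
  · have := ((tendsto_pow_atTop_nhds_zero_of_lt_one H.pos.le H.lt_one).const_mul (2 / (1 - lam)))
    rw [mul_zero] at this
    simpa using ENNReal.tendsto_ofReal this
  · obtain ⟨h, hh, hb⟩ := H.exists_ball_near n b
    exact Set.mem_iUnion.2 ⟨⟨h, (hfin n).mem_toFinset.2 hh⟩, hb⟩
  · refine liminf_le_of_frequently_le' (Eventually.frequently ?_)
    filter_upwards [eventually_log_ncard_div_lt H.gen H.symm hd1, eventually_gt_atTop 0]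
      with n hn hn0
    have hcard : (Set.ncard {g : G | wlen S g ≤ n} : ℝ) ≤
        Real.exp (d * (-Real.log lam) * n) := by
      rw [div_lt_iff₀ (by exact_mod_cast hn0)] at hn
      exact ((Real.log_lt_iff_lt_exp
        (by exact_mod_cast one_le_ncard_ball H.gen H.symm n)).1 hn).le
    calc ∑ h : T n, Metric.ediam (Metric.closedBall (ι h) (lam ^ n / (1 - lam))) ^ (d : ℝ)
        ≤ ∑ h : T n, ENNReal.ofReal (2 / (1 - lam) * lam ^ n) ^ (d : ℝ) :=
          Finset.sum_le_sum fun h _ => ENNReal.rpow_le_rpow (hdiam n h) d.coe_nonneg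
      _ = ENNReal.ofReal (Set.ncard {g : G | wlen S g ≤ n} *
            (2 / (1 - lam) * lam ^ n) ^ (d : ℝ)) := by
          rw [Finset.sum_const, nsmul_eq_mul, ENNReal.ofReal_mul (Nat.cast_nonneg _),
            ENNReal.ofReal_natCast, ENNReal.ofReal_rpow_of_nonneg (by positivity) d.coe_nonneg,
            Set.ncard_eq_toFinset_card _ (hfin n), Finset.card_univ, Fintype.card_coe]
      _ ≤ _ := by
          refine ENNReal.ofReal_le_ofReal ?_
          rw [Real.mul_rpow (by positivity) (by positivity), mul_left_comm]
          refine mul_le_of_le_one_right (by positivity) ?_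
          refine (mul_le_mul_of_nonneg_right hcard (by positivity)).trans_eq ?_
          rw [← Real.rpow_natCast, ← Real.rpow_mul hpos.le, Real.rpow_def_of_pos hpos,
            ← Real.exp_add, Real.exp_eq_one_iff]
          ring

end Floyd

namespace Floyd

open scoped Topology ENNReal NNReal

variable {G : Type*} [Group G] {S : Finset G} {lam : ℝ} {B : Type*} [MetricSpace B] {ι : G → B}

/-- Streams with digits in `A` produce many Myrberg limit points. -/
lemma StreamData.le_dimH_myrbergSet {ε : ℝ} {R L m : ℕ} {C : ℝ} {A : Finset G} {f : G}
    {V : ℕ → G} (D : StreamData S ι ε R L m (A : Set G) f V) (K : GoodConstants S lam ι ε R L C)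
    {act : G → B → B} (hact : IsBoundaryAction ι act) (hA : 1 < A.card) :
    ENNReal.ofReal (Real.log A.card / (-Real.log (lam ^ (m + wlen S f + 1)))) ≤
      dimH (myrbergSet ι act) := by
  have H := K.space
  let dig : (ℕ → Fin A.card) → ℕ → G := fun d k => A.equivFin.symm (d k)
  have hdig : ∀ d k, dig d k ∈ (A : Set G) := fun d k => (A.equivFin.symm (d k)).2
  have hlim := fun d => D.exists_tendsto_stream (hdig d) K
  choose Φ hΦ hΦlim using hlim
  refine (le_dimH_range_of_separated hA Φ (c := lam ^ m * (ε / 4))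
    (mul_pos (pow_pos H.pos m) (by linarith [K.eps_pos])) (pow_pos H.pos _)
    (pow_lt_one₀ H.pos.le H.lt_one (by omega)) fun d d' k hlt hk => ?_).trans
    (dimH_mono (Set.range_subset_iff.2 fun d =>
      D.mem_myrbergSet (hdig d) K hact (hΦ d) (hΦlim d)))
  refine D.le_dist_limit (hdig d) K (hdig d') (fun i hi => ?_) (fun h => hk ?_) (hΦlim d) (hΦlim d')
  · simp only [dig, hlt i hi]
  · exact A.equivFin.symm.injective (Subtype.ext h)

lemma FloydSpace.le_dimH_myrbergSet (H : FloydSpace S lam ι) {act : G → B → B}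
    (hact : IsBoundaryAction ι act) {a b c : B} (ha : a ∈ floydBoundary ι)
    (hb : b ∈ floydBoundary ι) (hc : c ∈ floydBoundary ι) (hab : a ≠ b) (hac : a ≠ c)
    (hbc : b ≠ c) {t : ℝ} (ht0 : 0 < t) (ht : t < critExp S) :
    ENNReal.ofReal (t / (-Real.log lam)) ≤ dimH (myrbergSet ι act) := by
  classical
  obtain ⟨ε, hε, hconn⟩ := H.exists_connectors hact ha hb hc hab hac hbc
  obtain ⟨R, L, C, K⟩ := H.exists_goodConstants hε
  obtain ⟨F, hF, hFconn⟩ := hconn L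
  have hlog : 0 < -Real.log lam := neg_pos.2 (Real.log_neg H.pos H.lt_one)
  obtain ⟨t', htt', ht'⟩ := exists_between ht
  set b₀ : ℕ := Set.ncard {g : G | wlen S g ≤ 4 * R}
  have hb₀ : 1 ≤ b₀ := one_le_ncard_ball H.gen H.symm _
  set W : ℕ := ∑ i, wlen S (F i)
  obtain ⟨M, hM⟩ : ∃ M : ℕ, ∀ m ≥ M, Real.log (3 * b₀) + t * (W + 1) ≤ (t' - t) * m :=
    eventually_atTop.1 ((tendsto_natCast_atTop_atTop.const_mul_atTop
      (sub_pos.2 htt')).eventually_ge_atTop _)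
  obtain ⟨m, hm, hsphere⟩ :=
    exists_exp_le_ncard_sphere H.gen H.symm (ht0.trans htt') ht' (max L M)
  have hfin : {g : G | wlen S g = m}.Finite :=
    (finite_ball H.gen H.symm m).subset fun g (hg : wlen S g = m) => hg.le
  let X : Fin 3 → Finset G := fun i => hfin.toFinset.filter fun g =>
    ε ≤ dist (ι g⁻¹) (ι (F i)) ∧ ε ≤ dist (ι (F i)⁻¹) (ι g)
  have hX : hfin.toFinset.card ≤ ∑ i, (X i).card := by
    refine (Finset.card_le_card fun g hg => ?_).trans Finset.card_biUnion_le
    obtain ⟨i, hi⟩ := hFconn g⁻¹ g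
    exact Finset.mem_biUnion.2 ⟨i, Finset.mem_univ _, Finset.mem_filter.2 ⟨hg, hi⟩⟩
  rw [← Set.ncard_eq_toFinset_card _ hfin] at hX
  obtain ⟨i, hi⟩ : ∃ i, Set.ncard {g : G | wlen S g = m} ≤ 3 * (X i).card := by
    by_contra! hcon
    have := hcon 0
    have := hcon 1
    have := hcon 2
    rw [Fin.sum_univ_three] at hX
    omega
  obtain ⟨A, hAX, hsep, hcard⟩ := exists_separated_subset H.gen H.symm (4 * R) (X i)
  have hA' : ∀ a ∈ A, wlen S a = m ∧ ε ≤ dist (ι a⁻¹) (ι (F i)) ∧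
      ε ≤ dist (ι (F i)⁻¹) (ι a) := fun a ha => by
    simpa [X] using hAX ha
  have h1 : Real.exp (t' * m) ≤ A.card * (3 * b₀) := by
    refine hsphere.trans ?_
    have : Set.ncard {g : G | wlen S g = m} ≤ A.card * (3 * b₀) := by
      calc _ ≤ 3 * (X i).card := hi
        _ ≤ 3 * (A.card * b₀) := Nat.mul_le_mul_left 3 hcard
        _ = _ := by ring
    exact_mod_cast this
  have hb₀' : (0 : ℝ) < 3 * b₀ := by positivity
  have hApos : (0 : ℝ) < A.card := by
    by_contra! h
    exact (Real.exp_pos _).not_ge (h1.trans (mul_nonpos_of_nonpos_of_nonneg h hb₀'.le))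
  have h2 : t * (m + wlen S (F i) + 1) ≤ Real.log A.card := by
    have h3 := (Real.le_log_iff_exp_le (mul_pos hApos hb₀')).2 h1
    rw [Real.log_mul hApos.ne' hb₀'.ne'] at h3
    have h4 := hM m ((le_max_right _ _).trans hm)
    have h5 : (wlen S (F i) : ℝ) ≤ W := by
      exact_mod_cast Finset.single_le_sum (f := fun i => wlen S (F i))
        (fun _ _ => Nat.zero_le _) (Finset.mem_univ i)
    nlinarith
  have hA1 : 1 < A.card := by
    have : 0 < Real.log A.card := lt_of_lt_of_le (by positivity) h2
    exact_mod_cast (Real.log_pos_iff hApos.le).1 this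
  obtain ⟨V, D⟩ := exists_streamData K hF hFconn (A := (A : Set G))
    (Finset.card_pos.1 (by omega)) i ((le_max_left _ _).trans hm) (fun a ha => (hA' a ha).1)
    (fun a ha => (hA' a ha).2.2) (fun a ha => (hA' a ha).2.1) hsep
  refine le_trans (ENNReal.ofReal_le_ofReal ?_) (D.le_dimH_myrbergSet K hact hA1)
  rw [Real.log_pow, ← mul_neg, div_le_div_iff₀ hlog (by positivity)]
  push_cast
  nlinarith

lemma FloydSpace.dimH_myrbergSet (H : FloydSpace S lam ι) {act : G → B → B}
    (hact : IsBoundaryAction ι act) {a b c : B} (ha : a ∈ floydBoundary ι)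
    (hb : b ∈ floydBoundary ι) (hc : c ∈ floydBoundary ι) (hab : a ≠ b) (hac : a ≠ c)
    (hbc : b ≠ c) :
    dimH (myrbergSet ι act) = ENNReal.ofReal (critExp S / (-Real.log lam)) := by
  refine le_antisymm (H.dimH_le _) ?_
  have hlog : 0 < -Real.log lam := neg_pos.2 (Real.log_neg H.pos H.lt_one)
  rcases le_or_gt (critExp S) 0 with h0 | h0
  · rw [ENNReal.ofReal_of_nonpos (div_nonpos_of_nonpos_of_nonneg h0 hlog.le)]
    exact zero_le
  have hlim : Tendsto (fun t => ENNReal.ofReal (t / (-Real.log lam))) (𝓝[<] (critExp S))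
      (𝓝 (ENNReal.ofReal (critExp S / (-Real.log lam)))) :=
    (ENNReal.continuous_ofReal.comp (continuous_id.div_const _)).continuousWithinAt
  refine le_of_tendsto hlim ?_
  filter_upwards [Ioo_mem_nhdsLT h0] with t ht
  exact H.le_dimH_myrbergSet hact ha hb hc hab hac hbc ht.1 ht.2

end Floyd

/-- If the Floyd boundary of a finitely generated group is non-trivial,
then the Myrberg limit set has full Hausdorff dimension `δ_G / (−log λ)` in the Floyd
metric. -/
theorem dimH_myrberg_floyd_boundary
    {G : Type*} [Group G] [DecidableEq G]
    (S : Finset G) (hSgen : Subgroup.closure (S : Set G) = ⊤)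
    (hSsymm : ∀ s ∈ S, s⁻¹ ∈ S) (hS1 : (1 : G) ∉ S)
    (lam : ℝ) (hlam0 : 0 < lam) (hlam1 : lam < 1)
    (B : Type*) [MetricSpace B] (ι : G → B)
    (hcomp : IsFloydCompactification S lam B ι)
    (act : G → B → B) (hact : IsBoundaryAction ι act)
    (hnontrivial : ∃ a b c d : B, a ∈ floydBoundary ι ∧ b ∈ floydBoundary ι ∧
      c ∈ floydBoundary ι ∧ d ∈ floydBoundary ι ∧
      a ≠ b ∧ a ≠ c ∧ a ≠ d ∧ b ≠ c ∧ b ≠ d ∧ c ≠ d) :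
    dimH (myrbergSet ι act) = ENNReal.ofReal (critExp S / (-Real.log lam)) := by
  obtain ⟨a, b, c, -, ha, hb, hc, -, hab, hac, -, hbc, -, -⟩ := hnontrivial
  exact (hcomp.floydSpace hSgen hSsymm hS1 hlam0 hlam1).dimH_myrbergSet hact ha hb hc hab hac hbc
end
end

section
/- Let X be a proper geodesic Gromov hyperbolic space equipped with a proper, isometric, non-elementary action of a group Γ, and let G < Γ be an infinite normal subgroup of infinite index. Then G contains an infinite sequence of loxodromic elements h_n that escapes to infinity, i.e. d(o, G·Ax(h_n)) → ∞ for any basepoint o; moreover the h_n can be chosen so that G·Ax(h_n) = g_n·(G·Ax(h₁)) for suitable g_n ∈ Γ. -/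
/-!
STATEMENT 15. Let `X` be a proper geodesic Gromov hyperbolic space with a proper, isometric
and non-elementary action of `Γ`, and let `G < Γ` be an infinite normal subgroup of infinite
index.  Then `G` has an infinite sequence of loxodromic elements `hₙ` that escapes to infinity,
i.e. `d(o, G·Ax(hₙ)) → ∞`; moreover the `hₙ` can be chosen so that
`G·Ax(hₙ) = gₙ·(G·Ax(h₁))` for suitable `gₙ ∈ Γ`.
-/

open Metric Filter Set Real

noncomputable section

namespace GromovScaffold

variable {X : Type*} [MetricSpace X]

/-- The Gromov product of `x` and `y` seen from `o`. -/
def gprod (o x y : X) : ℝ := (dist x o + dist y o - dist x y) / 2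

/-- `X` is `δ`-hyperbolic in the sense of Gromov (four point condition, which for geodesic
spaces is equivalent, up to changing the constant, to the thin triangles condition). -/
def IsGromovHyperbolic (X : Type*) [MetricSpace X] (δ : ℝ) : Prop :=
  ∀ o x y z : X, min (gprod o x z) (gprod o z y) - δ ≤ gprod o x y

/-- `f` restricted to `s` is a unit-speed geodesic. -/
def IsGeodesicOn (f : ℝ → X) (s : Set ℝ) : Prop :=
  ∀ u ∈ s, ∀ v ∈ s, dist (f u) (f v) = |u - v|

/-- Every pair of points of `X` is joined by a geodesic segment. -/
def GeodesicSpace (X : Type*) [MetricSpace X] : Prop :=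
  ∀ x y : X, ∃ f : ℝ → X, f 0 = x ∧ f (dist x y) = y ∧ IsGeodesicOn f (Icc 0 (dist x y))

/-- A geodesic ray in `X` (parametrised by `[0,∞)`; the values for negative times are
irrelevant). -/
structure GeodesicRay (X : Type*) [MetricSpace X] where
  toFun : ℝ → X
  geodesic : IsGeodesicOn toFun (Ici 0)

/-- Two rays are asymptotic if they stay at bounded distance from each other. -/
def GeodesicRay.Asymp (r₁ r₂ : GeodesicRay X) : Prop :=
  ∃ C : ℝ, ∀ t ≥ (0 : ℝ), dist (r₁.toFun t) (r₂.toFun t) ≤ C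

theorem asymp_equivalence (X : Type*) [MetricSpace X] :
    Equivalence (GeodesicRay.Asymp (X := X)) := by
  constructor
  · exact fun r => ⟨0, fun t _ => by simp⟩
  · rintro r₁ r₂ ⟨C, hC⟩
    exact ⟨C, fun t ht => by rw [dist_comm]; exact hC t ht⟩
  · rintro r₁ r₂ r₃ ⟨C, hC⟩ ⟨D, hD⟩
    exact ⟨C + D, fun t ht =>
      (dist_triangle _ (r₂.toFun t) _).trans (add_le_add (hC t ht) (hD t ht))⟩

/-- The setoid of asymptotic geodesic rays. -/
def raySetoid (X : Type*) [MetricSpace X] : Setoid (GeodesicRay X) :=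
  ⟨GeodesicRay.Asymp, asymp_equivalence X⟩

/-- The Gromov boundary of `X`: asymptotic classes of geodesic rays. -/
def GromovBoundary (X : Type*) [MetricSpace X] := Quotient (raySetoid X)

/-- The boundary point determined by a ray. -/
def GeodesicRay.pt (r : GeodesicRay X) : GromovBoundary X := Quotient.mk (raySetoid X) r

/-- The image of a geodesic ray under an isometry. -/
def rayMap (g : X ≃ᵢ X) (r : GeodesicRay X) : GeodesicRay X :=
  ⟨fun t => g (r.toFun t), fun u hu v hv => by
    rw [g.dist_eq]; exact r.geodesic u hu v hv⟩

/-- The induced action of an isometry on the Gromov boundary. -/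
def bmap (g : X ≃ᵢ X) : GromovBoundary X → GromovBoundary X :=
  Quotient.map (rayMap g) (by
    rintro r₁ r₂ ⟨C, hC⟩
    exact ⟨C, fun t ht => by simpa [rayMap, g.dist_eq] using hC t ht⟩)

/-- A sequence `x : ℕ → X` converges to the boundary point `ξ`: the Gromov products with a
representing ray go to infinity. -/
def SeqConv (o : X) (x : ℕ → X) (ξ : GromovBoundary X) : Prop :=
  ∃ r : GeodesicRay X, r.pt = ξ ∧
    Tendsto (fun p : ℕ × ℕ => gprod o (x p.1) (r.toFun p.2)) atTop atTop

/-- The limit set of a group of isometries: accumulation points of the orbit `G • o` on the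
Gromov boundary. -/
def limitSet (G : Subgroup (X ≃ᵢ X)) (o : X) : Set (GromovBoundary X) :=
  {ξ | ∃ g : ℕ → G, Tendsto (fun n => dist o ((g n : X ≃ᵢ X) o)) atTop atTop ∧
    SeqConv o (fun n => (g n : X ≃ᵢ X) o) ξ}

/-- `ξ` is a conical limit point of `G`: `ξ ∈ ΛG` and there are `R > 0`, a geodesic ray `σ`
ending at `ξ` and a sequence `gₙ ∈ G` with `gₙ o → ξ` and `d(gₙ o, σ) ≤ R`. -/
def conicalSet (G : Subgroup (X ≃ᵢ X)) (o : X) : Set (GromovBoundary X) :=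
  {ξ | ξ ∈ limitSet G o ∧ ∃ R > (0 : ℝ), ∃ σ : GeodesicRay X, σ.pt = ξ ∧ ∃ g : ℕ → G,
    SeqConv o (fun n => (g n : X ≃ᵢ X) o) ξ ∧
    ∀ n, infDist ((g n : X ≃ᵢ X) o) (σ.toFun '' Ici 0) ≤ R}

/-- The non-conical limit set. -/
def nonconicalSet (G : Subgroup (X ≃ᵢ X)) (o : X) : Set (GromovBoundary X) :=
  limitSet G o \ conicalSet G o

/-- The critical exponent `δ_G = limsup (1/n) log #{g ∈ G : d(o, g o) ≤ n}`. -/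
def critExp (G : Subgroup (X ≃ᵢ X)) (o : X) : ℝ :=
  limsup (fun n : ℕ =>
    Real.log (Set.ncard {g : X ≃ᵢ X | g ∈ G ∧ dist o (g o) ≤ n}) / n) atTop

/-- The action of `G` on `X` is properly discontinuous. -/
def ProperAct (G : Subgroup (X ≃ᵢ X)) : Prop :=
  ∀ (x : X) (R : ℝ), {g : X ≃ᵢ X | g ∈ G ∧ dist x (g x) ≤ R}.Finite

/-- A bi-infinite geodesic in `X`. -/
structure GeodesicLine (X : Type*) [MetricSpace X] where
  toFun : ℝ → X
  geodesic : IsGeodesicOn toFun univ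

/-- The positive geodesic ray of a line. -/
def GeodesicLine.posRay (l : GeodesicLine X) : GeodesicRay X :=
  ⟨l.toFun, fun u _ v _ => l.geodesic u trivial v trivial⟩

/-- The negative geodesic ray of a line. -/
def GeodesicLine.negRay (l : GeodesicLine X) : GeodesicRay X :=
  ⟨fun t => l.toFun (-t), fun u _ v _ => by
    rw [l.geodesic (-u) trivial (-v) trivial, neg_sub_neg, abs_sub_comm]⟩

/-- The line `l` joins the boundary points `ξ` and `η`. -/
def Joins (l : GeodesicLine X) (ξ η : GromovBoundary X) : Prop :=
  l.posRay.pt = ξ ∧ l.negRay.pt = η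

/-- The given metric on the Gromov boundary is a visual metric with parameter `ε` and
basepoint `o`: `dist ξ η ≍ exp (-ε d(o, [ξ,η]))` with a uniform multiplicative constant. -/
def IsVisualMetric (o : X) (ε : ℝ) [MetricSpace (GromovBoundary X)] : Prop :=
  ∃ C ≥ (1 : ℝ), ∀ ξ η : GromovBoundary X, ∀ l : GeodesicLine X, Joins l ξ η →
    dist ξ η ≤ C * Real.exp (-ε * infDist o (range l.toFun)) ∧
    Real.exp (-ε * infDist o (range l.toFun)) / C ≤ dist ξ η

end GromovScaffold

namespace GromovScaffold

variable {X : Type*} [MetricSpace X]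

/-- `h` is loxodromic: it has exactly two fixed points on the Gromov boundary. -/
def IsLoxodromic (h : X ≃ᵢ X) : Prop :=
  ∃ p q : GromovBoundary X, p ≠ q ∧ {ξ : GromovBoundary X | bmap h ξ = ξ} = {p, q}

/-- The (quasi-)axis of a loxodromic isometry: the union of all bi-infinite geodesics joining
its two boundary fixed points. -/
def axisSet (h : X ≃ᵢ X) : Set X :=
  {x | ∃ l : GeodesicLine X, (∃ p q : GromovBoundary X, p ≠ q ∧
      {ξ : GromovBoundary X | bmap h ξ = ξ} = {p, q} ∧ Joins l p q) ∧ x ∈ range l.toFun}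

/-- `G·Ax(h)`, the union of the `G`-translates of the axis of `h`. -/
def GAxis (G : Subgroup (X ≃ᵢ X)) (h : X ≃ᵢ X) : Set X :=
  ⋃ g ∈ (G : Set (X ≃ᵢ X)), g '' axisSet h

/-- The action has non-elementary limit set: at least three points. -/
def NonElementary (G : Subgroup (X ≃ᵢ X)) (o : X) : Prop :=
  ∃ a b c : GromovBoundary X, a ∈ limitSet G o ∧ b ∈ limitSet G o ∧ c ∈ limitSet G o ∧
    a ≠ b ∧ a ≠ c ∧ b ≠ c

end GromovScaffold

open GromovScaffold

namespace GromovScaffold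

section GromovProduct

variable {X : Type*} [MetricSpace X] {δ : ℝ}

theorem gprod_comm (o x y : X) : gprod o x y = gprod o y x := by
  unfold gprod; rw [dist_comm x y]; ring

theorem gprod_self_left (o x : X) : gprod o o x = 0 := by
  unfold gprod; rw [dist_self, dist_comm x o]; ring

theorem gprod_nonneg (o x y : X) : 0 ≤ gprod o x y := by
  unfold gprod; linarith [dist_triangle_right x y o]

theorem gprod_le_dist_left (o x y : X) : gprod o x y ≤ dist o x := by
  unfold gprod; linarith [dist_triangle y x o, dist_comm y x, dist_comm o x]

theorem gprod_le_dist_right (o x y : X) : gprod o x y ≤ dist o y := by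
  rw [gprod_comm]; exact gprod_le_dist_left o y x

theorem gprod_map (g : X ≃ᵢ X) (o x y : X) : gprod (g o) (g x) (g y) = gprod o x y := by
  simp [gprod, g.dist_eq]

/-- The Gromov product is `1`-Lipschitz in the base point. -/
theorem gprod_le_add_base (o p x y : X) : gprod o x y ≤ gprod p x y + dist o p := by
  unfold gprod
  linarith [dist_triangle x p o, dist_triangle y p o, dist_comm o p]

/-- The Gromov product is `1`-Lipschitz in the last variable. -/
theorem gprod_le_add_right (o x y z : X) : gprod o x y ≤ gprod o x z + dist y z := by
  unfold gprod
  linarith [dist_triangle x y z, dist_triangle y z o]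

theorem gprod_eq_dist_sub (o x y : X) : gprod o x y = dist o x - gprod x o y := by
  unfold gprod; rw [dist_comm x o, dist_comm y x, dist_comm y o]; ring

theorem dist_eq_sub_gprod (o x y : X) : dist x y = dist o x + dist o y - 2 * gprod o x y := by
  unfold gprod; rw [dist_comm x o, dist_comm y o]; ring

theorem dist_sub_le_gprod (o x y : X) : dist o x - dist x y ≤ gprod o x y := by
  unfold gprod; linarith [dist_triangle o y x, dist_comm x o, dist_comm y o, dist_comm x y]

theorem IsGromovHyperbolic.min_le (hhyp : IsGromovHyperbolic X δ) (o x z y : X) :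
    min (gprod o x z) (gprod o z y) ≤ gprod o x y + δ := by
  linarith [hhyp o x y z]

theorem IsGromovHyperbolic.min_min_le (hhyp : IsGromovHyperbolic X δ) (o x z w y : X) :
    min (gprod o x z) (min (gprod o z w) (gprod o w y)) ≤ gprod o x y + 2 * δ := by
  have h1 := hhyp.min_le o x z y
  have h2 := hhyp.min_le o z w y
  rcases min_le_iff.1 h1 with h | h
  · exact (min_le_left _ _).trans (by
      rcases le_or_gt 0 δ with h0 | h0
      · linarith
      · exfalso
        have h3 := hhyp o o o o
        simp only [gprod_self_left, min_self] at h3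
        linarith)
  · exact (min_le_right _ _).trans (by linarith)

end GromovProduct

section OrbitLoxodromic

variable {X : Type*} [MetricSpace X] {δ : ℝ}

/-- The orbit of `o` under the powers of `f` is unbounded, and its points lie, up to the
error `C`, in their natural order on geodesics. -/
def OrbitLoxodromic (o : X) (C : ℝ) (f : X ≃ᵢ X) : Prop :=
  (∀ i j k : ℤ, i ≤ j → j ≤ k → gprod ((f ^ j) o) ((f ^ i) o) ((f ^ k) o) ≤ C) ∧
    Tendsto (fun k : ℕ => dist o ((f ^ k) o)) atTop atTop

theorem isometryEquiv_one_apply (x : X) : (1 : X ≃ᵢ X) x = x := rfl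

theorem dist_inv_apply (o : X) (f : X ≃ᵢ X) : dist o (f⁻¹ o) = dist o (f o) := by
  rw [← f.dist_eq o (f⁻¹ o), IsometryEquiv.apply_inv_self, dist_comm]

theorem dist_mul_apply (o : X) (f g : X ≃ᵢ X) :
    dist o ((f * g) o) = dist (f⁻¹ o) (g o) := by
  rw [← f.dist_eq (f⁻¹ o), IsometryEquiv.apply_inv_self, IsometryEquiv.mul_apply]

theorem gprod_apply_base (g : X ≃ᵢ X) (o x y : X) :
    gprod (g o) x y = gprod o (g⁻¹ x) (g⁻¹ y) := by
  rw [← gprod_map g o, IsometryEquiv.apply_inv_self, IsometryEquiv.apply_inv_self]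

/-- An isometry whose displacement exceeds twice the Gromov product of its backtracking is
loxodromic. -/
theorem OrbitLoxodromic.of_gprod_lt (hδ : 0 ≤ δ) (hhyp : IsGromovHyperbolic X δ) (o : X)
    (g : X ≃ᵢ X) (h : 2 * gprod o (g o) (g⁻¹ o) + 3 * δ < dist o (g o)) :
    OrbitLoxodromic o (gprod o (g o) (g⁻¹ o) + 2 * δ) g := by
  have main : ∀ g : X ≃ᵢ X, 2 * gprod o (g o) (g⁻¹ o) + 3 * δ < dist o (g o) →
      ∀ n : ℕ, gprod o ((g ^ n)⁻¹ o) (g o) ≤ gprod o (g o) (g⁻¹ o) + δ := by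
    intro g h n
    set c := gprod o (g o) (g⁻¹ o) with hc
    have hc0 : 0 ≤ c := gprod_nonneg _ _ _
    induction n with
    | zero => simp [gprod_self_left]; linarith
    | succ n ih =>
      have h1 := hhyp.min_le o (g⁻¹ o) ((g ^ (n + 1))⁻¹ o) (g o)
      rw [gprod_comm o (g⁻¹ o) (g o), ← hc] at h1
      have h2 : gprod o (g⁻¹ o) ((g ^ (n + 1))⁻¹ o) =
          dist o (g o) - gprod o (g o) ((g ^ n)⁻¹ o) := by
        rw [gprod_eq_dist_sub, dist_inv_apply, gprod_apply_base, inv_inv, pow_succ, mul_inv_rev,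
          IsometryEquiv.mul_apply, IsometryEquiv.apply_inv_self]
      rw [gprod_comm o (g o)] at h2
      rcases min_le_iff.1 h1 with h3 | h3 <;> linarith
  set c := gprod o (g o) (g⁻¹ o) with hc
  have hc0 : 0 ≤ c := gprod_nonneg _ _ _
  have h1 := main g h
  have hinv : gprod o (g⁻¹ o) (g⁻¹⁻¹ o) = c := by rw [inv_inv, gprod_comm]
  have h2 := main g⁻¹ (by rw [hinv, dist_inv_apply]; exact h)
  rw [hinv] at h2
  have h3 : ∀ j k : ℕ, gprod o ((g ^ j)⁻¹ o) ((g ^ k) o) ≤ c + 2 * δ := by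
    intro j k
    rcases k with _ | k
    · rw [gprod_comm]; simp [gprod_self_left]; linarith
    · have h4 := hhyp.min_le o ((g ^ j)⁻¹ o) ((g ^ (k + 1)) o) (g o)
      have h5 : gprod o (g o) ((g ^ (k + 1)) o) = dist o (g o) - gprod o (g⁻¹ o) ((g ^ k) o) := by
        rw [gprod_eq_dist_sub, gprod_apply_base, pow_succ', IsometryEquiv.mul_apply,
          IsometryEquiv.inv_apply_self]
      have h6 := h2 k
      rw [← inv_pow, inv_inv, gprod_comm] at h6
      rw [gprod_comm o _ (g o)] at h4
      rcases min_le_iff.1 h4 with h7 | h7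
      · linarith [h1 j]
      · linarith [h1 j]
  refine ⟨fun i j k hij hjk => ?_, ?_⟩
  · rw [gprod_apply_base, ← zpow_neg, ← IsometryEquiv.mul_apply, ← IsometryEquiv.mul_apply,
      ← zpow_add, ← zpow_add]
    obtain ⟨a, ha⟩ := Int.eq_ofNat_of_zero_le (sub_nonneg.2 hij)
    obtain ⟨b, hb⟩ := Int.eq_ofNat_of_zero_le (sub_nonneg.2 hjk)
    rw [show -j + i = -(a : ℤ) by omega, show -j + k = (b : ℤ) by omega, zpow_neg]
    exact_mod_cast h3 a b
  · have h4 : ∀ n : ℕ, n * (dist o (g o) - 2 * c - 2 * δ) ≤ dist o ((g ^ n) o) := by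
      intro n
      induction n with
      | zero => simp
      | succ n ih =>
        rw [pow_succ, dist_mul_apply, dist_eq_sub_gprod o ((g ^ n)⁻¹ o), dist_inv_apply]
        push_cast
        linarith [h1 n]
    refine tendsto_atTop_mono h4 (Tendsto.atTop_mul_const (by linarith) ?_)
    exact tendsto_natCast_atTop_atTop

/-- In a group without loxodromic elements all orbit points far from `o` lie in the same
direction. -/
theorem min_dist_le_gprod (hδ : 0 ≤ δ) (hhyp : IsGromovHyperbolic X δ) (o : X)
    (H : Subgroup (X ≃ᵢ X)) (hH : ∀ g ∈ H, ∀ C, ¬ OrbitLoxodromic o C g) {g h : X ≃ᵢ X}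
    (hg : g ∈ H) (hh : h ∈ H) :
    min (dist o (g o)) (dist o (h o)) ≤ 2 * gprod o (g o) (h o) + 6 * δ := by
  have key : ∀ g ∈ H, dist o (g o) ≤ 2 * gprod o (g o) (g⁻¹ o) + 3 * δ := fun g hg =>
    not_lt.1 fun hlt => hH g hg _ (OrbitLoxodromic.of_gprod_lt hδ hhyp o g hlt)
  by_contra! hlt
  obtain ⟨hA, hB⟩ := lt_min_iff.1 hlt
  have hg1 := key g hg
  have hh1 := key h hh
  have hgh := key (g * h) (H.mul_mem hg hh)
  have e1 : gprod o (g⁻¹ o) (h o) ≤ gprod o (g o) (h o) + δ := by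
    rcases min_le_iff.1 (hhyp.min_le o (g o) (g⁻¹ o) (h o)) with h1 | h1 <;> linarith
  have e2 : gprod o (g o) (h⁻¹ o) ≤ gprod o (g o) (h o) + δ := by
    rcases min_le_iff.1 (hhyp.min_le o (g o) (h⁻¹ o) (h o)) with h1 | h1
    · linarith
    · rw [gprod_comm o (h⁻¹ o)] at h1
      linarith
  have e3 : dist o ((g * h) o) = dist o (g o) + dist o (h o) - 2 * gprod o (g⁻¹ o) (h o) := by
    rw [dist_mul_apply, dist_eq_sub_gprod o (g⁻¹ o), dist_inv_apply]
  have e4 : gprod o (g o) ((g * h) o) = dist o (g o) - gprod o (g⁻¹ o) (h o) := by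
    rw [gprod_eq_dist_sub, gprod_apply_base, IsometryEquiv.mul_apply, IsometryEquiv.inv_apply_self]
  have e5 : gprod o ((g * h)⁻¹ o) (h⁻¹ o) = dist o (h o) - gprod o (g⁻¹ o) (h o) := by
    rw [gprod_comm, gprod_eq_dist_sub, gprod_apply_base, dist_inv_apply, mul_inv_rev, inv_inv,
      IsometryEquiv.mul_apply, IsometryEquiv.apply_inv_self, gprod_comm]
  have e6 := hhyp.min_min_le o (g o) ((g * h) o) ((g * h)⁻¹ o) (h⁻¹ o)
  rcases min_le_iff.1 e6 with h1 | h1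
  · linarith
  · rcases min_le_iff.1 h1 with h2 | h2 <;> linarith

/-- A point seeing two far away orbit points `f⁻ⁿ o` and `fⁿ o` in opposite directions is close
to the orbit. -/
theorem OrbitLoxodromic.exists_dist_le (hhyp : IsGromovHyperbolic X δ)
    {o : X} {C : ℝ} {f : X ≃ᵢ X} (hf : OrbitLoxodromic o C f) {z : X} {D : ℝ} {n : ℕ}
    (hz : gprod z ((f ^ (-n : ℤ)) o) ((f ^ (n : ℤ)) o) ≤ D) :
    ∃ k : ℤ, dist z ((f ^ k) o) ≤ 2 * (C + δ + dist o (f o)) + D := by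
  set x := (f ^ (-n : ℤ)) o with hx
  set y := (f ^ (n : ℤ)) o with hy
  have h0 : 0 ≤ C + δ := by
    have h1 := hhyp o o o o
    simp only [gprod_self_left, min_self] at h1
    have h2 := hf.1 0 0 0 le_rfl le_rfl
    have h3 := gprod_nonneg ((f ^ (0 : ℤ)) o) ((f ^ (0 : ℤ)) o) ((f ^ (0 : ℤ)) o)
    linarith
  have hL : 0 ≤ dist o (f o) := dist_nonneg
  have step : ∀ k : ℤ, dist ((f ^ k) o) ((f ^ (k + 1)) o) = dist o (f o) := by
    intro k
    rw [zpow_add, IsometryEquiv.mul_apply, zpow_one, IsometryEquiv.dist_eq]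
  have alt : ∀ k : ℤ, -n ≤ k → k ≤ n →
      gprod ((f ^ k) o) x z ≤ C + δ ∨ gprod ((f ^ k) o) z y ≤ C + δ := by
    intro k h1 h2
    have h3 := hhyp.min_le ((f ^ k) o) x z y
    have h4 := hf.1 (-n) k n h1 h2
    rcases min_le_iff.1 h3 with h | h
    · left; linarith
    · right; linarith
  suffices ∃ k : ℤ, gprod ((f ^ k) o) x z ≤ C + δ + dist o (f o) ∧
      gprod ((f ^ k) o) z y ≤ C + δ + dist o (f o) by
    obtain ⟨k, h1, h2⟩ := this
    refine ⟨k, ?_⟩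
    have h3 := dist_triangle x ((f ^ k) o) y
    unfold gprod at h1 h2 hz
    rw [dist_comm x z] at h1 hz
    rw [dist_comm y z] at hz
    rw [dist_comm ((f ^ k) o) y] at h3
    linarith
  by_contra! hno
  have all : ∀ m : ℕ, m ≤ 2 * n → gprod ((f ^ (-n + m : ℤ)) o) x z ≤ C + δ := by
    intro m
    induction m with
    | zero =>
      intro _
      simp only [Nat.cast_zero, add_zero]
      rw [← hx, gprod_self_left]; exact h0
    | succ m ih =>
      intro hm
      have h1 := ih (by omega)
      have h2 := hno (-n + m) (by linarith)
      rcases alt (-n + (m + 1 : ℕ)) (by push_cast; omega) (by push_cast; omega) with h3 | h3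
      · exact h3
      · have h4 := gprod_le_add_base ((f ^ (-n + m : ℤ)) o) ((f ^ (-n + m + 1 : ℤ)) o) z y
        rw [step] at h4
        push_cast at h3
        rw [← add_assoc] at h3
        linarith
  have h1 := all (2 * n) le_rfl
  rw [show (-n + (2 * n : ℕ) : ℤ) = n by push_cast; ring] at h1
  have h2 := hno n (by linarith)
  rw [← hy, gprod_comm, gprod_self_left] at h2
  linarith

end OrbitLoxodromic

section GromovSequences

variable {X : Type*} [MetricSpace X] {δ : ℝ}

/-- The sequences `x` and `y` converge to a common point at infinity. -/
def GromovConv (o : X) (x y : ℕ → X) : Prop :=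
  ∀ M : ℝ, ∃ N : ℕ, ∀ i ≥ N, ∀ j ≥ N, M ≤ gprod o (x i) (y j)

theorem gromovConv_of_tendsto {o : X} {x y : ℕ → X}
    (h : Tendsto (fun p : ℕ × ℕ => gprod o (x p.1) (y p.2)) atTop atTop) :
    GromovConv o x y := by
  intro M
  obtain ⟨⟨a, b⟩, hab⟩ := eventually_atTop.1 (tendsto_atTop.1 h M)
  exact ⟨max a b, fun i hi j hj =>
    hab (i, j) ⟨(le_max_left _ _).trans hi, (le_max_right _ _).trans hj⟩⟩

theorem GromovConv.symm {o : X} {x y : ℕ → X} (h : GromovConv o x y) : GromovConv o y x := by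
  intro M
  obtain ⟨N, hN⟩ := h M
  exact ⟨N, fun i hi j hj => by rw [gprod_comm]; exact hN j hj i hi⟩

theorem GromovConv.trans (hhyp : IsGromovHyperbolic X δ) {o : X} {x y z : ℕ → X}
    (h : GromovConv o x y) (h' : GromovConv o y z) : GromovConv o x z := by
  intro M
  obtain ⟨N, hN⟩ := h (M + δ)
  obtain ⟨N', hN'⟩ := h' (M + δ)
  refine ⟨max N N', fun i hi j hj => ?_⟩
  have h1 := hhyp o (x i) (z j) (y (max N N'))
  have h2 := hN i ((le_max_left _ _).trans hi) (max N N') (le_max_left _ _)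
  have h3 := hN' (max N N') (le_max_right _ _) j ((le_max_right _ _).trans hj)
  linarith [le_min h2 h3]

theorem GromovConv.base {o : X} {x y : ℕ → X} (h : GromovConv o x y) (p : X) :
    GromovConv p x y := by
  intro M
  obtain ⟨N, hN⟩ := h (M + dist o p)
  exact ⟨N, fun i hi j hj => by
    linarith [hN i hi j hj, gprod_le_add_base o p (x i) (y j)]⟩

theorem GromovConv.map {o : X} {x y : ℕ → X} (h : GromovConv o x y) (g : X ≃ᵢ X) :
    GromovConv o (fun n => g (x n)) (fun n => g (y n)) := by
  refine GromovConv.base (o := g o) ?_ o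
  intro M
  obtain ⟨N, hN⟩ := h M
  exact ⟨N, fun i hi j hj => by rw [gprod_map]; exact hN i hi j hj⟩

theorem GromovConv.of_dist_le {o : X} {x y z : ℕ → X} (h : GromovConv o x y) {B : ℝ}
    (hB : ∀ n, dist (y n) (z n) ≤ B) : GromovConv o x z := by
  intro M
  obtain ⟨N, hN⟩ := h (M + B)
  exact ⟨N, fun i hi j hj => by
    linarith [hN i hi j hj, gprod_le_add_right o (x i) (y j) (z j), hB j]⟩

/-- Two sequences converging at infinity have the same limit or bounded Gromov products. -/
theorem gromovConv_or_bounded (hhyp : IsGromovHyperbolic X δ) {o : X} {x y : ℕ → X}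
    (hx : GromovConv o x x) (hy : GromovConv o y y) :
    GromovConv o x y ∨ ∃ M, ∀ i j, gprod o (x i) (y j) ≤ M := by
  by_contra! hcon
  obtain ⟨h1, h2⟩ := hcon
  refine h1 fun M => ?_
  obtain ⟨N, hN⟩ := hx (M + 2 * δ)
  obtain ⟨N', hN'⟩ := hy (M + 2 * δ)
  obtain ⟨B, hB⟩ := ((Set.finite_Iio N).image fun i => dist o (x i)).bddAbove
  obtain ⟨B', hB'⟩ := ((Set.finite_Iio N').image fun i => dist o (y i)).bddAbove
  obtain ⟨i, j, hij⟩ := h2 (max (M + 2 * δ) (max B B'))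
  obtain ⟨h3, h4, h5⟩ : M + 2 * δ < gprod o (x i) (y j) ∧ B < gprod o (x i) (y j) ∧
      B' < gprod o (x i) (y j) := by simpa using hij
  have hi : N ≤ i := by
    by_contra! hlt
    linarith [hB ⟨i, hlt, rfl⟩, gprod_le_dist_left o (x i) (y j)]
  have hj : N' ≤ j := by
    by_contra! hlt
    linarith [hB' ⟨j, hlt, rfl⟩, gprod_le_dist_right o (x i) (y j)]
  refine ⟨max N N', fun a ha b hb => ?_⟩
  have h6 := hhyp.min_min_le o (x a) (x i) (y j) (y b)
  have h7 := hN a ((le_max_left _ _).trans ha) i hi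
  have h8 := hN' j hj b ((le_max_right _ _).trans hb)
  linarith [le_min h7 (le_min h3.le h8)]

theorem GeodesicRay.dist_eq (r : GeodesicRay X) {s t : ℝ} (hs : 0 ≤ s) (ht : 0 ≤ t) :
    dist (r.toFun s) (r.toFun t) = |s - t| := r.geodesic s hs t ht

theorem GeodesicRay.gprod_eq (r : GeodesicRay X) {s t : ℝ} (hs : 0 ≤ s) (ht : 0 ≤ t) :
    gprod (r.toFun 0) (r.toFun s) (r.toFun t) = min s t := by
  unfold gprod
  rw [r.dist_eq hs le_rfl, r.dist_eq ht le_rfl, r.dist_eq hs ht, sub_zero, sub_zero,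
    abs_of_nonneg hs, abs_of_nonneg ht]
  rcases le_total s t with h | h
  · rw [min_eq_left h, abs_of_nonpos (by linarith)]; ring
  · rw [min_eq_right h, abs_of_nonneg (by linarith)]; ring

theorem GeodesicRay.gromovConv_self (r : GeodesicRay X) (o : X) :
    GromovConv o (fun n => r.toFun n) (fun n => r.toFun n) := by
  refine GromovConv.base (o := r.toFun 0) (fun M => ?_) o
  obtain ⟨N, hN⟩ := exists_nat_ge M
  refine ⟨N, fun i hi j hj => ?_⟩
  rw [r.gprod_eq (Nat.cast_nonneg _) (Nat.cast_nonneg _)]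
  exact le_min (hN.trans (Nat.cast_le.2 hi)) (hN.trans (Nat.cast_le.2 hj))

theorem GeodesicRay.Asymp.gromovConv {r s : GeodesicRay X} (h : r.Asymp s) (o : X) :
    GromovConv o (fun n => r.toFun n) (fun n => s.toFun n) := by
  obtain ⟨C, hC⟩ := h
  exact (r.gromovConv_self o).of_dist_le fun n => hC n (Nat.cast_nonneg _)

theorem GeodesicRay.asymp_of_gromovConv (hhyp : IsGromovHyperbolic X δ) {o : X}
    {r s : GeodesicRay X} (h : GromovConv o (fun n => r.toFun n) (fun n => s.toFun n)) :
    r.Asymp s := by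
  have h0 := h.base (r.toFun 0)
  refine ⟨3 * dist (r.toFun 0) (s.toFun 0) + 4 * δ, fun t ht => ?_⟩
  obtain ⟨N, hN⟩ := h0 t
  obtain ⟨N', hN'⟩ := exists_nat_ge t
  have hn : t ≤ ((max N N' : ℕ) : ℝ) := hN'.trans (Nat.cast_le.2 (le_max_right _ _))
  have h1 := hN (max N N') (le_max_left _ _) (max N N') (le_max_left _ _)
  have h2 := r.gprod_eq ht (Nat.cast_nonneg (max N N'))
  rw [min_eq_left hn] at h2
  have h3 := s.gprod_eq (Nat.cast_nonneg (max N N')) ht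
  rw [min_eq_right hn] at h3
  have h4 := gprod_le_add_base (s.toFun 0) (r.toFun 0) (s.toFun (max N N' : ℕ)) (s.toFun t)
  have h5 := hhyp.min_min_le (r.toFun 0) (r.toFun t) (r.toFun (max N N' : ℕ))
    (s.toFun (max N N' : ℕ)) (s.toFun t)
  have h6 : t - dist (r.toFun 0) (s.toFun 0) ≤ gprod (r.toFun 0) (r.toFun t) (s.toFun t) +
      2 * δ := by
    refine le_trans (le_min ?_ (le_min ?_ ?_)) h5
    · linarith [dist_nonneg (x := r.toFun 0) (y := s.toFun 0)]
    · linarith [dist_nonneg (x := r.toFun 0) (y := s.toFun 0)]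
    · rw [dist_comm (r.toFun 0)]; linarith
  have h7 := r.dist_eq le_rfl ht
  have h8 := s.dist_eq le_rfl ht
  rw [zero_sub, abs_neg, abs_of_nonneg ht] at h7 h8
  rw [dist_eq_sub_gprod (r.toFun 0)]
  linarith [dist_triangle (r.toFun 0) (s.toFun 0) (s.toFun t)]

theorem GeodesicRay.pt_eq_iff {r s : GeodesicRay X} : r.pt = s.pt ↔ r.Asymp s :=
  Quotient.eq (r := raySetoid X)

theorem GeodesicRay.pt_eq_iff_gromovConv (hhyp : IsGromovHyperbolic X δ) (o : X)
    {r s : GeodesicRay X} :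
    r.pt = s.pt ↔ GromovConv o (fun n => r.toFun n) (fun n => s.toFun n) :=
  pt_eq_iff.trans ⟨fun h => h.gromovConv o, asymp_of_gromovConv hhyp⟩

theorem GeodesicRay.exists_pt_eq (ξ : GromovBoundary X) : ∃ r : GeodesicRay X, r.pt = ξ :=
  Quotient.exists_rep ξ

end GromovSequences

section LoxodromicLine

variable {X : Type*} [MetricSpace X] {δ : ℝ} {o : X} {C : ℝ} {f : X ≃ᵢ X}

theorem OrbitLoxodromic.inv (hf : OrbitLoxodromic o C f) : OrbitLoxodromic o C f⁻¹ := by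
  refine ⟨fun i j k hij hjk => ?_, ?_⟩
  · rw [inv_zpow', inv_zpow', inv_zpow', gprod_comm]
    exact hf.1 _ _ _ (by omega) (by omega)
  · refine hf.2.congr fun k => ?_
    rw [inv_pow, dist_inv_apply]

theorem OrbitLoxodromic.sub_le_gprod (hf : OrbitLoxodromic o C f) {k n : ℕ} (hkn : k ≤ n) :
    dist o ((f ^ k) o) - C ≤ gprod o ((f ^ k) o) ((f ^ n) o) := by
  have h := hf.1 0 k n (by omega) (by omega)
  simp only [zpow_zero, zpow_natCast, isometryEquiv_one_apply] at h
  rw [gprod_eq_dist_sub]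
  linarith

theorem OrbitLoxodromic.gromovConv_self (hf : OrbitLoxodromic o C f) :
    GromovConv o (fun n => (f ^ n) o) (fun n => (f ^ n) o) := by
  intro M
  obtain ⟨N, hN⟩ := eventually_atTop.1 (tendsto_atTop.1 hf.2 (M + C))
  refine ⟨N, fun i hi j hj => ?_⟩
  rcases le_total i j with h | h
  · linarith [hN i hi, hf.sub_le_gprod h]
  · rw [gprod_comm]
    linarith [hN j hj, hf.sub_le_gprod h]

theorem OrbitLoxodromic.gprod_inv_le (hf : OrbitLoxodromic o C f) (j k : ℕ) :
    gprod o ((f⁻¹ ^ j) o) ((f ^ k) o) ≤ C := by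
  have h := hf.1 (-j) 0 k (by omega) (by omega)
  simpa only [zpow_zero, zpow_natCast, zpow_neg, inv_pow, isometryEquiv_one_apply] using h

/-- A geodesic from `x` to `y`, parametrised so as to pass near `o` at time `0`. -/
theorem exists_geodesic_near (hhyp : IsGromovHyperbolic X δ) (hgeo : GeodesicSpace X) (o x y : X) :
    ∃ τ : ℝ → X, dist o (τ 0) ≤ gprod o x y + 2 * δ ∧
      IsGeodesicOn τ (Icc (-(dist o x - gprod o x y)) (dist o y - gprod o x y)) ∧
      τ (-(dist o x - gprod o x y)) = x ∧ τ (dist o y - gprod o x y) = y := by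
  obtain ⟨σ, h0, h1, hσ⟩ := hgeo x y
  have ha : 0 ≤ dist o x - gprod o x y := sub_nonneg.2 (gprod_le_dist_left _ _ _)
  have hb : 0 ≤ dist o y - gprod o x y := sub_nonneg.2 (gprod_le_dist_right _ _ _)
  have hab := dist_eq_sub_gprod o x y
  have hgeod : IsGeodesicOn (fun t => σ (t + (dist o x - gprod o x y)))
      (Icc (-(dist o x - gprod o x y)) (dist o y - gprod o x y)) := by
    intro u hu v hv
    have h := hσ (u + (dist o x - gprod o x y)) ⟨by linarith [hu.1], by linarith [hu.2]⟩
      (v + (dist o x - gprod o x y)) ⟨by linarith [hv.1], by linarith [hv.2]⟩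
    simpa using h
  have hx : σ (-(dist o x - gprod o x y) + (dist o x - gprod o x y)) = x := by
    rw [neg_add_cancel, h0]
  have hy : σ (dist o y - gprod o x y + (dist o x - gprod o x y)) = y := by
    rw [show dist o y - gprod o x y + (dist o x - gprod o x y) = dist x y by linarith, h1]
  refine ⟨_, ?_, hgeod, hx, hy⟩
  have hxz := hgeod _ ⟨le_rfl, by linarith⟩ 0 ⟨by linarith, by linarith⟩
  have hyz := hgeod _ ⟨by linarith, le_rfl⟩ 0 ⟨by linarith, by linarith⟩
  simp only [hx, hy, sub_zero, abs_neg] at hxz hyz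
  rw [abs_of_nonneg ha] at hxz
  rw [abs_of_nonneg hb] at hyz
  set z := σ (0 + (dist o x - gprod o x y)) with hz
  have h4 := hhyp.min_le z x o y
  have e1 : gprod z x y = 0 := by
    unfold gprod; rw [hxz, hyz, hab]; ring
  have e2 : gprod z x o = (dist o z - gprod o x y) / 2 := by
    unfold gprod; rw [hxz]; unfold gprod; rw [dist_comm x o]; ring
  have e3 : gprod z o y = (dist o z - gprod o x y) / 2 := by
    unfold gprod; rw [hyz]; unfold gprod; rw [dist_comm y o]; ring
  rw [e1, e2, e3, min_self] at h4
  show dist o z ≤ _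
  linarith

theorem exists_tendsto_ultrafilter [ProperSpace X] (U : Ultrafilter ℕ) (x : ℕ → X) (o : X) (R : ℝ)
    (h : ∀ᶠ n in (U : Filter ℕ), dist o (x n) ≤ R) :
    ∃ a, Tendsto x U (nhds a) := by
  have hmem : x ⁻¹' closedBall o R ∈ (U : Filter ℕ) := by
    filter_upwards [h] with n hn
    rwa [mem_preimage, mem_closedBall, dist_comm]
  obtain ⟨a, -, ha⟩ :=
    (isCompact_closedBall o R).ultrafilter_le_nhds (U.map x) (le_principal_iff.2 hmem)
  exact ⟨a, ha⟩

theorem continuous_gprod_left (o y : X) : Continuous fun x => gprod o x y := by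
  unfold gprod; fun_prop

/-- The points at infinity of the orbit of a loxodromic isometry are joined by a geodesic. -/
theorem OrbitLoxodromic.exists_line [ProperSpace X] (hhyp : IsGromovHyperbolic X δ)
    (hgeo : GeodesicSpace X) (hf : OrbitLoxodromic o C f) :
    ∃ l : GeodesicLine X,
      GromovConv o (fun n => l.posRay.toFun n) (fun n => (f ^ n) o) ∧
      GromovConv o (fun n => l.negRay.toFun n) (fun n => (f⁻¹ ^ n) o) := by
  choose τ h0 hτ hx hy using fun n : ℕ => exists_geodesic_near hhyp hgeo o ((f⁻¹ ^ n) o) ((f ^ n) o)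
  set a : ℕ → ℝ := fun n => -(dist o ((f⁻¹ ^ n) o) - gprod o ((f⁻¹ ^ n) o) ((f ^ n) o))
  set b : ℕ → ℝ := fun n => dist o ((f ^ n) o) - gprod o ((f⁻¹ ^ n) o) ((f ^ n) o)
  have h0' : ∀ n, dist o (τ n 0) ≤ C + 2 * δ := fun n => by linarith [h0 n, hf.gprod_inv_le n n]
  have hb : ∀ t, ∀ᶠ n in atTop, t ≤ b n := fun t => by
    filter_upwards [tendsto_atTop.1 hf.2 (t + C)] with n hn
    simp only [b]
    linarith [hf.gprod_inv_le n n]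
  have ha : ∀ t, ∀ᶠ n in atTop, a n ≤ t := fun t => by
    filter_upwards [tendsto_atTop.1 hf.inv.2 (-t + C)] with n hn
    simp only [a]
    linarith [hf.gprod_inv_le n n]
  have hdist : ∀ s t, ∀ᶠ n in atTop, dist (τ n s) (τ n t) = |s - t| := fun s t => by
    filter_upwards [ha s, ha t, hb s, hb t] with n h1 h2 h3 h4
    exact hτ n s ⟨h1, h3⟩ t ⟨h2, h4⟩
  set U : Ultrafilter ℕ := hyperfilter ℕ
  have hU : (U : Filter ℕ) ≤ atTop := by
    rw [← Nat.cofinite_eq_atTop]; exact hyperfilter_le_cofinite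
  have hlim : ∀ t, ∃ p, Tendsto (fun n => τ n t) U (nhds p) := fun t => by
    refine exists_tendsto_ultrafilter U _ o (C + 2 * δ + |t|) ?_
    filter_upwards [hU (hdist 0 t)] with n hn
    rw [zero_sub, abs_neg] at hn
    linarith [dist_triangle o (τ n 0) (τ n t), h0' n]
  choose l hl using hlim
  have hgl : IsGeodesicOn l univ := fun s _ t _ => by
    refine tendsto_nhds_unique ((hl s).dist (hl t)) (tendsto_const_nhds.congr' ?_)
    filter_upwards [hU (hdist s t)] with n hn using hn.symm
  have key : ∀ (t : ℝ) (w : X) (m : ℝ),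
      (∀ᶠ n in atTop, m ≤ gprod o (τ n t) w) → m ≤ gprod o (l t) w := fun t w m h =>
    ge_of_tendsto (((continuous_gprod_left o w).tendsto _).comp (hl t)) (hU h)
  have hpos : ∀ t ≥ (0 : ℝ), ∀ k : ℕ,
      min (t - (C + 2 * δ)) (dist o ((f ^ k) o) - C) - δ ≤ gprod o (l t) ((f ^ k) o) := by
    intro t ht k
    refine key _ _ _ ?_
    filter_upwards [ha 0, hb t, eventually_ge_atTop k] with n h1 h2 h3
    refine le_trans (sub_le_sub_right (min_le_min ?_ ?_) _) (hhyp o _ _ ((f ^ n) o))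
    · have e1 := hτ n t ⟨h1.trans ht, h2⟩ (b n) ⟨(h1.trans ht).trans h2, le_rfl⟩
      have e2 := hτ n t ⟨h1.trans ht, h2⟩ 0 ⟨h1, ht.trans h2⟩
      have e3 := hτ n (b n) ⟨(h1.trans ht).trans h2, le_rfl⟩ 0 ⟨h1, ht.trans h2⟩
      have e4 := gprod_le_add_base (τ n 0) o (τ n t) ((f ^ n) o)
      rw [hy n] at e1 e3
      rw [sub_zero, abs_of_nonneg ht] at e2
      rw [sub_zero, abs_of_nonneg (ht.trans h2)] at e3
      rw [abs_of_nonpos (by linarith)] at e1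
      have e5 : gprod (τ n 0) (τ n t) ((f ^ n) o) = t := by
        unfold gprod; rw [e1, e2, e3]; ring
      rw [dist_comm] at e4
      linarith [h0' n]
    · rw [gprod_comm]; exact hf.sub_le_gprod h3
  have hneg : ∀ t ≥ (0 : ℝ), ∀ k : ℕ,
      min (t - (C + 2 * δ)) (dist o ((f⁻¹ ^ k) o) - C) - δ ≤ gprod o (l (-t)) ((f⁻¹ ^ k) o) := by
    intro t ht k
    refine key _ _ _ ?_
    filter_upwards [hb 0, ha (-t), eventually_ge_atTop k] with n h1 h2 h3
    have ht' : -t ≤ 0 := by linarith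
    refine le_trans (sub_le_sub_right (min_le_min ?_ ?_) _) (hhyp o _ _ ((f⁻¹ ^ n) o))
    · have e1 := hτ n (-t) ⟨h2, ht'.trans h1⟩ (a n) ⟨le_rfl, (h2.trans ht').trans h1⟩
      have e2 := hτ n (-t) ⟨h2, ht'.trans h1⟩ 0 ⟨h2.trans ht', h1⟩
      have e3 := hτ n (a n) ⟨le_rfl, (h2.trans ht').trans h1⟩ 0 ⟨h2.trans ht', h1⟩
      have e4 := gprod_le_add_base (τ n 0) o (τ n (-t)) ((f⁻¹ ^ n) o)
      rw [hx n] at e1 e3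
      rw [sub_zero, abs_neg, abs_of_nonneg ht] at e2
      rw [sub_zero, abs_of_nonpos (h2.trans ht')] at e3
      rw [abs_of_nonneg (by linarith)] at e1
      have e5 : gprod (τ n 0) (τ n (-t)) ((f⁻¹ ^ n) o) = t := by
        unfold gprod; rw [e1, e2, e3]; ring
      rw [dist_comm] at e4
      linarith [h0' n]
    · rw [gprod_comm]; exact hf.inv.sub_le_gprod h3
  have conv : ∀ (r : ℕ → X) (g : X ≃ᵢ X), OrbitLoxodromic o C g →
      (∀ n k : ℕ, min (n - (C + 2 * δ)) (dist o ((g ^ k) o) - C) - δ ≤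
        gprod o (r n) ((g ^ k) o)) → GromovConv o r (fun n => (g ^ n) o) := by
    intro r g hg h M
    obtain ⟨N, hN⟩ := eventually_atTop.1 (tendsto_atTop.1 hg.2 (M + δ + C))
    obtain ⟨N', hN'⟩ := exists_nat_ge (M + δ + (C + 2 * δ))
    refine ⟨max N N', fun i hi j hj => le_trans ?_ (h i j)⟩
    have h1 := hN j ((le_max_left _ _).trans hj)
    have h2 : (N' : ℝ) ≤ i := Nat.cast_le.2 ((le_max_right _ _).trans hi)
    have h3 : M + δ ≤ min (i - (C + 2 * δ)) (dist o ((g ^ j) o) - C) :=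
      le_min (by linarith) (by linarith)
    linarith
  exact ⟨⟨l, hgl⟩, conv _ f hf fun n k => hpos n (Nat.cast_nonneg n) k,
    conv _ f⁻¹ hf.inv fun n k => hneg n (Nat.cast_nonneg n) k⟩

end LoxodromicLine

section FixedPoints

variable {X : Type*} [MetricSpace X] {δ : ℝ} {o : X} {C : ℝ} {f : X ≃ᵢ X}

theorem bmap_pt (g : X ≃ᵢ X) (r : GeodesicRay X) : bmap g r.pt = (rayMap g r).pt := rfl

theorem bmap_mul (g h : X ≃ᵢ X) (ξ : GromovBoundary X) : bmap (g * h) ξ = bmap g (bmap h ξ) := by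
  obtain ⟨r, rfl⟩ := GeodesicRay.exists_pt_eq ξ
  rfl

theorem bmap_one (ξ : GromovBoundary X) : bmap 1 ξ = ξ := by
  obtain ⟨r, rfl⟩ := GeodesicRay.exists_pt_eq ξ
  rfl

theorem GromovConv.comp_succ {x : ℕ → X} (h : GromovConv o x x) :
    GromovConv o x (fun n => x (n + 1)) := by
  intro M
  obtain ⟨N, hN⟩ := h M
  exact ⟨N, fun i hi j hj => hN i hi (j + 1) (by omega)⟩

/-- The limit of the positive orbit is fixed. -/
theorem OrbitLoxodromic.bmap_eq_self (hhyp : IsGromovHyperbolic X δ) (hf : OrbitLoxodromic o C f)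
    {r : GeodesicRay X} (hr : GromovConv o (fun n => r.toFun n) (fun n => (f ^ n) o)) :
    bmap f r.pt = r.pt := by
  rw [bmap_pt, GeodesicRay.pt_eq_iff_gromovConv hhyp o]
  have h1 := hr.map f
  have h2 : (fun n : ℕ => f ((f ^ n) o)) = fun n => (f ^ (n + 1)) o := by
    funext n
    rw [pow_succ', IsometryEquiv.mul_apply]
  rw [h2] at h1
  exact (h1.trans hhyp hf.gromovConv_self.comp_succ.symm).trans hhyp hr.symm

theorem bmap_inv_eq_self {ξ : GromovBoundary X} : bmap f⁻¹ ξ = ξ ↔ bmap f ξ = ξ := by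
  constructor
  · intro h
    rw [← h, ← bmap_mul, mul_inv_cancel, bmap_one, h]
  · intro h
    rw [← h, ← bmap_mul, inv_mul_cancel, bmap_one, h]

theorem dist_pow_le (f : X ≃ᵢ X) {x : X} {B : ℝ} (h : dist (f x) x ≤ B) (k : ℕ) :
    dist ((f ^ k) x) x ≤ k * B := by
  induction k with
  | zero => simp [isometryEquiv_one_apply]
  | succ k ih =>
    rw [pow_succ, IsometryEquiv.mul_apply]
    have h1 := dist_triangle ((f ^ k) (f x)) ((f ^ k) x) x
    rw [IsometryEquiv.dist_eq] at h1
    push_cast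
    linarith

/-- A ray moved by a bounded amount by a loxodromic isometry ends at one of its two limit
points. -/
theorem OrbitLoxodromic.gromovConv_of_fixed (hhyp : IsGromovHyperbolic X δ)
    (hf : OrbitLoxodromic o C f) {r : GeodesicRay X} (hr : bmap f r.pt = r.pt) :
    GromovConv o (fun n => r.toFun n) (fun n => (f ^ n) o) ∨
      GromovConv o (fun n => r.toFun n) (fun n => (f⁻¹ ^ n) o) := by
  by_contra! hcon
  obtain ⟨M, hM⟩ := (gromovConv_or_bounded hhyp (r.gromovConv_self o)
    hf.gromovConv_self).resolve_left hcon.1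
  obtain ⟨M', hM'⟩ := (gromovConv_or_bounded hhyp (r.gromovConv_self o)
    hf.inv.gromovConv_self).resolve_left hcon.2
  obtain ⟨B, hB⟩ := GeodesicRay.pt_eq_iff.1 hr
  obtain ⟨k, hk⟩ := (tendsto_atTop.1 hf.2 (M + M' + δ + 1)).exists
  obtain ⟨n, hn⟩ := exists_nat_ge (M' + δ + 1 + dist o ((f ^ k) o) + dist o (r.toFun 0) + k * B)
  set z := r.toFun n with hz
  have h1 : dist ((f ^ k) z) z ≤ k * B := dist_pow_le f (hB n (Nat.cast_nonneg n)) k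
  have h2 : dist z (r.toFun 0) = n := by
    rw [r.dist_eq (Nat.cast_nonneg n) le_rfl, sub_zero, abs_of_nonneg (Nat.cast_nonneg n)]
  have h3 : n - dist o (r.toFun 0) ≤ dist o z := by
    linarith [dist_triangle_left z (r.toFun 0) o]
  have h4 : gprod ((f ^ k) o) ((f ^ k) z) o ≤ M' := by
    have h := hM' n k
    rw [gprod_apply_base, ← IsometryEquiv.mul_apply, inv_mul_cancel, isometryEquiv_one_apply,
      ← inv_pow]
    exact h
  have h5 : gprod ((f ^ k) o) z o = dist o ((f ^ k) o) - gprod o z ((f ^ k) o) := by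
    rw [gprod_comm, gprod_eq_dist_sub, gprod_comm o, dist_comm]
  have h6 := hhyp.min_le ((f ^ k) o) ((f ^ k) z) z o
  have h7 := dist_sub_le_gprod ((f ^ k) o) z ((f ^ k) z)
  rw [dist_comm z] at h7
  have h8 : gprod o z ((f ^ k) o) ≤ M := hM n k
  have h9 := dist_triangle o ((f ^ k) o) z
  rcases min_le_iff.1 h6 with h | h
  · rw [gprod_comm] at h
    linarith
  · rw [h5] at h
    linarith

end FixedPoints

section Conjugation

variable {X : Type*} [MetricSpace X]

theorem setOf_bmap_conj (γ h : X ≃ᵢ X) :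
    {ξ | bmap (γ * h * γ⁻¹) ξ = ξ} = bmap γ '' {ξ | bmap h ξ = ξ} := by
  ext ξ
  simp only [mem_ofPred_eq, mem_image, bmap_mul]
  constructor
  · intro hξ
    refine ⟨bmap γ⁻¹ ξ, ?_, by rw [← bmap_mul, mul_inv_cancel, bmap_one]⟩
    conv_rhs => rw [← hξ]
    rw [← bmap_mul γ⁻¹ γ, inv_mul_cancel, bmap_one]
  · rintro ⟨η, hη, rfl⟩
    rw [← bmap_mul γ⁻¹ γ, inv_mul_cancel, bmap_one, hη]

theorem bmap_injective (γ : X ≃ᵢ X) : Function.Injective (bmap γ) := by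
  intro ξ η h
  rw [← bmap_one ξ, ← bmap_one η, ← inv_mul_cancel γ, bmap_mul, bmap_mul, h]

theorem IsLoxodromic.conj {h : X ≃ᵢ X} (hh : IsLoxodromic h) (γ : X ≃ᵢ X) :
    IsLoxodromic (γ * h * γ⁻¹) := by
  obtain ⟨p, q, hpq, hfix⟩ := hh
  refine ⟨bmap γ p, bmap γ q, (bmap_injective γ).ne hpq, ?_⟩
  rw [setOf_bmap_conj, hfix, image_pair]

/-- The image of a geodesic line under an isometry. -/
def lineMap (g : X ≃ᵢ X) (l : GeodesicLine X) : GeodesicLine X :=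
  ⟨fun t => g (l.toFun t), fun u hu v hv => by
    rw [g.dist_eq]; exact l.geodesic u hu v hv⟩

theorem Joins.map {l : GeodesicLine X} {p q : GromovBoundary X} (h : Joins l p q) (g : X ≃ᵢ X) :
    Joins (lineMap g l) (bmap g p) (bmap g q) := by
  obtain ⟨rfl, rfl⟩ := h
  exact ⟨rfl, rfl⟩

theorem image_axisSet_subset (γ h : X ≃ᵢ X) : γ '' axisSet h ⊆ axisSet (γ * h * γ⁻¹) := by
  rintro _ ⟨x, ⟨l, ⟨p, q, hpq, hfix, hl⟩, t, rfl⟩, rfl⟩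
  refine ⟨lineMap γ l, ⟨bmap γ p, bmap γ q, (bmap_injective γ).ne hpq, ?_, hl.map γ⟩, t, rfl⟩
  rw [setOf_bmap_conj, hfix, image_pair]

theorem axisSet_conj (γ h : X ≃ᵢ X) : axisSet (γ * h * γ⁻¹) = γ '' axisSet h := by
  refine (image_axisSet_subset γ h).antisymm' fun x hx => ?_
  have h1 := image_axisSet_subset γ⁻¹ (γ * h * γ⁻¹) (mem_image_of_mem _ hx)
  rw [show γ⁻¹ * (γ * h * γ⁻¹) * γ⁻¹⁻¹ = h by group] at h1
  exact ⟨_, h1, IsometryEquiv.apply_inv_self _ _⟩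

end Conjugation

section Axis

variable {X : Type*} [MetricSpace X] {δ : ℝ} {o : X} {C : ℝ} {f : X ≃ᵢ X}

theorem GeodesicLine.pt_posRay_ne_negRay (l : GeodesicLine X) : l.posRay.pt ≠ l.negRay.pt := by
  intro h
  obtain ⟨B, hB⟩ := GeodesicRay.pt_eq_iff.1 h
  have h1 := hB (|B| + 1) (by positivity)
  have h2 := l.geodesic (|B| + 1) trivial (-(|B| + 1)) trivial
  simp only [GeodesicLine.posRay, GeodesicLine.negRay] at h1
  rw [h2, sub_neg_eq_add, abs_of_nonneg (by positivity)] at h1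
  linarith [le_abs_self B, abs_nonneg B]

theorem OrbitLoxodromic.exists_line_fixed [ProperSpace X] (hhyp : IsGromovHyperbolic X δ)
    (hgeo : GeodesicSpace X) (hf : OrbitLoxodromic o C f) :
    ∃ l : GeodesicLine X,
      GromovConv o (fun n => l.posRay.toFun n) (fun n => (f ^ n) o) ∧
      GromovConv o (fun n => l.negRay.toFun n) (fun n => (f⁻¹ ^ n) o) ∧
      {ξ | bmap f ξ = ξ} = {l.posRay.pt, l.negRay.pt} := by
  obtain ⟨l, hpos, hneg⟩ := hf.exists_line hhyp hgeo
  refine ⟨l, hpos, hneg, Subset.antisymm (fun ξ hξ => ?_) ?_⟩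
  · obtain ⟨r, rfl⟩ := GeodesicRay.exists_pt_eq ξ
    rcases hf.gromovConv_of_fixed hhyp hξ with h | h
    · exact Or.inl ((GeodesicRay.pt_eq_iff_gromovConv hhyp o).2 (h.trans hhyp hpos.symm))
    · exact Or.inr ((GeodesicRay.pt_eq_iff_gromovConv hhyp o).2 (h.trans hhyp hneg.symm))
  · rintro ξ (rfl | rfl)
    · exact hf.bmap_eq_self hhyp hpos
    · exact bmap_inv_eq_self.1 (hf.inv.bmap_eq_self hhyp hneg)

theorem OrbitLoxodromic.isLoxodromic [ProperSpace X] (hhyp : IsGromovHyperbolic X δ)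
    (hgeo : GeodesicSpace X) (hf : OrbitLoxodromic o C f) : IsLoxodromic f := by
  obtain ⟨l, -, -, hl⟩ := hf.exists_line_fixed hhyp hgeo
  exact ⟨_, _, l.pt_posRay_ne_negRay, hl⟩

theorem OrbitLoxodromic.axisSet_nonempty [ProperSpace X] (hhyp : IsGromovHyperbolic X δ)
    (hgeo : GeodesicSpace X) (hf : OrbitLoxodromic o C f) : (axisSet f).Nonempty := by
  obtain ⟨l, -, -, hl⟩ := hf.exists_line_fixed hhyp hgeo
  exact ⟨l.toFun 0, l, ⟨_, _, l.pt_posRay_ne_negRay, hl, rfl, rfl⟩, 0, rfl⟩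

theorem GeodesicLine.exists_gprod_le (hhyp : IsGromovHyperbolic X δ) (l : GeodesicLine X)
    {x y : ℕ → X} (hx : GromovConv o (fun n => l.posRay.toFun n) x)
    (hy : GromovConv o (fun n => l.negRay.toFun n) y) (t : ℝ) :
    ∃ n, gprod (l.toFun t) (x n) (y n) ≤ 2 * δ := by
  obtain ⟨N, hN⟩ := hx.base (l.toFun t) (2 * δ + 1)
  obtain ⟨N', hN'⟩ := hy.base (l.toFun t) (2 * δ + 1)
  obtain ⟨m, hm⟩ := exists_nat_ge |t|
  set n := max (max N N') m with hn
  have h1 := hN n (le_sup_of_le_left le_sup_left) n (le_sup_of_le_left le_sup_left)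
  have h2 := hN' n (le_sup_of_le_left le_sup_right) n (le_sup_of_le_left le_sup_right)
  have hnt : |t| ≤ n := hm.trans (Nat.cast_le.2 le_sup_right)
  obtain ⟨ht1, ht2⟩ := abs_le.1 hnt
  have e1 := l.geodesic n trivial t trivial
  have e2 := l.geodesic (-n) trivial t trivial
  have e3 := l.geodesic n trivial (-n) trivial
  rw [abs_of_nonneg (by linarith)] at e1 e3
  rw [abs_of_nonpos (by linarith)] at e2
  have e4 : gprod (l.toFun t) (l.posRay.toFun n) (l.negRay.toFun n) = 0 := by
    simp only [gprod, GeodesicLine.posRay, GeodesicLine.negRay]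
    rw [e1, e2, e3]
    ring
  have e5 := hhyp.min_min_le (l.toFun t) (l.posRay.toFun n) (x n) (y n) (l.negRay.toFun n)
  rw [e4, gprod_comm _ (y n)] at e5
  refine ⟨n, ?_⟩
  rcases min_le_iff.1 e5 with h | h
  · linarith
  · rcases min_le_iff.1 h with h | h <;> linarith

/-- The powers of a loxodromic isometry act coboundedly on its axis. -/
theorem OrbitLoxodromic.dist_axis_le [ProperSpace X] (hhyp : IsGromovHyperbolic X δ)
    (hgeo : GeodesicSpace X) (hf : OrbitLoxodromic o C f) {z : X} (hz : z ∈ axisSet f) :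
    ∃ k : ℤ, dist z ((f ^ k) o) ≤ 2 * (C + δ + dist o (f o)) + 2 * δ := by
  obtain ⟨l, hpos, hneg, hl⟩ := hf.exists_line_fixed hhyp hgeo
  obtain ⟨l', ⟨p, q, hpq, hfix, hjoin⟩, t, rfl⟩ := hz
  obtain ⟨rfl, rfl⟩ := hjoin
  have hsuff : ∀ n : ℕ, gprod (l'.toFun t) ((f⁻¹ ^ n) o) ((f ^ n) o) ≤ 2 * δ →
      ∃ k : ℤ, dist (l'.toFun t) ((f ^ k) o) ≤ 2 * (C + δ + dist o (f o)) + 2 * δ := by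
    intro n hn
    refine hf.exists_dist_le hhyp (n := n) ?_
    rwa [zpow_neg, zpow_natCast, ← inv_pow]
  rw [hl, pair_eq_pair_iff] at hfix
  rcases hfix with ⟨h1, h2⟩ | ⟨h1, h2⟩
  · obtain ⟨n, hn⟩ := l'.exists_gprod_le hhyp (t := t)
      (((GeodesicRay.pt_eq_iff_gromovConv hhyp o).1 h1.symm).trans hhyp hpos)
      (((GeodesicRay.pt_eq_iff_gromovConv hhyp o).1 h2.symm).trans hhyp hneg)
    exact hsuff n (by rwa [gprod_comm])
  · obtain ⟨n, hn⟩ := l'.exists_gprod_le hhyp (t := t)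
      (((GeodesicRay.pt_eq_iff_gromovConv hhyp o).1 h2.symm).trans hhyp hneg)
      (((GeodesicRay.pt_eq_iff_gromovConv hhyp o).1 h1.symm).trans hhyp hpos)
    exact hsuff n hn

end Axis

section Groups

variable {X : Type*} [MetricSpace X] {δ : ℝ} {o : X} {C : ℝ} {f : X ≃ᵢ X}

theorem exists_orbitLoxodromic_of_limitSet (hδ : 0 ≤ δ) (hhyp : IsGromovHyperbolic X δ)
    {Γ : Subgroup (X ≃ᵢ X)} {a b : GromovBoundary X} (ha : a ∈ limitSet Γ o)
    (hb : b ∈ limitSet Γ o) (hab : a ≠ b) : ∃ f ∈ Γ, ∃ C, OrbitLoxodromic o C f := by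
  by_contra! hno
  obtain ⟨g, hg, r, rfl, hr⟩ := ha
  obtain ⟨h, hh, s, rfl, hs⟩ := hb
  refine hab ((GeodesicRay.pt_eq_iff_gromovConv hhyp o).2 ?_)
  have hr' : GromovConv o (fun n => (g n : X ≃ᵢ X) o) (fun n => r.toFun n) :=
    gromovConv_of_tendsto hr
  have hs' : GromovConv o (fun n => (h n : X ≃ᵢ X) o) (fun n => s.toFun n) :=
    gromovConv_of_tendsto hs
  suffices GromovConv o (fun n => (g n : X ≃ᵢ X) o) (fun n => (h n : X ≃ᵢ X) o) from
    (hr'.symm.trans hhyp this).trans hhyp hs'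
  intro M
  obtain ⟨N, hN⟩ := eventually_atTop.1 (tendsto_atTop.1 hg (2 * M + 6 * δ))
  obtain ⟨N', hN'⟩ := eventually_atTop.1 (tendsto_atTop.1 hh (2 * M + 6 * δ))
  refine ⟨max N N', fun i hi j hj => ?_⟩
  have h1 := min_dist_le_gprod hδ hhyp o Γ hno (g i).2 (h j).2
  have h2 := le_min (hN i ((le_max_left _ _).trans hi)) (hN' j ((le_max_right _ _).trans hj))
  linarith

theorem OrbitLoxodromic.pow (hf : OrbitLoxodromic o C f) {p : ℕ} (hp : 0 < p) :
    OrbitLoxodromic o C (f ^ p) := by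
  have hp' : (0 : ℤ) ≤ p := by omega
  refine ⟨fun i j k hij hjk => ?_, ?_⟩
  · rw [← zpow_natCast f p, ← zpow_mul, ← zpow_mul, ← zpow_mul]
    exact hf.1 _ _ _ (mul_le_mul_of_nonneg_left hij hp') (mul_le_mul_of_nonneg_left hjk hp')
  · simp only [← pow_mul]
    exact hf.2.comp (tendsto_id.const_mul_atTop' hp)

/-- The conjugate `f h f⁻¹` moves `o` in the direction of `f o`, up to the displacement of `h`. -/
theorem sub_le_gprod_conj (o : X) (f h : X ≃ᵢ X) :
    (dist o ((f * h * f⁻¹) o) - dist o (h o)) / 2 ≤ gprod o (f o) ((f * h * f⁻¹) o) := by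
  have h1 := dist_triangle (f o) (f (h o)) (f (h (f⁻¹ o)))
  rw [f.dist_eq o (h o), f.dist_eq (h o), h.dist_eq, dist_inv_apply] at h1
  simp only [IsometryEquiv.mul_apply]
  unfold gprod
  linarith [dist_comm o (f o), dist_comm o (f (h (f⁻¹ o)))]

/-- If `H` has no loxodromic element, then the conjugates of `h ∈ H` by the powers of `f` stay
bounded in at least one direction. -/
theorem OrbitLoxodromic.bounded_conj (hδ : 0 ≤ δ) (hhyp : IsGromovHyperbolic X δ)
    (hf : OrbitLoxodromic o C f) (H : Subgroup (X ≃ᵢ X))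
    (hH : ∀ g ∈ H, ∀ C, ¬ OrbitLoxodromic o C g) {h : X ≃ᵢ X}
    (hconj : ∀ k : ℤ, f ^ k * h * (f ^ k)⁻¹ ∈ H) :
    (∃ B, ∀ k : ℕ, dist o ((f ^ k * h * (f ^ k)⁻¹) o) ≤ B) ∨
      ∃ B, ∀ k : ℕ, dist o ((f⁻¹ ^ k * h * (f⁻¹ ^ k)⁻¹) o) ≤ B := by
  by_contra! hcon
  set B := 2 * (C + 2 * δ + 1) + dist o (h o) + 12 * δ + 2 * (C + 2 * δ + 1)
  have hC : 0 ≤ C := (gprod_nonneg _ _ _).trans (hf.gprod_inv_le 0 0)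
  obtain ⟨k, hk⟩ := hcon.1 B
  obtain ⟨j, hj⟩ := hcon.2 B
  have hd : 0 ≤ dist o (h o) := dist_nonneg
  have h1 := sub_le_gprod_conj o (f ^ k) h
  have h2 := sub_le_gprod_conj o (f⁻¹ ^ j) h
  have m1 : f ^ k * h * (f ^ k)⁻¹ ∈ H := by simpa using hconj k
  have m2 : f⁻¹ ^ j * h * (f⁻¹ ^ j)⁻¹ ∈ H := by simpa using hconj (-j)
  have h3 := min_dist_le_gprod hδ hhyp o H hH m1 m2
  have h4 := lt_min hk hj
  have h5 := hhyp.min_min_le o ((f ^ k) o) ((f ^ k * h * (f ^ k)⁻¹) o)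
    ((f⁻¹ ^ j * h * (f⁻¹ ^ j)⁻¹) o) ((f⁻¹ ^ j) o)
  have h6 := hf.gprod_inv_le j k
  rw [gprod_comm] at h6
  rw [gprod_comm o _ ((f⁻¹ ^ j) o)] at h5
  simp only [B] at hk hj h4
  rcases min_le_iff.1 h5 with h | h
  · linarith
  · rcases min_le_iff.1 h with h | h <;> linarith

/-- Pigeonhole: bounded conjugates force `h` to commute with a power of `f`. -/
theorem exists_commute_pow {Γ : Subgroup (X ≃ᵢ X)} (hproper : ProperAct Γ) {h : X ≃ᵢ X}
    (hf : f ∈ Γ) (hh : h ∈ Γ) {B : ℝ} (hB : ∀ k : ℕ, dist o ((f ^ k * h * (f ^ k)⁻¹) o) ≤ B) :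
    ∃ p : ℕ, 0 < p ∧ Commute h (f ^ p) := by
  have hmaps : ∀ k : ℕ, f ^ k * h * (f ^ k)⁻¹ ∈ {g : X ≃ᵢ X | g ∈ Γ ∧ dist o (g o) ≤ B} :=
    fun k => ⟨Γ.mul_mem (Γ.mul_mem (Γ.pow_mem hf k) hh) (Γ.inv_mem (Γ.pow_mem hf k)), hB k⟩
  have hninj : ¬ Function.Injective fun k : ℕ => f ^ k * h * (f ^ k)⁻¹ := fun hinj =>
    (infinite_range_of_injective hinj) ((hproper o B).subset (range_subset_iff.2 hmaps))
  have key : ∀ k l : ℕ, k < l → f ^ k * h * (f ^ k)⁻¹ = f ^ l * h * (f ^ l)⁻¹ →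
      ∃ p : ℕ, 0 < p ∧ Commute h (f ^ p) := by
    intro k l hkl heq
    refine ⟨l - k, by omega, ?_⟩
    obtain ⟨d, rfl⟩ := Nat.exists_eq_add_of_lt hkl
    rw [show k + d + 1 - k = d + 1 by omega]
    rw [add_assoc, pow_add, mul_inv_rev] at heq
    have h1 : h = f ^ (d + 1) * h * (f ^ (d + 1))⁻¹ := by
      have h2 := congrArg (fun g => (f ^ k)⁻¹ * g * f ^ k) heq
      simpa [mul_assoc] using h2
    rw [eq_mul_inv_iff_mul_eq] at h1
    exact h1
  simp only [Function.Injective, not_forall] at hninj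
  obtain ⟨k, l, heq, hne⟩ := hninj
  rcases lt_or_gt_of_ne hne with hlt | hlt
  · exact key k l hlt heq
  · exact key l k hlt heq.symm

/-- An isometry commuting with a power of `f` moves `o` near the orbit of `o` under `f`. -/
theorem OrbitLoxodromic.dist_apply_le (hhyp : IsGromovHyperbolic X δ)
    (hf : OrbitLoxodromic o C f) {h : X ≃ᵢ X} {p : ℕ} (hp : 0 < p) (hcomm : Commute h (f ^ p)) :
    ∃ k : ℤ, dist (h o) ((f ^ k) o) ≤ 2 * (C + δ + dist o (f o)) + (C + 2 * δ) := by
  have htend : Tendsto (fun n : ℕ => dist o ((f ^ (p * n)) o)) atTop atTop :=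
    hf.2.comp (tendsto_id.const_mul_atTop' hp)
  obtain ⟨n, hn⟩ := (tendsto_atTop.1 htend (C + 2 * δ + dist o (h o) + 1)).exists
  refine hf.exists_dist_le hhyp (n := p * n) ?_
  rw [zpow_neg, zpow_natCast]
  have hc : Commute h (f ^ (p * n)) := by rw [pow_mul]; exact hcomm.pow_right n
  set g := f ^ (p * n) with hg
  have e1 : gprod (h o) (h (g⁻¹ o)) (h (g o)) ≤ C := by
    rw [gprod_map, hg, ← inv_pow]
    exact hf.gprod_inv_le _ _
  have d1 : dist (h (g⁻¹ o)) (g⁻¹ o) = dist o (h o) := by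
    rw [← IsometryEquiv.mul_apply, hc.inv_right.eq, IsometryEquiv.mul_apply,
      IsometryEquiv.dist_eq, dist_comm]
  have d2 : dist (h (g o)) (g o) = dist o (h o) := by
    rw [← IsometryEquiv.mul_apply, hc.eq, IsometryEquiv.mul_apply,
      IsometryEquiv.dist_eq, dist_comm]
  have e2 := dist_sub_le_gprod (h o) (h (g⁻¹ o)) (g⁻¹ o)
  have e3 := dist_sub_le_gprod (h o) (h (g o)) (g o)
  rw [h.dist_eq, dist_inv_apply, d1] at e2
  rw [h.dist_eq, d2, gprod_comm] at e3
  have e4 := hhyp.min_min_le (h o) (h (g⁻¹ o)) (g⁻¹ o) (g o) (h (g o))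
  rcases min_le_iff.1 e4 with h1 | h1
  · linarith
  · rcases min_le_iff.1 h1 with h2 | h2 <;> linarith

theorem zpow_mem_of_ne {G : Type*} [Group G] {H : Subgroup G} {g : G} {m : ℤ} (hm : m ≠ 0)
    (h : g ^ m ∈ H) : ∃ p : ℕ, 0 < p ∧ g ^ p ∈ H := by
  refine ⟨m.natAbs, Int.natAbs_pos.2 hm, ?_⟩
  rcases Int.natAbs_eq m with h1 | h1
  · rw [h1, zpow_natCast] at h; exact h
  · rw [h1, zpow_neg, zpow_natCast, inv_mem_iff] at h; exact h

/-- An infinite normal subgroup of a group with a loxodromic element contains a loxodromic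
element. -/
theorem exists_orbitLoxodromic_mem_normal (hδ : 0 ≤ δ) (hhyp : IsGromovHyperbolic X δ)
    {Γ G : Subgroup (X ≃ᵢ X)} (hproper : ProperAct Γ) (hle : G ≤ Γ)
    (hnormal : ∀ γ ∈ Γ, ∀ g ∈ G, γ * g * γ⁻¹ ∈ G) (hGinf : (G : Set (X ≃ᵢ X)).Infinite)
    (hfΓ : f ∈ Γ) (hf : OrbitLoxodromic o C f) : ∃ h ∈ G, ∃ C, OrbitLoxodromic o C h := by
  by_contra! hno
  have hcomm : ∀ h ∈ G, ∃ p : ℕ, 0 < p ∧ Commute h (f ^ p) := by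
    intro h hh
    rcases hf.bounded_conj hδ hhyp G hno (h := h)
      (fun k => hnormal _ (Γ.zpow_mem hfΓ k) h hh) with ⟨B, hB⟩ | ⟨B, hB⟩
    · exact exists_commute_pow hproper hfΓ (hle hh) hB
    · obtain ⟨p, hp, hc⟩ := exists_commute_pow hproper (Γ.inv_mem hfΓ) (hle hh) hB
      rw [inv_pow] at hc
      exact ⟨p, hp, Commute.inv_right_iff.1 hc⟩
  have hnear : ∀ h : G, ∃ k : ℤ, dist o ((f ^ (-k) * (h : X ≃ᵢ X)) o) ≤
      2 * (C + δ + dist o (f o)) + (C + 2 * δ) := by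
    rintro ⟨h, hh⟩
    obtain ⟨p, hp, hc⟩ := hcomm h hh
    obtain ⟨k, hk⟩ := hf.dist_apply_le hhyp hp hc
    refine ⟨k, ?_⟩
    rwa [dist_mul_apply, zpow_neg, inv_inv, dist_comm]
  choose k hk using hnear
  have : Infinite G := hGinf.to_subtype
  have hninj : ¬ Function.Injective fun h : G => f ^ (-k h) * (h : X ≃ᵢ X) := fun hinj =>
    (infinite_range_of_injective hinj) ((hproper o _).subset (range_subset_iff.2 fun h =>
      ⟨Γ.mul_mem (Γ.zpow_mem hfΓ _) (hle h.2), hk h⟩))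
  simp only [Function.Injective, not_forall] at hninj
  obtain ⟨a, b, heq, hne⟩ := hninj
  have hmem : f ^ (k a - k b) ∈ G := by
    have h1 : f ^ (k a - k b) = (a : X ≃ᵢ X) * (b : X ≃ᵢ X)⁻¹ := by
      rw [eq_mul_inv_iff_mul_eq, sub_eq_add_neg, zpow_add, mul_assoc, ← heq, ← mul_assoc,
        ← zpow_add, add_neg_cancel, zpow_zero, one_mul]
    rw [h1]
    exact G.mul_mem a.2 (G.inv_mem b.2)
  have hk0 : k a - k b ≠ 0 := by
    intro h0
    refine hne (Subtype.ext ?_)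
    have h1 : k a = k b := by omega
    simpa [h1] using heq
  obtain ⟨p, hp, hpG⟩ := zpow_mem_of_ne hk0 hmem
  exact hno _ hpG C (hf.pow hp)

end Groups

section GAxisTranslates

variable {X : Type*} [MetricSpace X] {G Γ : Subgroup (X ≃ᵢ X)}

theorem GAxis_conj (hnormal : ∀ γ ∈ Γ, ∀ g ∈ G, γ * g * γ⁻¹ ∈ G) {γ : X ≃ᵢ X} (hγ : γ ∈ Γ)
    (h : X ≃ᵢ X) : GAxis G (γ * h * γ⁻¹) = γ '' GAxis G h := by
  ext x
  simp only [GAxis, mem_iUnion, exists_prop, axisSet_conj, SetLike.mem_coe, mem_image]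
  constructor
  · rintro ⟨g, hg, _, ⟨z, hz, rfl⟩, rfl⟩
    refine ⟨(γ⁻¹ * g * γ) z, ⟨γ⁻¹ * g * γ, ?_, z, hz, rfl⟩, ?_⟩
    · simpa using hnormal γ⁻¹ (Γ.inv_mem hγ) g hg
    · simp only [IsometryEquiv.mul_apply, IsometryEquiv.apply_inv_self]
  · rintro ⟨_, ⟨g, hg, z, hz, rfl⟩, rfl⟩
    refine ⟨γ * g * γ⁻¹, hnormal γ hγ g hg, γ z, ⟨z, hz, rfl⟩, ?_⟩
    simp only [IsometryEquiv.mul_apply, IsometryEquiv.inv_apply_self]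

theorem subset_GAxis (h : X ≃ᵢ X) : axisSet h ⊆ GAxis G h := fun x hx =>
  mem_iUnion₂.2 ⟨1, G.one_mem, x, hx, rfl⟩

/-- Translates of `G·Ax(h)` by representatives of distinct cosets of `G` escape to infinity. -/
theorem OrbitLoxodromic.tendsto_infDist_image_GAxis [ProperSpace X] {δ C : ℝ} {o : X}
    {h : X ≃ᵢ X} (hhyp : IsGromovHyperbolic X δ) (hgeo : GeodesicSpace X) (hproper : ProperAct Γ)
    (hle : G ≤ Γ) (hh : h ∈ G) (hlox : OrbitLoxodromic o C h) {γ : ℕ → X ≃ᵢ X}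
    (hγ : ∀ n, γ n ∈ Γ) (hinj : ∀ m n, (γ m)⁻¹ * γ n ∈ G → m = n) :
    Tendsto (fun n => infDist o (γ n '' GAxis G h)) atTop atTop := by
  refine tendsto_atTop.2 fun R => ?_
  set K := 2 * (C + δ + dist o (h o)) + 2 * δ
  set F := {f : X ≃ᵢ X | f ∈ Γ ∧ dist o (f o) ≤ R + K}
  have hF : F.Finite := hproper o (R + K)
  set S := {n : ℕ | ∃ f ∈ F, (γ n)⁻¹ * f ∈ G}
  have hS : S.Finite := by
    have hex : ∀ n : S, ∃ f : F, (γ n)⁻¹ * f ∈ G := fun n => by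
      obtain ⟨f, hf, hfG⟩ := n.2
      exact ⟨⟨f, hf⟩, hfG⟩
    choose φ hφ using hex
    have hφinj : Function.Injective φ := fun m n hmn => Subtype.ext (hinj _ _ (by
      have h1 := G.mul_mem (hφ m) (G.inv_mem (hφ n))
      rw [hmn] at h1
      simpa using h1))
    have : Finite F := hF.to_subtype
    have : Finite S := Finite.of_injective φ hφinj
    exact S.toFinite
  have hev : ∀ᶠ n in atTop, n ∉ S := by
    rw [← Nat.cofinite_eq_atTop]
    exact hS.eventually_cofinite_notMem
  filter_upwards [hev] with n hn
  refine (le_infDist (((hlox.axisSet_nonempty hhyp hgeo).mono (subset_GAxis h)).image _)).2 ?_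
  rintro _ ⟨y, hy, rfl⟩
  obtain ⟨g, hg, z, hz, rfl⟩ := mem_iUnion₂.1 hy
  obtain ⟨k, hk⟩ := hlox.dist_axis_le hhyp hgeo hz
  by_contra! hlt
  refine hn ⟨γ n * g * h ^ k, ⟨Γ.mul_mem (Γ.mul_mem (hγ n) (hle hg)) (Γ.zpow_mem (hle hh) k), ?_⟩,
    ?_⟩
  · have h1 := dist_triangle o (γ n (g z)) (γ n (g ((h ^ k) o)))
    rw [(γ n).dist_eq, g.dist_eq] at h1
    simp only [IsometryEquiv.mul_apply]
    linarith
  · rw [← mul_assoc, ← mul_assoc, inv_mul_cancel, one_mul]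
    exact G.mul_mem hg (G.zpow_mem hh k)

theorem exists_seq_distinct_cosets (hindex : (G.subgroupOf Γ).index = 0) :
    ∃ γ : ℕ → X ≃ᵢ X, (∀ n, γ n ∈ Γ) ∧ ∀ m n, (γ m)⁻¹ * γ n ∈ G → m = n := by
  have : Infinite (Γ ⧸ G.subgroupOf Γ) := Subgroup.index_eq_zero_iff_infinite.1 hindex
  let e := Infinite.natEmbedding (Γ ⧸ G.subgroupOf Γ)
  refine ⟨fun n => ((e n).out : Γ), fun n => (e n).out.2, fun m n hmn => e.injective ?_⟩
  rw [← QuotientGroup.out_eq' (e m), ← QuotientGroup.out_eq' (e n), QuotientGroup.eq]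
  exact Subgroup.mem_subgroupOf.2 hmn

end GAxisTranslates

end GromovScaffold

/-- escaping loxodromic elements in normal subgroups. -/
theorem escaping_loxodromics_of_normal_subgroup
    {X : Type*} [MetricSpace X] [ProperSpace X]
    (δ : ℝ) (hδ : 0 ≤ δ) (hhyp : IsGromovHyperbolic X δ) (hgeo : GeodesicSpace X)
    (Γ G : Subgroup (X ≃ᵢ X)) (hproper : ProperAct Γ)
    (o : X) (hnonelem : NonElementary Γ o)
    (hle : G ≤ Γ)
    (hnormal : ∀ γ ∈ Γ, ∀ g ∈ G, γ * g * γ⁻¹ ∈ G)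
    (hGinf : (G : Set (X ≃ᵢ X)).Infinite)
    (hindex : (G.subgroupOf Γ).index = 0) :
    ∃ h : ℕ → X ≃ᵢ X,
      (∀ n, h n ∈ G) ∧ (∀ n, IsLoxodromic (h n)) ∧
      Filter.Tendsto (fun n => Metric.infDist o (GAxis G (h n))) Filter.atTop Filter.atTop ∧
      ∃ γ : ℕ → X ≃ᵢ X, (∀ n, γ n ∈ Γ) ∧
        ∀ n, GAxis G (h n) = (γ n) '' GAxis G (h 0) := by
  obtain ⟨a, b, -, ha, hb, -, hab, -, -⟩ := hnonelem
  obtain ⟨f, hfΓ, C, hf⟩ := exists_orbitLoxodromic_of_limitSet hδ hhyp ha hb hab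
  obtain ⟨h, hh, C', hlox⟩ :=
    exists_orbitLoxodromic_mem_normal hδ hhyp hproper hle hnormal hGinf hfΓ hf
  obtain ⟨γ, hγ, hinj⟩ := exists_seq_distinct_cosets hindex
  have himage : ∀ n, GAxis G (γ n * h * (γ n)⁻¹) = γ n '' GAxis G h := fun n =>
    GAxis_conj hnormal (hγ n) h
  refine ⟨fun n => γ n * h * (γ n)⁻¹, fun n => hnormal _ (hγ n) h hh,
    fun n => (hlox.isLoxodromic hhyp hgeo).conj (γ n), ?_,
    fun n => γ n * (γ 0)⁻¹, fun n => Γ.mul_mem (hγ n) (Γ.inv_mem (hγ 0)), fun n => ?_⟩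
  · simp only [himage]
    exact hlox.tendsto_infDist_image_GAxis hhyp hgeo hproper hle hh hγ hinj
  · rw [himage, himage, image_image]
    simp only [IsometryEquiv.mul_apply, IsometryEquiv.inv_apply_self]
end
end
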